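/- For every integer m ≥ 1, every list of total degrees d_1,…,d_m and every integer n ≥ 3, there exists a constant C = C(m, d_1,…,d_m, n) with the following property. Let q be a prime power of characteristic p, and let F_1,…,F_m ∈ F_q[t][x] be pairwise non-associate polynomials with deg F_i = d_i and deg_x F_i = r_i > 0, each monic in x, each irreducible over the algebraic closure of F_q (absolutely irreducible), each separable over F_q(t) (F_i ∉ F_q[t][x^p]), and suppose n ≥ sl F_i for 1 ≤ i ≤ m. Set N_i = r_i n and fix, for each i, a partition N_i = Σ_{k=1}^{M_i} s_{ik} with s_{ik} ≥ 1. Then the number of f ∈ F_q[t] with deg f = n such that for each i the polynomial F_i(t,f) decomposes in F_q[t] into M_i irreducible factors of degrees s_{i1},…,s_{iM_i} differs from (∏_{i=1}^m P(s_{i1},…,s_{iM_i}))·q^{n+1} by at most C·q^{n+1/2}, where P(s_{i1},…,s_{iM_i}) is the probability that a uniformly random permutation in S_{N_i} has cycle structure (s_{i1},…,s_{iM_i}). -/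

import Mathlib

open Polynomial

/-- The slope of `P(t,x) = Σ_{j=0}^r c_j(t) x^j ∈ K[t][x]` monic in `x` (with `x` the
outer variable): `sl P = max_{1 ≤ j ≤ r} deg c_{r-j}(t) / j`, where `deg 0 = ⊥`. -/
noncomputable def slopeX {K : Type} [Field K] (P : Polynomial (Polynomial K)) : WithBot ℚ :=
  (Finset.Icc 1 P.natDegree).sup fun j =>
    ((P.coeff (P.natDegree - j)).degree).map fun d : ℕ => (d : ℚ) / (j : ℚ)

/-- The total degree of a polynomial `P ∈ K[t][x]` (with `x` the outer variable). -/
noncomputable def totalDeg {K : Type} [Field K] (P : Polynomial (Polynomial K)) : ℕ :=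
  (Finset.range (P.natDegree + 1)).sup fun j => j + (P.coeff j).natDegree

/-- The probability that a uniformly random permutation of `N` letters has cycle
structure given by the multiset of the values of `s : Fin M → ℕ` (a partition of `N`);
cycle structures are compared via Mathlib's `cycleType`, which omits fixed points. -/
noncomputable def cycleStructureProb (N : ℕ) {M : ℕ} (s : Fin M → ℕ) : ℝ :=
  (Nat.card {σ : Equiv.Perm (Fin N) //
      σ.cycleType = Multiset.filter (fun a => 2 ≤ a) (List.ofFn s : Multiset ℕ)} : ℝ) /
    (Nat.factorial N : ℝ)


namespace BH

section A1
variable {k : Type} [Field k]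

/-- the weight filtration on `k[u][y]`: `u` has weight `1`, `y` has weight `D`. -/
noncomputable def Wt (k : Type) [Field k] (D e : ℕ) : Submodule k k[X][X] where
  carrier := {A | ∀ s i, (A.coeff s).coeff i ≠ 0 → i + D * s ≤ e}
  add_mem' := by
    intro a b ha hb s i h
    by_contra hc
    have h1 : (a.coeff s).coeff i = 0 := by by_contra h1; exact hc (ha s i h1)
    have h2 : (b.coeff s).coeff i = 0 := by by_contra h1; exact hc (hb s i h1)
    simp [h1, h2] at h
  zero_mem' := by intro s i h; simp at h
  smul_mem' := by
    intro c a ha s i h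
    apply ha s i
    intro h0
    simp [coeff_smul, h0] at h

theorem mem_Wt {D e : ℕ} {A : k[X][X]} :
    A ∈ Wt k D e ↔ ∀ s i, (A.coeff s).coeff i ≠ 0 → i + D * s ≤ e := Iff.rfl

theorem Wt_mono {D e e' : ℕ} (h : e ≤ e') {A : k[X][X]} (hA : A ∈ Wt k D e) : A ∈ Wt k D e' :=
  fun s i hs => (hA s i hs).trans h

theorem Wt_mul {D e e' : ℕ} {A B : k[X][X]} (hA : A ∈ Wt k D e) (hB : B ∈ Wt k D e') :
    A * B ∈ Wt k D (e + e') := by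
  intro s i h
  rw [coeff_mul, finsetSum_coeff] at h
  obtain ⟨⟨a, b⟩, hab, h⟩ := Finset.exists_ne_zero_of_sum_ne_zero h
  rw [coeff_mul] at h
  obtain ⟨⟨c, d⟩, hcd, h⟩ := Finset.exists_ne_zero_of_sum_ne_zero h
  have h1 := hA a c (left_ne_zero_of_mul h)
  have h2 := hB b d (right_ne_zero_of_mul h)
  have hab' : a + b = s := by simpa using hab
  have hcd' : c + d = i := by simpa using hcd
  subst hab' hcd'
  nlinarith

theorem Wt_mon {D : ℕ} (i s : ℕ) (c : k) :
    (C (C c * X ^ i) * X ^ s : k[X][X]) ∈ Wt k D (i + D * s) := by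
  intro s' i' h
  rw [coeff_C_mul, coeff_X_pow] at h
  split_ifs at h with h1
  · rw [mul_one, coeff_C_mul, coeff_X_pow] at h
    split_ifs at h with h2
    · subst h1 h2; exact le_rfl
    · simp at h
  · simp at h

theorem Wt_one {D : ℕ} : (1 : k[X][X]) ∈ Wt k D 0 := by
  simpa using Wt_mon (D := D) 0 0 (1 : k)

theorem Wt_pow {D e : ℕ} {A : k[X][X]} (hA : A ∈ Wt k D e) (n : ℕ) : A ^ n ∈ Wt k D (n * e) := by
  induction n with
  | zero => simpa using Wt_one
  | succ n ih => rw [pow_succ, add_mul, one_mul]; exact Wt_mul ih hA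

theorem Wt_X {D : ℕ} : (X : k[X][X]) ∈ Wt k D D := by
  simpa using Wt_mon (D := D) 0 1 (1 : k)

theorem Wt_CX {D : ℕ} : (C X : k[X][X]) ∈ Wt k D 1 := by
  simpa using Wt_mon (D := D) 1 0 (1 : k)

theorem Wt_CC {D : ℕ} (c : k) : (C (C c) : k[X][X]) ∈ Wt k D 0 := by
  simpa using Wt_mon (D := D) 0 0 c

theorem exists_Wt (D : ℕ) (A : k[X][X]) : ∃ e, A ∈ Wt k D e := by
  induction A using Polynomial.induction_on' with
  | add p q hp hq =>
    obtain ⟨e, he⟩ := hp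
    obtain ⟨f, hf⟩ := hq
    exact ⟨max e f, add_mem (Wt_mono (le_max_left _ _) he) (Wt_mono (le_max_right _ _) hf)⟩
  | monomial n a =>
    refine ⟨a.natDegree + D * n, ?_⟩
    intro s i h
    rw [coeff_monomial] at h
    split_ifs at h with h1
    · subst h1
      have := le_natDegree_of_ne_zero h
      omega
    · simp at h

/-- partial derivative in the inner variable -/
noncomputable def du : k[X][X] →ₗ[k] k[X][X] where
  toFun A := A.sum fun s a => monomial s (derivative a)
  map_add' := by
    intro a b
    apply sum_add_index <;> simp
  map_smul' := by
    intro c a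
    rw [sum_smul_index' _ _ _ (by simp)]
    simp only [RingHom.id_apply, Polynomial.sum, Finset.smul_sum]
    refine Finset.sum_congr rfl fun s _ => ?_
    rw [smul_monomial, derivative_smul]

theorem du_coeff (A : k[X][X]) (s : ℕ) : (du A).coeff s = derivative (A.coeff s) := by
  simp only [du, LinearMap.coe_mk, AddHom.coe_mk, Polynomial.sum, finsetSum_coeff, coeff_monomial]
  simp +contextual [Finset.sum_ite_eq']

theorem Wt_du {D e : ℕ} {A : k[X][X]} (hA : A ∈ Wt k D e) : du A ∈ Wt k D e := by
  intro s i h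
  rw [du_coeff, coeff_derivative] at h
  have := hA s (i+1) (left_ne_zero_of_mul h)
  omega

theorem Wt_dy {D e : ℕ} {A : k[X][X]} (hA : A ∈ Wt k D e) : derivative A ∈ Wt k D e := by
  intro s i h
  rw [coeff_derivative] at h
  have h2 : (A.coeff (s+1)).coeff i ≠ 0 := by
    intro h0
    apply h
    have : ((s : k[X]) + 1) = C ((s : k) + 1) := by simp
    rw [this, coeff_mul_C, h0, zero_mul]
  have := hA (s+1) i h2
  nlinarith

theorem du_mul (A B : k[X][X]) : du (A * B) = du A * B + A * du B := by
  ext1 s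
  rw [du_coeff, coeff_mul, coeff_add, coeff_mul, coeff_mul, derivative_sum, ← Finset.sum_add_distrib]
  refine Finset.sum_congr rfl fun x _ => ?_
  rw [derivative_mul, du_coeff, du_coeff]

theorem du_C (a : k[X]) : du (C a) = C (derivative a) := by
  ext1 s
  rw [du_coeff, coeff_C, coeff_C]
  split_ifs <;> simp

theorem du_X : du (X : k[X][X]) = 0 := by
  ext1 s
  rw [du_coeff, coeff_X]
  split_ifs <;> simp

/-- tangent derivation to the curve `Θ = 0`. -/
noncomputable def dT (Θ : k[X][X]) : k[X][X] →ₗ[k] k[X][X] where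
  toFun A := derivative Θ * du A - du Θ * derivative A
  map_add' := by intro a b; simp; ring
  map_smul' := by
    intro c a
    simp only [map_smul, RingHom.id_apply, derivative_smul]
    rw [mul_smul_comm, mul_smul_comm, smul_sub]

theorem dT_apply (Θ A : k[X][X]) : dT Θ A = derivative Θ * du A - du Θ * derivative A := rfl

theorem Wt_dT {D e e' : ℕ} {Θ A : k[X][X]} (hΘ : Θ ∈ Wt k D e') (hA : A ∈ Wt k D e) :
    dT Θ A ∈ Wt k D (e + e') := by
  rw [dT_apply, add_comm e]
  exact sub_mem (Wt_mul (Wt_dy hΘ) (Wt_du hA)) (Wt_mul (Wt_du hΘ) (Wt_dy hA))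

theorem Wt_dT_iter {D e e' : ℕ} {Θ A : k[X][X]} (hΘ : Θ ∈ Wt k D e') (hA : A ∈ Wt k D e) (l : ℕ) :
    (dT Θ)^[l] A ∈ Wt k D (e + l * e') := by
  induction l with
  | zero => simpa using hA
  | succ l ih =>
    rw [Function.iterate_succ_apply']
    refine Wt_mono (le_of_eq ?_) (Wt_dT hΘ ih)
    ring

theorem dT_mul (Θ A B : k[X][X]) : dT Θ (A * B) = dT Θ A * B + A * dT Θ B := by
  simp only [dT_apply, du_mul, derivative_mul]
  ring

theorem dT_pow_char (p : ℕ) [Fact p.Prime] [CharP k p] (Θ A : k[X][X]) (n : ℕ) (hn : n ≠ 0) :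
    dT Θ (A ^ (p ^ n)) = 0 := by
  have key : ∀ (m : ℕ), dT Θ (A ^ (m+1)) = (m+1 : ℕ) • (A ^ m * dT Θ A) := by
    intro m
    induction m with
    | zero => simp
    | succ m ih =>
      rw [pow_succ, dT_mul, ih]
      simp only [nsmul_eq_mul]
      push_cast
      ring
  obtain ⟨m, hm⟩ : ∃ m, p ^ n = m + 1 := ⟨p ^ n - 1, by
    have := pow_pos (Fact.out : p.Prime).pos n; omega⟩
  rw [hm, key, ← hm, nsmul_eq_mul]
  have : ((p ^ n : ℕ) : k[X][X]) = 0 := by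
    push_cast
    rw [CharP.cast_eq_zero, zero_pow hn]
  rw [this, zero_mul]

/-- a smooth point datum: an expansion homomorphism. -/
structure Expn (Θ : k[X][X]) (P : k × k) where
  φ : k[X][X] →ₐ[k] PowerSeries k
  hu : φ (C X) = PowerSeries.C P.1 + PowerSeries.X
  h0 : ∀ A, PowerSeries.constantCoeff (φ A) = A.evalEval P.1 P.2
  hΘ : φ Θ = 0
  hΘy : (derivative Θ).evalEval P.1 P.2 ≠ 0

theorem exists_expn {Θ : k[X][X]} (hm : Θ.Monic) (P : k × k) (h : Θ.evalEval P.1 P.2 = 0)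
    (hy : (derivative Θ).evalEval P.1 P.2 ≠ 0) : Nonempty (Expn Θ P) := by
  let ψ : k[X] →ₐ[k] PowerSeries k := aeval (PowerSeries.C P.1 + PowerSeries.X)
  have hψ : ∀ a, PowerSeries.constantCoeff (ψ a) = a.eval P.1 := by
    intro a
    have : (PowerSeries.constantCoeff (R := k)).comp (ψ : k[X] →+* PowerSeries k)
        = (evalRingHom P.1) := by
      apply Polynomial.ringHom_ext
      · intro c; simp [ψ]
      · simp [ψ]
    exact congrArg (fun f => f a) this
  have hcc : ∀ (A : k[X][X]) (y : PowerSeries k),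
      PowerSeries.constantCoeff ((A.map (ψ : k[X] →+* PowerSeries k)).eval y)
        = A.evalEval P.1 (PowerSeries.constantCoeff y) := by
    intro A y
    induction A using Polynomial.induction_on' with
    | add p q hp hq => simp [hp, hq]
    | monomial n a => simp [hψ, evalEval]
  obtain ⟨η, hη, hη0⟩ := HenselianRing.is_henselian (R := PowerSeries k)
    (I := .span {PowerSeries.X}) (Θ.map (ψ : k[X] →+* PowerSeries k)) (hm.map _)
    (PowerSeries.C P.2) (by
      rw [Ideal.mem_span_singleton, PowerSeries.X_dvd_iff, hcc]
      simpa using h) (by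
      apply IsUnit.map
      rw [PowerSeries.isUnit_iff_constantCoeff, derivative_map, hcc]
      simpa using hy)
  rw [Ideal.mem_span_singleton, PowerSeries.X_dvd_iff, map_sub, sub_eq_zero] at hη0
  have hA : ∀ A, aevalAeval (PowerSeries.C P.1 + PowerSeries.X) η A
      = (A.map (ψ : k[X] →+* PowerSeries k)).eval η := by
    intro A
    induction A using Polynomial.induction_on' with
    | add p q hp hq => rw [map_add, hp, hq, Polynomial.map_add, eval_add]
    | monomial n a =>
      rw [← C_mul_X_pow_eq_monomial, map_mul, map_pow, aevalAeval_C, aevalAeval_Y]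
      simp [ψ]
  refine ⟨⟨aevalAeval (PowerSeries.C P.1 + PowerSeries.X) η, ?_, ?_, ?_, hy⟩⟩
  · exact aevalAeval_X _ _
  · intro A
    rw [hA, hcc, hη0]
    simp
  · rw [hA]; exact hη

theorem Expn.chain {Θ : k[X][X]} {P : k × k} (E : Expn Θ P) (A : k[X][X]) :
    PowerSeries.derivative k (E.φ A)
      = E.φ (du A) + E.φ (derivative A) * PowerSeries.derivative k (E.φ X) := by
  have hC : ∀ a : k[X], PowerSeries.derivative k (E.φ (C a)) = E.φ (C (derivative a)) := by
    intro a
    induction a using Polynomial.induction_on with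
    | C c =>
      have : (C (C c) : k[X][X]) = algebraMap k _ c := rfl
      rw [this, AlgHom.commutes]; simp
    | add p q hp hq => simp [hp, hq]
    | monomial n a h =>
      rw [pow_succ, ← mul_assoc]
      generalize (C a * X ^ n : k[X]) = b at h ⊢
      rw [C_mul, map_mul, Derivation.leibniz, h, derivative_mul, C_add, map_add, C_mul, map_mul, E.hu]
      simp
      ring
  induction A using Polynomial.induction_on with
  | C a => rw [hC, du_C]; simp
  | add p q hp hq =>
    simp only [map_add, hp, hq]; ring
  | monomial n a h =>
    rw [pow_succ, ← mul_assoc]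
    generalize (C a * X ^ n : k[X][X]) = b at h ⊢
    rw [map_mul, Derivation.leibniz, h, du_mul, derivative_mul, du_X]
    simp only [map_add, map_mul, smul_eq_mul, derivative_X, mul_one, mul_zero, add_zero]
    ring

theorem Expn.dT {Θ : k[X][X]} {P : k × k} (E : Expn Θ P) (A : k[X][X]) :
    E.φ (dT Θ A) = E.φ (derivative Θ) * PowerSeries.derivative k (E.φ A) := by
  have h1 := E.chain Θ
  rw [E.hΘ, map_zero] at h1
  rw [E.chain A, dT_apply, map_sub, map_mul, map_mul]
  linear_combination (E.φ (derivative A)) * h1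

theorem X_pow_dvd_of_derivative (p : ℕ) [Fact p.Prime] [CharP k p] (f : PowerSeries k) (l : ℕ)
    (hl : l + 1 < p + 1) (h0 : PowerSeries.constantCoeff f = 0)
    (h : PowerSeries.X ^ l ∣ PowerSeries.derivative k f) : PowerSeries.X ^ (l+1) ∣ f := by
  rw [PowerSeries.X_pow_dvd_iff] at h ⊢
  intro m hm
  cases m with
  | zero => simpa using h0
  | succ m =>
    have := h m (by omega)
    rw [PowerSeries.coeff_derivative] at this
    rcases mul_eq_zero.1 this with h | h
    · exact h
    · exfalso
      have h2 : ((m + 1 : ℕ) : k) = 0 := by exact_mod_cast h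
      rw [CharP.cast_eq_zero_iff k p] at h2
      have := Nat.le_of_dvd (by omega) h2
      omega

theorem Expn.dvd_of_iter (p : ℕ) [Fact p.Prime] [CharP k p] {Θ : k[X][X]} {P : k × k}
    (E : Expn Θ P) (M : ℕ) (hM : M ≤ p) (A : k[X][X])
    (h : ∀ l < M, ((BH.dT Θ)^[l] A).evalEval P.1 P.2 = 0) : PowerSeries.X ^ M ∣ E.φ A := by
  induction M generalizing A with
  | zero => simp
  | succ M ih =>
    refine X_pow_dvd_of_derivative p _ M (by omega) ?_ ?_
    · rw [E.h0]; exact h 0 (by omega)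
    · have := ih (by omega) (BH.dT Θ A) (fun l hl => by
        have := h (l+1) (by omega)
        rwa [Function.iterate_succ_apply] at this)
      rw [E.dT] at this
      have hu : IsUnit (E.φ (derivative Θ)) := by
        rw [PowerSeries.isUnit_iff_constantCoeff, E.h0]
        exact isUnit_iff_ne_zero.2 E.hΘy
      exact (hu.dvd_mul_left).1 this

end A1
end BH

namespace BH

section A2
variable {k : Type} [Field k]

theorem exists_divmod {D g e : ℕ} {Θ : k[X][X]} (hm : Θ.Monic) (hg : Θ.natDegree = g)
    (hΘ : Θ ∈ Wt k D (D * g)) (n : ℕ) (A : k[X][X]) (hA : A ∈ Wt k D e) (hn : A.natDegree < n) :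
    ∃ Q B : k[X][X], A = B + Θ * Q ∧ B ∈ Wt k D e ∧ B.degree < Θ.degree := by
  induction n generalizing A with
  | zero => omega
  | succ n ih =>
    by_cases hd : A.degree < Θ.degree
    · exact ⟨0, A, by simp, hA, hd⟩
    have hA0 : A ≠ 0 := by
      rintro rfl
      apply hd
      rw [degree_zero, bot_lt_iff_ne_bot, ne_eq, degree_eq_bot]
      exact hm.ne_zero
    have hd' : Θ.degree ≤ A.degree := not_lt.1 hd
    have hnd : g ≤ A.natDegree := hg ▸ natDegree_le_natDegree hd'
    set N := A.natDegree with hN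
    have hlt := div_wf_lemma ⟨hd', hA0⟩ hm
    set Q0 : k[X][X] := C A.leadingCoeff * X ^ (A.natDegree - Θ.natDegree) with hQ0
    have hDe : D * N ≤ e := by
      have h1 : A.coeff N ≠ 0 := leadingCoeff_ne_zero.2 hA0
      have h2 := hA N (A.coeff N).natDegree (leadingCoeff_ne_zero.2 h1)
      omega
    have hQ0W : Q0 ∈ Wt k D (e - D * g) := by
      intro s i h
      rw [hQ0, coeff_C_mul, coeff_X_pow] at h
      split_ifs at h with h1
      · rw [mul_one] at h
        have := hA N i h
        rw [h1, ← hN, hg]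
        have e1 : D * (N - g) = D * N - D * g := Nat.mul_sub _ _ _
        have : D * g ≤ D * N := Nat.mul_le_mul_left _ hnd
        omega
      · simp at h
    have hW : A - Θ * Q0 ∈ Wt k D e := by
      refine sub_mem hA (Wt_mono ?_ (Wt_mul hΘ hQ0W))
      have : D * g ≤ D * N := Nat.mul_le_mul_left _ hnd
      omega
    by_cases hdd : (A - Θ * Q0).degree < Θ.degree
    · exact ⟨Q0, A - Θ * Q0, by ring, hW, hdd⟩
    by_cases hz : A - Θ * Q0 = 0
    · exact ⟨Q0, 0, by linear_combination hz, zero_mem _, by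
        rw [degree_zero, bot_lt_iff_ne_bot, ne_eq, degree_eq_bot]
        exact hm.ne_zero⟩
    obtain ⟨Q, B, h1, h2, h3⟩ := ih (A - Θ * Q0) hW (by
      have := natDegree_lt_natDegree hz hlt
      omega)
    exact ⟨Q0 + Q, B, by linear_combination h1, h2, h3⟩

theorem Wt_mod {D g e : ℕ} {Θ : k[X][X]} (hm : Θ.Monic) (hg : Θ.natDegree = g)
    (hΘ : Θ ∈ Wt k D (D * g)) {A : k[X][X]} (hA : A ∈ Wt k D e) : A %ₘ Θ ∈ Wt k D e := by
  obtain ⟨Q, B, h1, h2, h3⟩ := exists_divmod hm hg hΘ (A.natDegree+1) A hA (by omega)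
  rw [(div_modByMonic_unique Q B hm ⟨h1.symm, h3⟩).2]
  exact h2

/-- the explicit finite-dimensional model of reduced polynomials of weight at most `x`. -/
abbrev VV (k : Type) [Field k] (D g x : ℕ) : Type := ∀ s : Fin g, degreeLT k (x + 1 - D * s)

noncomputable def VVι (k : Type) [Field k] (D g x : ℕ) : VV k D g x →ₗ[k] k[X][X] where
  toFun c := ∑ s : Fin g, monomial (s : ℕ) (c s : k[X])
  map_add' := by intro a b; simp [Finset.sum_add_distrib]
  map_smul' := by
    intro r a
    simp only [Pi.smul_apply, Submodule.coe_smul, RingHom.id_apply, Finset.smul_sum, smul_monomial]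

theorem VVι_coeff {D g x : ℕ} (c : VV k D g x) (s : Fin g) :
    (VVι k D g x c).coeff s = c s := by
  simp only [VVι, LinearMap.coe_mk, AddHom.coe_mk, finsetSum_coeff, coeff_monomial]
  rw [Finset.sum_eq_single s]
  · simp
  · intro b _ hb
    rw [if_neg]
    exact fun h => hb (Fin.ext h)
  · simp

theorem VVι_coeff_ge {D g x : ℕ} (c : VV k D g x) (s : ℕ) (hs : g ≤ s) :
    (VVι k D g x c).coeff s = 0 := by
  simp only [VVι, LinearMap.coe_mk, AddHom.coe_mk, finsetSum_coeff, coeff_monomial]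
  refine Finset.sum_eq_zero fun b _ => ?_
  rw [if_neg]
  have := b.2
  omega

theorem VVι_inj {D g x : ℕ} : Function.Injective (VVι k D g x) := by
  intro a b h
  funext s
  apply Subtype.ext
  rw [← VVι_coeff a s, ← VVι_coeff b s, h]

theorem VVι_mem {D g x : ℕ} (c : VV k D g x) : VVι k D g x c ∈ Wt k D x := by
  intro s i h
  rcases lt_or_ge s g with hs | hs
  · rw [VVι_coeff c ⟨s, hs⟩] at h
    have h2 := (c ⟨s, hs⟩).2
    rw [mem_degreeLT] at h2
    have := lt_of_le_of_lt (le_degree_of_ne_zero h) h2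
    have h3 : i < x + 1 - D * s := by exact_mod_cast this
    omega
  · rw [VVι_coeff_ge c s hs] at h; simp at h

theorem VVι_degree {D g x : ℕ} (c : VV k D g x) : (VVι k D g x c).degree < g := by
  rw [degree_lt_iff_coeff_zero]
  exact fun s hs => VVι_coeff_ge c s hs

/-- inverse to `VVι` on reduced polynomials. -/
theorem VVι_surj {D g x : ℕ} (A : k[X][X]) (hA : A ∈ Wt k D x) (hd : A.degree < g) :
    ∃ c, VVι k D g x c = A := by
  refine ⟨fun s => ⟨A.coeff s, ?_⟩, ?_⟩
  · rw [mem_degreeLT, degree_lt_iff_coeff_zero]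
    intro i hi
    by_contra h
    have := hA s i h
    omega
  · ext1 s
    rcases lt_or_ge s g with hs | hs
    · exact VVι_coeff (D := D) (x := x) _ ⟨s, hs⟩
    · rw [VVι_coeff_ge _ s hs]
      exact ((degree_lt_iff_coeff_zero _ _).1 hd s hs).symm

theorem finrank_VV (D g x : ℕ) : Module.finrank k (VV k D g x) = ∑ s : Fin g, (x + 1 - D * s) := by
  rw [Module.finrank_pi_fintype]
  refine Finset.sum_congr rfl fun s _ => ?_
  rw [(degreeLTEquiv k _).finrank_eq, Module.finrank_fin_fun]

instance (D g x : ℕ) : FiniteDimensional k (VV k D g x) := by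
  have : ∀ n, FiniteDimensional k (degreeLT k n) := fun n =>
    (degreeLTEquiv k n).symm.finiteDimensional
  infer_instance

theorem finrank_VV_le (D g x : ℕ) : Module.finrank k (VV k D g x) ≤ g * (x+1) := by
  rw [finrank_VV]
  calc _ ≤ ∑ s : Fin g, (x+1) := Finset.sum_le_sum fun s _ => by omega
    _ = _ := by simp

theorem finrank_VV_diff (D g x ρ : ℕ) (h : D * g ≤ x) :
    Module.finrank k (VV k D g (x + ρ)) = Module.finrank k (VV k D g x) + g * ρ := by
  rw [finrank_VV, finrank_VV]
  have : g * ρ = ∑ s : Fin g, ρ := by simp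
  rw [this, ← Finset.sum_add_distrib]
  refine Finset.sum_congr rfl fun s _ => ?_
  have : D * s ≤ D * g := Nat.mul_le_mul_left _ s.2.le
  omega

/-- evaluation of the first `M` coefficients at a family of points -/
noncomputable def jets {Θ : k[X][X]} {S : Finset (k × k)} (E : ∀ P : S, Expn Θ P) (M : ℕ) :
    k[X][X] →ₗ[k] (S → Fin M → k) :=
  LinearMap.pi fun P => LinearMap.pi fun l => (PowerSeries.coeff (l : ℕ)).comp (E P).φ.toLinearMap

theorem jets_apply {Θ : k[X][X]} {S : Finset (k × k)} (E : ∀ P : S, Expn Θ P) (M : ℕ)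
    (A : k[X][X]) (P : S) (l : Fin M) : jets E M A P l = PowerSeries.coeff (l : ℕ) ((E P).φ A) := rfl

theorem jets_surj {Θ : k[X][X]} {S : Finset (k × k)} (E : ∀ P : S, Expn Θ P) (M : ℕ) :
    Function.Surjective (jets E M) := by
  classical
  intro c
  let ℓ : k × k → k × k → k[X][X] := fun P Q =>
    if Q.1 = P.1 then X - C (C Q.2) else C (X - C Q.1)
  have hℓ1 : ∀ P Q, (ℓ P Q).evalEval Q.1 Q.2 = 0 := by
    intro P Q
    simp only [ℓ]
    split_ifs <;> simp [evalEval]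
  have hℓ2 : ∀ P Q, P ≠ Q → (ℓ P Q).evalEval P.1 P.2 ≠ 0 := by
    intro P Q hPQ
    simp only [ℓ]
    split_ifs with h
    · simp only [evalEval, eval_sub, eval_X, eval_C]
      intro h2
      exact hPQ (Prod.ext h.symm (sub_eq_zero.1 h2))
    · simp only [evalEval, eval_sub, eval_X, eval_C]
      intro h2
      exact h (sub_eq_zero.1 h2).symm
  let h : S → k[X][X] := fun P => ∏ Q ∈ Finset.univ.erase P, (ℓ P Q) ^ M
  have hh1 : ∀ P Q : S, P ≠ Q → PowerSeries.X ^ M ∣ (E Q).φ (h P) := by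
    intro P Q hPQ
    have : (ℓ P Q) ^ M ∣ h P := Finset.dvd_prod_of_mem (fun Q : S => (ℓ P Q) ^ M)
      (Finset.mem_erase.2 ⟨hPQ.symm, Finset.mem_univ _⟩)
    refine dvd_trans ?_ (map_dvd (E Q).φ this)
    rw [map_pow]
    apply pow_dvd_pow_of_dvd
    rw [PowerSeries.X_dvd_iff, (E Q).h0]
    exact hℓ1 _ _
  have hh2 : ∀ P : S, IsUnit ((E P).φ (h P)) := by
    intro P
    rw [PowerSeries.isUnit_iff_constantCoeff, (E P).h0, isUnit_iff_ne_zero]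
    simp only [h]
    rw [evalEval_prod]
    refine Finset.prod_ne_zero_iff.2 fun Q hQ => ?_
    rw [evalEval_pow]
    apply pow_ne_zero
    apply hℓ2
    intro h
    exact (Finset.mem_erase.1 hQ).1 (Subtype.ext h.symm)
  choose v hv using fun P => (hh2 P).exists_right_inv
  let t : S → PowerSeries k := fun P => PowerSeries.mk fun l => if hl : l < M then c P ⟨l, hl⟩ else 0
  let w : S → k[X] := fun P => PowerSeries.trunc M (t P * v P)
  have hφ : ∀ (P : S) (w : k[X]), (E P).φ (C (w.comp (X - C P.1.1))) = (w : PowerSeries k) := by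
    intro P w
    induction w using Polynomial.induction_on' with
    | add p q hp hq => simp [hp, hq]
    | monomial n a =>
      have h1 : (E P).φ (C (C a)) = PowerSeries.C a := (E P).φ.commutes a
      have h2 : (E P).φ (C (X - C P.1.1)) = PowerSeries.X := by
        have h1 : (E P).φ (C (C P.1.1)) = PowerSeries.C P.1.1 := (E P).φ.commutes _
        rw [C_sub, map_sub, (E P).hu, h1]; ring
      rw [← C_mul_X_pow_eq_monomial, mul_comp, C_comp, X_pow_comp, C_mul, C_pow, map_mul, map_pow,
        h1, h2]
      simp
  refine ⟨∑ P : S, h P * C ((w P).comp (X - C P.1.1)), ?_⟩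
  funext P l
  rw [jets_apply, map_sum, map_sum, Finset.sum_eq_single P]
  rotate_left
  · intro Q _ hQ
    have hd : PowerSeries.X ^ M ∣ (E P).φ (h Q * C ((w Q).comp (X - C Q.1.1))) := by
      rw [map_mul]; exact Dvd.dvd.mul_right (hh1 Q P hQ) _
    exact PowerSeries.X_pow_dvd_iff.1 hd l l.2
  · intro h; exact absurd (Finset.mem_univ _) h
  have h1 : PowerSeries.X ^ M ∣ (t P * v P - (w P : PowerSeries k)) := by
    rw [PowerSeries.X_pow_dvd_iff]
    intro m hm
    simp [w, PowerSeries.coeff_trunc, hm]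
  have h2 : PowerSeries.X ^ M ∣ (t P - (E P).φ (h P) * (w P : PowerSeries k)) := by
    have : t P - (E P).φ (h P) * (w P : PowerSeries k)
        = (E P).φ (h P) * (t P * v P - (w P : PowerSeries k)) := by
      linear_combination (- t P) * hv P
    rw [this]
    exact Dvd.dvd.mul_left h1 _
  have h3 := PowerSeries.X_pow_dvd_iff.1 h2 l l.2
  rw [map_sub, sub_eq_zero] at h3
  rw [map_mul, hφ, ← h3]
  simp [t]

theorem zero_count {D g : ℕ} {Θ : k[X][X]} (hm : Θ.Monic) (hg : Θ.natDegree = g)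
    (hΘ : Θ ∈ Wt k D (D * g)) (hirr : Irreducible Θ) {S : Finset (k × k)}
    (E : ∀ P : S, Expn Θ P) (M ρ : ℕ) (R : k[X][X]) (hR : R ∈ Wt k D ρ) (hR0 : ¬ Θ ∣ R)
    (hv : ∀ P : S, PowerSeries.X ^ M ∣ (E P).φ R) : M * S.card ≤ g * ρ := by
  classical
  have hprime : Prime Θ := hirr.prime
  have hdeg : Θ.degree = g := by rw [← hg]; exact degree_eq_natDegree hm.ne_zero
  -- reduction
  have hjet : ∀ A, jets E M (A %ₘ Θ) = jets E M A := by
    intro A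
    funext P l
    have : (E P).φ A = (E P).φ (A %ₘ Θ) := by
      conv_lhs => rw [← modByMonic_add_div A Θ]
      rw [map_add, map_mul, (E P).hΘ, zero_mul, add_zero]
    rw [jets_apply, jets_apply, this]
  -- choose lifts
  choose lift hlift using fun c : S × Fin M =>
    jets_surj E M (Pi.single c.1 (Pi.single c.2 1))
  choose e he using fun c => exists_Wt D (lift c)
  let x0 : ℕ := D * g + ∑ c, e c
  let L : VV k D g (x0 + ρ) →ₗ[k] (S → Fin M → k) := (jets E M).comp (VVι k D g (x0 + ρ))
  have hL : Function.Surjective L := by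
    rw [← LinearMap.range_eq_top, eq_top_iff]
    intro c _
    have hc : c = ∑ P : S, ∑ l : Fin M, c P l • (Pi.single P (Pi.single l 1) : S → Fin M → k) := by
      funext P l
      simp [Finset.sum_apply, Pi.single_apply, apply_ite, ite_apply]
    rw [hc]
    refine Submodule.sum_mem _ fun P _ => Submodule.sum_mem _ fun l _ => Submodule.smul_mem _ _ ?_
    have h1 : lift (P, l) %ₘ Θ ∈ Wt k D (x0 + ρ) := by
      refine Wt_mod hm hg hΘ (Wt_mono ?_ (he (P, l)))
      have := Finset.single_le_sum (f := e) (fun _ _ => Nat.zero_le _) (Finset.mem_univ (P, l))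
      simp only [x0]
      omega
    obtain ⟨v, hv⟩ := VVι_surj (g := g) _ h1 (hdeg ▸ degree_modByMonic_lt _ hm)
    refine ⟨v, ?_⟩
    simp only [L, LinearMap.comp_apply]
    rw [hv, hjet, hlift]
  -- multiplication by R
  have hmul : ∀ v : VV k D g x0, ∃ w : VV k D g (x0 + ρ), VVι k D g (x0+ρ) w = (R * VVι k D g x0 v) %ₘ Θ := by
    intro v
    apply VVι_surj
    · refine Wt_mod hm hg hΘ ?_
      rw [add_comm x0]
      exact Wt_mul hR (VVι_mem v)
    · rw [← hdeg]; exact degree_modByMonic_lt _ hm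
  choose μ hμ using hmul
  let μL : VV k D g x0 →ₗ[k] LinearMap.ker L :=
    { toFun := fun v => ⟨μ v, by
        rw [LinearMap.mem_ker]
        simp only [L, LinearMap.comp_apply]
        rw [hμ, hjet]
        funext P l
        rw [jets_apply, map_mul]
        exact PowerSeries.X_pow_dvd_iff.1 (Dvd.dvd.mul_right (hv P) _) l l.2⟩
      map_add' := by
        intro a b
        apply Subtype.ext
        apply VVι_inj
        simp only [Submodule.coe_add, map_add]
        rw [hμ, hμ, hμ, map_add, mul_add, add_modByMonic]
      map_smul' := by
        intro a b
        apply Subtype.ext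
        apply VVι_inj
        simp only [Submodule.coe_smul, map_smul, RingHom.id_apply]
        rw [hμ, hμ, map_smul, mul_smul_comm]
        have h1 : ∀ B : k[X][X], a • B = C a • B := fun B => by
          rw [← algebraMap_eq, algebraMap_smul]
        rw [h1, h1, smul_modByMonic] }
  have hμinj : Function.Injective μL := by
    refine (injective_iff_map_eq_zero μL).2 ?_
    intro v hv0
    have h1 : μ v = 0 := congrArg Subtype.val hv0
    have h2 := hμ v
    rw [h1, map_zero, eq_comm, modByMonic_eq_zero_iff_dvd hm] at h2
    have h3 := (hprime.dvd_or_dvd h2).resolve_left hR0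
    have h4 : VVι k D g x0 v = 0 := by
      apply eq_zero_of_dvd_of_degree_lt h3
      rw [hdeg]; exact VVι_degree v
    exact VVι_inj (h4.trans (map_zero _).symm)
  have h1 := LinearMap.finrank_le_finrank_of_injective hμinj
  have h2 := LinearMap.finrank_range_add_finrank_ker L
  rw [LinearMap.range_eq_top.2 hL, finrank_top, finrank_VV_diff D g x0 ρ (by simp only [x0]; omega)] at h2
  have h3 : Module.finrank k (S → Fin M → k) = M * S.card := by
    rw [Module.finrank_pi_fintype]
    simp [mul_comm]
  omega

/-- nonvanishing lemma in power series -/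
theorem frob_indep (p Q : ℕ) [Fact p.Prime] [CharP k p] (n : ℕ) (hQ : Q = p ^ n)
    {ι : Type} [Fintype ι] (σ : ι → PowerSeries k)
    (hσ : ∀ c : ι → k, PowerSeries.X ^ Q ∣ ∑ i, c i • σ i → c = 0)
    (b : ι → PowerSeries k) (h : ∑ i, σ i * b i ^ Q = 0) : ∀ i, b i = 0 := by
  have hQ0 : Q ≠ 0 := by rw [hQ]; exact (pow_pos (Fact.out : p.Prime).pos n).ne'
  have key : ∀ N : ℕ, ∀ i, PowerSeries.X ^ N ∣ b i := by
    intro N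
    induction N with
    | zero => intro i; simp
    | succ N ih =>
      choose b' hb' using ih
      have h2 : ∑ i, σ i * b' i ^ Q = 0 := by
        have h3 : (PowerSeries.X ^ N) ^ Q * ∑ i, σ i * b' i ^ Q = 0 := by
          rw [← h, Finset.mul_sum]
          refine Finset.sum_congr rfl fun i _ => ?_
          rw [hb' i]; ring
        exact (mul_eq_zero.1 h3).resolve_left (pow_ne_zero _ (pow_ne_zero _ PowerSeries.X_ne_zero))
      have h4 := hσ (fun i => PowerSeries.constantCoeff (b' i) ^ Q) (by
        have h5 : ∀ i, ∃ r, b' i ^ Q = PowerSeries.C (PowerSeries.constantCoeff (b' i) ^ Q)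
            + PowerSeries.X ^ Q * r := by
          intro i
          have h6 : PowerSeries.X ∣ b' i - PowerSeries.C (PowerSeries.constantCoeff (b' i)) := by
            rw [PowerSeries.X_dvd_iff]; simp
          obtain ⟨r, hr⟩ := h6
          refine ⟨r ^ Q, ?_⟩
          have : CharP (PowerSeries k) p :=
            charP_of_injective_algebraMap (algebraMap k (PowerSeries k)).injective p
          have h7 : b' i = PowerSeries.C (PowerSeries.constantCoeff (b' i)) + PowerSeries.X * r := by
            rw [← hr]; ring
          conv_lhs => rw [h7]
          rw [hQ, add_pow_char_pow, map_pow, mul_pow]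
        choose r hr using h5
        have h8 : ∑ i, (PowerSeries.constantCoeff (b' i) ^ Q) • σ i
            = PowerSeries.X ^ Q * (- ∑ i, σ i * r i) := by
          have h9 : ∀ i, σ i * b' i ^ Q = (PowerSeries.constantCoeff (b' i) ^ Q) • σ i
             + PowerSeries.X ^ Q * (σ i * r i) := by
            intro i
            rw [hr i, PowerSeries.smul_eq_C_mul]; ring
          simp only [h9] at h2
          rw [Finset.sum_add_distrib, ← Finset.mul_sum] at h2
          linear_combination h2
        rw [h8]
        exact dvd_mul_right _ _)
      intro i
      have h5 : PowerSeries.constantCoeff (b' i) = 0 := by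
        have := congrFun h4 i
        exact pow_eq_zero_iff hQ0 |>.1 this
      rw [hb' i, pow_succ]
      exact mul_dvd_mul_left _ (PowerSeries.X_dvd_iff.2 h5)
  intro i
  ext N
  simpa using PowerSeries.X_pow_dvd_iff.1 (key (N+1) i) N (by omega)

end A2
end BH

namespace BH

section A3
variable {k : Type} [Field k]

/-- the monomials `u^i y^s` -/
noncomputable def mon (k : Type) [Field k] (x : ℕ × ℕ) : k[X][X] := C (X ^ x.1) * X ^ x.2

theorem mon_Wt (D : ℕ) (x : ℕ × ℕ) : mon k x ∈ Wt k D (x.1 + D * x.2) := by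
  have := Wt_mon (D := D) x.1 x.2 (1 : k)
  rwa [C_1, one_mul] at this

theorem coeff_comb {m g : ℕ} (c : Fin m × Fin g → k) (i : Fin m) (s : Fin g) :
    ((∑ x : Fin m × Fin g, c x • mon k (x.1, x.2)).coeff s).coeff i = c (i, s) := by
  rw [finsetSum_coeff, finsetSum_coeff, Finset.sum_eq_single (i, s)]
  · simp only [mon, coeff_smul, coeff_C_mul, coeff_X_pow]
    simp
  · rintro ⟨i', s'⟩ _ h
    simp only [mon, coeff_smul, coeff_C_mul, coeff_X_pow]
    by_cases hs : (s : ℕ) = s'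
    · by_cases hi : (i : ℕ) = i'
      · exact absurd (Prod.ext (Fin.ext hi.symm) (Fin.ext hs.symm)) h
      · simp [hs, coeff_X_pow, hi]
    · simp [hs]
  · simp

theorem comb_Wt {m g : ℕ} (D : ℕ) (c : Fin m × Fin g → k) :
    (∑ x : Fin m × Fin g, c x • mon k (x.1, x.2)) ∈ Wt k D (m + D * g) := by
  refine Submodule.sum_mem _ fun x _ => Submodule.smul_mem _ _ (Wt_mono ?_ (mon_Wt D _))
  have h1 := x.1.2
  have h2 : D * x.2 ≤ D * g := Nat.mul_le_mul_left _ x.2.2.le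
  simp only
  omega

theorem comb_degree {m g : ℕ} (c : Fin m × Fin g → k) :
    (∑ x : Fin m × Fin g, c x • mon k (x.1, x.2)).degree < g := by
  rw [degree_lt_iff_coeff_zero]
  intro s hs
  rw [finsetSum_coeff]
  refine Finset.sum_eq_zero fun x _ => ?_
  have := x.2.2
  have h2 : s ≠ (x.2 : ℕ) := by omega
  simp only [mon, coeff_smul, coeff_C_mul, coeff_X_pow, if_neg h2]
  simp

theorem comb_not_dvd {m g : ℕ} {Θ : k[X][X]} (hm : Θ.Monic) (hg : Θ.natDegree = g)
    (c : Fin m × Fin g → k) (h : Θ ∣ ∑ x : Fin m × Fin g, c x • mon k (x.1, x.2)) : c = 0 := by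
  have h1 := eq_zero_of_dvd_of_degree_lt h (by
    rw [degree_eq_natDegree hm.ne_zero, hg]; exact comb_degree c)
  funext ⟨i, s⟩
  rw [← coeff_comb c i s, h1]; simp

theorem stepanov_core [IsAlgClosed k] (p : ℕ) [Fact p.Prime] [CharP k p] (D g Ew : ℕ) (hgpos : 0 < g)
    {Θ Pw : k[X][X]} (hm : Θ.Monic) (hg : Θ.natDegree = g)
    (hΘ : Θ ∈ Wt k D (D * g)) (hPw : Pw ∈ Wt k D Ew) (hirr : Irreducible Θ)
    (μ ν : ℕ) (hν : ν ≠ 0) (M m J : ℕ) (hM : M ≤ p)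
    (hm1 : g * (m + D * g) < p ^ ν)
    (hcount : M * (p ^ μ * (m + D * g + M * (D * g)) + J + g * (Ew + D * g) + 1) < g * m * J)
    (S : Finset (k × k))
    (hS : ∀ P ∈ S, P.1 ^ (p ^ μ * p ^ ν) = P.1 ∧ Θ.evalEval P.1 P.2 = 0 ∧
      (derivative Θ).evalEval P.1 P.2 ≠ 0 ∧
      (derivative Θ).evalEval P.1 P.2 * P.2 ^ (p ^ μ * p ^ ν) = Pw.evalEval P.1 P.2) :
    M * S.card ≤ g * (m + D * g + (J + D * g) * p ^ ν) := by
  classical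
  rcases S.eq_empty_or_nonempty with rfl | ⟨P0, hP0⟩
  · simp
  have hp0 : 0 < p := (Fact.out : p.Prime).pos
  have hdeg : Θ.degree = g := by rw [← hg]; exact degree_eq_natDegree hm.ne_zero
  have E := fun P : S => exists_expn hm P.1 (hS P.1 P.2).2.1 (hS P.1 P.2).2.2.1
  let α := Fin m × Fin g
  let β := Fin J × Fin g
  let a : α → k[X][X] := fun x => mon k (x.1, x.2)
  let b : β → k[X][X] := fun x => mon k (x.1, x.2)
  let bt : β → k[X][X] := fun x => C (X ^ (x.1 : ℕ)) * (Pw ^ (x.2 : ℕ) * (derivative Θ) ^ (g - (x.2:ℕ)))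
  set x : ℕ := p ^ μ * (m + D * g + M * (D * g)) + J + g * (Ew + D * g) with hx
  have hbt : ∀ y, bt y ∈ Wt k D (J + g * (Ew + D * g)) := by
    intro y
    have h1 : (C (X ^ (y.1 : ℕ)) : k[X][X]) ∈ Wt k D y.1 := by
      simpa [mon] using mon_Wt (k := k) D ((y.1 : ℕ), 0)
    refine Wt_mono ?_ (Wt_mul h1 (Wt_mul (Wt_pow hPw y.2) (Wt_pow (Wt_dy hΘ) (g - y.2))))
    have h2 := y.1.2
    have h3 := y.2.2
    have h4 : (y.2 : ℕ) * Ew ≤ g * Ew := Nat.mul_le_mul_right _ h3.le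
    have h5 : (g - (y.2 : ℕ)) * (D * g) ≤ g * (D * g) := Nat.mul_le_mul_right _ (Nat.sub_le _ _)
    rw [mul_add]
    omega
  have hex : ∀ (i : α × β) (l : Fin M), ∃ v : VV k D g x,
      VVι k D g x v = (((dT Θ)^[l] (a i.1)) ^ (p ^ μ) * bt i.2) %ₘ Θ := by
    intro i l
    apply VVι_surj
    · refine Wt_mod hm hg hΘ ?_
      have h1 : a i.1 ∈ Wt k D (m + D * g) := by
        refine Wt_mono ?_ (mon_Wt D _)
        have h1 := i.1.1.2
        have h2 : D * i.1.2 ≤ D * g := Nat.mul_le_mul_left _ i.1.2.2.le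
        simp only
        omega
      have h2 := Wt_pow (Wt_dT_iter hΘ h1 l) (p ^ μ)
      refine Wt_mono ?_ (Wt_mul h2 (hbt i.2))
      rw [hx, add_assoc (p ^ μ * _)]
      gcongr
      exact l.2.le
    · rw [← hdeg]; exact degree_modByMonic_lt _ hm
  choose v hv using hex
  let L : (α × β → k) →ₗ[k] (Fin M → VV k D g x) :=
    LinearMap.pi fun l => Fintype.linearCombination k (fun i => v i l)
  have hker : LinearMap.ker L ≠ ⊥ := by
    apply LinearMap.ker_ne_bot_of_finrank_lt
    rw [Module.finrank_pi_fintype, Module.finrank_fintype_fun_eq_card]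
    simp only [Finset.sum_const, Finset.card_univ, Fintype.card_fin, smul_eq_mul]
    have h1 := finrank_VV_le (k := k) D g x
    have h2 : Fintype.card (α × β) = (m * g) * (J * g) := by simp [α, β]
    rw [h2]
    calc M * Module.finrank k (VV k D g x) ≤ M * (g * (x+1)) := Nat.mul_le_mul_left _ h1
      _ = g * (M * (x+1)) := by ring
      _ < g * (g * m * J) := Nat.mul_lt_mul_of_pos_left hcount hgpos
      _ = _ := by ring
  obtain ⟨r, hr, hr0⟩ := Submodule.exists_mem_ne_zero_of_ne_bot hker
  choose ρ hρ using fun i => IsAlgClosed.exists_pow_nat_eq (r i) (n := p ^ μ * p ^ ν) (by positivity)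
  -- the conditions
  have hcond : ∀ l : Fin M, Θ ∣ ∑ i, r i • (((dT Θ)^[l] (a i.1)) ^ (p ^ μ) * bt i.2) := by
    intro l
    rw [← modByMonic_eq_zero_iff_dvd hm]
    have h1 : ∀ (A : k[X][X]), A %ₘ Θ = modByMonicHom Θ A := fun A => rfl
    have h3 := congrFun (LinearMap.mem_ker.1 hr) l
    simp only [L, LinearMap.pi_apply, Fintype.linearCombination_apply, Pi.zero_apply] at h3
    have h4 := congrArg (VVι k D g x) h3
    rw [map_sum, map_zero] at h4
    rw [h1, map_sum, ← h4]
    refine Finset.sum_congr rfl fun i _ => ?_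
    have h1 : ∀ (c : k) (B : k[X][X]), c • B = C c • B := fun c B => by
      rw [← algebraMap_eq, algebraMap_smul]
    rw [h1 (r i) (_ ^ _ * _), map_smul, (VVι k D g x).map_smul, hv, h1]
    rfl
  let B : α → k[X][X] := fun i => ∑ j : β, ρ (i, j) • b j
  let R : k[X][X] := ∑ i : α, a i * B i ^ (p ^ ν)
  have hiter : ∀ l, (dT Θ)^[l] R = ∑ i : α, ((dT Θ)^[l] (a i)) * B i ^ (p ^ ν) := by
    intro l
    induction l with
    | zero => rfl
    | succ l ih =>
      rw [Function.iterate_succ_apply', ih, map_sum]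
      refine Finset.sum_congr rfl fun i _ => ?_
      rw [dT_mul, dT_pow_char p Θ _ ν hν, mul_zero, add_zero, Function.iterate_succ_apply']
  have hvan : ∀ P : S, PowerSeries.X ^ M ∣ (E P).some.φ R := by
    intro P
    refine (E P).some.dvd_of_iter p M hM R fun l hl => ?_
    obtain ⟨h1, h2, h3, h4⟩ := hS P.1 P.2
    rw [hiter]
    let ev : k[X][X] →+* k := evalEvalRingHom P.1.1 P.1.2
    have hev : ∀ A : k[X][X], ev A = A.evalEval P.1.1 P.1.2 := fun A => rfl
    have hevs : ∀ (c : k) (A : k[X][X]), ev (c • A) = c * ev A := by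
      intro c A
      rw [hev, evalEval_smul, smul_eq_mul, hev]
    rw [← hev]
    have hc := hcond ⟨l, hl⟩
    obtain ⟨T, hT⟩ := hc
    have hT := congrArg ev hT
    rw [map_mul, hev Θ, h2, zero_mul, map_sum] at hT
    have hbte : ∀ j : β, ev (bt j) = ev (b j) ^ (p ^ μ * p ^ ν) * (ev (derivative Θ)) ^ g := by
      intro j
      have e1 : ev (C X) = P.1.1 := by simp [ev]
      have e2 : ev X = P.1.2 := by simp [ev]
      simp only [bt, b, mon, map_mul, map_pow, e1, e2]
      rw [hev Pw, ← h4, ← hev]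
      have h5 : ∀ z : k, z ^ g = z ^ (g - (j.2 : ℕ)) * z ^ (j.2 : ℕ) := by
        intro z; rw [← pow_add]; congr 1; have := j.2.2; omega
      rw [h5]
      conv_rhs => rw [mul_pow, ← pow_mul, ← pow_mul, mul_comm (j.1 : ℕ), pow_mul _ _ (j.1:ℕ), h1]
      rw [mul_pow, ← pow_mul, mul_comm (j.2 : ℕ)]
      ring
    have hkey : (ev (∑ i : α, ((dT Θ)^[l] (a i)) * B i ^ (p ^ ν))) ^ (p ^ μ) * (ev (derivative Θ)) ^ g = 0 := by
      rw [Fintype.sum_prod_type] at hT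
      rw [← hT, map_sum, sum_pow_char_pow, Finset.sum_mul]
      refine Finset.sum_congr rfl fun i _ => ?_
      rw [map_mul, mul_pow, map_pow, ← pow_mul, mul_comm (p ^ ν), map_sum, ← pow_add, sum_pow_char_pow,
        Finset.mul_sum, Finset.sum_mul]
      refine Finset.sum_congr rfl fun j _ => ?_
      rw [hevs, hevs, map_mul, map_pow, hbte, pow_add, ← hρ, mul_pow]
      ring
    have h7 := (mul_eq_zero.1 hkey).resolve_right (pow_ne_zero _ h3)
    exact pow_eq_zero_iff (by positivity) |>.1 h7
  have hR : R ∈ Wt k D (m + D * g + (J + D * g) * p ^ ν) := by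
    refine Submodule.sum_mem _ fun i _ => Wt_mul ?_ ?_
    · refine Wt_mono ?_ (mon_Wt D _)
      have h1 := i.1.2
      have h2 : D * i.2 ≤ D * g := Nat.mul_le_mul_left _ i.2.2.le
      simp only
      omega
    · rw [mul_comm]
      exact Wt_pow (comb_Wt D _) _
  have hone : ∀ (N e : ℕ) (A : k[X][X]), A ∈ Wt k D e → ¬ Θ ∣ A →
      PowerSeries.X ^ N ∣ (E ⟨P0, hP0⟩).some.φ A → N ≤ g * e := by
    intro N e A hA hA0 hN
    have E1 : ∀ P : ({P0} : Finset (k × k)), ∃ E' : Expn Θ P.1, E'.φ = (E ⟨P0, hP0⟩).some.φ := by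
      rintro ⟨P, hP⟩
      have h := Finset.mem_singleton.1 hP
      subst h
      exact ⟨_, rfl⟩
    choose E1 hE1 using E1
    have := zero_count hm hg hΘ hirr (S := {P0}) E1 N e A hA hA0 (by
        intro P
        rw [hE1]
        exact hN)
    simpa using this
  have hR0 : ¬ Θ ∣ R := by
    intro hdvd
    apply hr0
    have hφ : (E ⟨P0, hP0⟩).some.φ R = 0 := by
      obtain ⟨T, hT⟩ := hdvd
      rw [hT, map_mul, (E ⟨P0, hP0⟩).some.hΘ, zero_mul]
    simp only [R, map_sum, map_mul, map_pow] at hφ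
    have hB := frob_indep p (p ^ ν) ν rfl (fun i : α => (E ⟨P0, hP0⟩).some.φ (a i)) (by
      intro c hc
      by_contra hc0
      have h1 : ¬ Θ ∣ ∑ x : α, c x • a x := fun h => hc0 (comb_not_dvd hm hg c h)
      have h2 := hone (p ^ ν) _ _ (comb_Wt D c) h1 (by
        rw [map_sum]; simp only [map_smul]; exact hc)
      omega) _ hφ
    funext i
    have h1 : Θ ∣ B i.1 := by
      by_contra h
      have := hone (g * (J + D * g) + 1) _ _ (comb_Wt D _) h (by
        rw [show (E ⟨P0, hP0⟩).some.φ (∑ x : Fin J × Fin g, ρ (i.1, x) • mon k (x.1, x.2)) = 0 from hB i.1]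
        exact dvd_zero _)
      omega
    have h2 := comb_not_dvd hm hg _ h1
    have h3 : ρ i = 0 := congrFun h2 i.2
    rw [← hρ, h3, zero_pow (by positivity)]
    rfl
  exact zero_count hm hg hΘ hirr (fun P => (E P).some) M _ R hR hR0 hvan

end A3
end BH

namespace BH

theorem card_trivial {k : Type} [Field k] {Θ : k[X][X]} {g q : ℕ} (hq : 1 < q) (hm : Θ.Monic)
    (hg : Θ.natDegree = g) (S : Finset (k × k))
    (hS : ∀ P ∈ S, P.1 ^ q = P.1 ∧ Θ.evalEval P.1 P.2 = 0) : S.card ≤ g * q := by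
  classical
  have h1 : (S.image Prod.fst).card ≤ q := by
    have h0 : (X ^ q - X : k[X]) ≠ 0 := FiniteField.X_pow_card_sub_X_ne_zero k hq
    have : S.image Prod.fst ⊆ (X ^ q - X : k[X]).roots.toFinset := by
      intro u hu
      obtain ⟨P, hP, rfl⟩ := Finset.mem_image.1 hu
      rw [Multiset.mem_toFinset, mem_roots h0, IsRoot.def]
      simp [(hS P hP).1]
    calc _ ≤ _ := Finset.card_le_card this
      _ ≤ _ := Multiset.toFinset_card_le _
      _ ≤ _ := card_roots' _
      _ = q := FiniteField.X_pow_card_sub_X_natDegree_eq k hq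
  have h2 := Finset.card_le_mul_card_image (f := Prod.fst) S g (by
    intro u hu
    have hm' : (Θ.map (evalRingHom u)).Monic := hm.map _
    have : (S.filter fun x => x.1 = u).card = ((S.filter fun x => x.1 = u).image Prod.snd).card := by
      rw [Finset.card_image_of_injOn]
      intro a ha b hb hab
      have ha := (Finset.mem_filter.1 ha).2
      have hb := (Finset.mem_filter.1 hb).2
      exact Prod.ext (ha.trans hb.symm) hab
    rw [this]
    have h3 : ((S.filter fun x => x.1 = u).image Prod.snd) ⊆ (Θ.map (evalRingHom u)).roots.toFinset := by
      intro y hy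
      obtain ⟨P, hP, rfl⟩ := Finset.mem_image.1 hy
      obtain ⟨hP1, hP2⟩ := Finset.mem_filter.1 hP
      rw [Multiset.mem_toFinset, mem_roots hm'.ne_zero, IsRoot.def]
      rw [map_evalRingHom_eval, ← hP2]
      exact (hS P hP1).2
    calc _ ≤ _ := Finset.card_le_card h3
      _ ≤ _ := Multiset.toFinset_card_le _
      _ ≤ _ := card_roots' _
      _ = g := by rw [hm.natDegree_map, hg])
  exact h2.trans (Nat.mul_le_mul_left _ h1)

set_option maxHeartbeats 2000000 in
theorem stepanov (g D Ew : ℕ) (hgpos : 0 < g) : ∃ Cst : ℝ, 0 ≤ Cst ∧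
    ∀ (k : Type) [Field k] [IsAlgClosed k] (p : ℕ) [Fact p.Prime] [CharP k p] (α : ℕ), α ≠ 0 →
    ∀ (Θ Pw : k[X][X]), Θ.Monic → Θ.natDegree = g →
    Θ ∈ Wt k D (D * g) → Pw ∈ Wt k D Ew → Irreducible Θ →
    ∀ (S : Finset (k × k)),
    (∀ P ∈ S, P.1 ^ (p ^ α) = P.1 ∧ Θ.evalEval P.1 P.2 = 0 ∧
      (derivative Θ).evalEval P.1 P.2 ≠ 0 ∧
      (derivative Θ).evalEval P.1 P.2 * P.2 ^ (p ^ α) = Pw.evalEval P.1 P.2) →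
    (S.card : ℝ) ≤ ((p ^ α : ℕ) : ℝ) + Cst * Real.sqrt ((p ^ α : ℕ) : ℝ) := by
  obtain ⟨c1, hc1⟩ : ∃ c, c = g * (Ew + D * g) := ⟨_, rfl⟩
  obtain ⟨K, hK⟩ : ∃ c, c = 8 * g * (2 * (D * g) + 1) + 2 := ⟨_, rfl⟩
  obtain ⟨c2, hc2⟩ : ∃ c, c = K + g + c1 + 1 := ⟨_, rfl⟩
  obtain ⟨B0, hB0⟩ : ∃ c, c = (8 * g * c2) ^ 2 + 4 * (g * (D * g)) + 8 * g := ⟨_, rfl⟩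
  obtain ⟨c3, hc3⟩ : ∃ c, c = 1 + g * (D * g) + K + g + g * (D * g) := ⟨_, rfl⟩
  refine ⟨g * B0 + 2 * c3, by positivity, ?_⟩
  intro k _ _ p _ _ α hα Θ Pw hm hg hΘ hPw hirr S hS
  have hp : p.Prime := Fact.out
  obtain ⟨μ, ν, hαμ, hν, hμν, hνμ⟩ : ∃ μ ν, α = μ + ν ∧ ν ≠ 0 ∧ μ ≤ ν ∧ ν ≤ μ + 1 :=
    ⟨α / 2, α - α / 2, by omega, by omega, by omega, by omega⟩
  obtain ⟨q, hq⟩ : ∃ q, q = p ^ α := ⟨_, rfl⟩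
  obtain ⟨P0, hP0⟩ : ∃ q, q = p ^ μ := ⟨_, rfl⟩
  obtain ⟨Q1, hQ1⟩ : ∃ q, q = p ^ ν := ⟨_, rfl⟩
  obtain ⟨M, hM⟩ : ∃ q, q = Nat.sqrt (p ^ (ν - μ)) := ⟨_, rfl⟩
  have hqPQ : q = P0 * Q1 := by rw [hq, hP0, hQ1, ← pow_add, hαμ]
  have hQP : Q1 = P0 * p ^ (ν - μ) := by
    rw [hQ1, hP0, ← pow_add]; congr 1; omega
  have hpe : 1 ≤ p ^ (ν - μ) := Nat.one_le_pow _ _ hp.pos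
  have hP01 : 1 ≤ P0 := by rw [hP0]; exact Nat.one_le_pow _ _ hp.pos
  have hQ11 : 1 ≤ Q1 := by rw [hQ1]; exact Nat.one_le_pow _ _ hp.pos
  have hM1 : 1 ≤ M := by rw [hM]; exact Nat.le_sqrt.2 (by simpa using hpe)
  have hMsq : M * M ≤ p ^ (ν - μ) := hM ▸ Nat.sqrt_le _
  have hMsq2 : p ^ (ν - μ) < (M + 1) * (M + 1) := hM ▸ Nat.lt_succ_sqrt _
  have hMp : M ≤ p := by
    have h1 : M ≤ p ^ (ν - μ) := hM ▸ Nat.sqrt_le_self _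
    refine h1.trans ?_
    calc p ^ (ν - μ) ≤ p ^ 1 := Nat.pow_le_pow_right hp.pos (by omega)
      _ = p := pow_one p
  have F1 : P0 * (M * M) ≤ Q1 := by rw [hQP]; exact Nat.mul_le_mul_left _ hMsq
  have F2 : Q1 ≤ 4 * (M * M) * P0 := by
    rw [hQP, mul_comm]
    refine Nat.mul_le_mul_right _ ?_
    nlinarith
  have F3 : M * M ≤ Q1 := (Nat.le_mul_of_pos_left _ hP01).trans F1
  have F4 : M * P0 ≤ Q1 := by
    rw [mul_comm]
    exact (Nat.mul_le_mul_left _ (Nat.le_mul_of_pos_right _ hM1)).trans F1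
  rw [← hq] at hS ⊢
  have hq1 : 1 < q := by rw [hq]; exact Nat.one_lt_pow hα hp.one_lt
  have hsq : (0:ℝ) ≤ Real.sqrt q := Real.sqrt_nonneg _
  rcases le_or_gt Q1 B0 with hsmall | hbig
  · have h1 := card_trivial hq1 hm hg S (fun P hP => ⟨(hS P hP).1, (hS P hP).2.1⟩)
    have h2 : Real.sqrt q ≤ B0 := by
      rw [Real.sqrt_le_left (by positivity)]
      have : q ≤ B0 ^ 2 := by
        rw [hqPQ]
        have h : P0 ≤ Q1 := (Nat.le_mul_of_pos_left _ hM1).trans F4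
        rw [sq]
        exact Nat.mul_le_mul (h.trans hsmall) hsmall
      exact_mod_cast this
    have h3 : (q : ℝ) = Real.sqrt q * Real.sqrt q := (Real.mul_self_sqrt (by positivity)).symm
    have h4 : (S.card : ℝ) ≤ g * q := by exact_mod_cast h1
    have h5 : (q : ℝ) ≤ B0 * Real.sqrt q := by
      nth_rewrite 1 [h3]
      exact mul_le_mul_of_nonneg_right h2 hsq
    have h6 : (g : ℝ) * q ≤ g * (B0 * Real.sqrt q) := mul_le_mul_of_nonneg_left h5 (by positivity)
    have h7 : (0:ℝ) ≤ 2 * c3 * Real.sqrt q := by positivity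
    have h8 : (0:ℝ) ≤ q := by positivity
    linarith
  · obtain ⟨m, hmdef⟩ : ∃ m, m = Q1 / (4 * g) := ⟨_, rfl⟩
    obtain ⟨J, hJ⟩ : ∃ J, J = (M * P0 + K) / g + 1 := ⟨_, rfl⟩
    have hm1 : 4 * g * m ≤ Q1 := by rw [hmdef]; exact Nat.mul_div_le _ _
    have hm2 : Q1 < 4 * g * m + 4 * g := by
      have := Nat.lt_mul_div_succ Q1 (show 0 < 4 * g by omega)
      rw [hmdef]
      linarith
    have hB1 : (8 * g * c2) * (8 * g * c2) ≤ Q1 := by rw [← sq]; omega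
    have hB2 : 4 * (g * (D * g)) ≤ Q1 := by omega
    have hB3 : 8 * g ≤ Q1 := by omega
    have hm3 : Q1 ≤ 8 * g * m := by linarith
    have hm4 : 1 ≤ m := by
      by_contra h
      have : m = 0 := by omega
      rw [this] at hm3
      omega
    have hJ1 : M * P0 + K ≤ g * J := by
      have := Nat.lt_mul_div_succ (M * P0 + K) hgpos
      rw [hJ]
      exact this.le
    have hJ2 : g * J ≤ M * P0 + K + g := by
      have := Nat.mul_div_le (M * P0 + K) g
      rw [hJ, mul_add]
      omega
    have hMc2 : M * c2 ≤ m := by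
      have h1 : M * (8 * g * c2) ≤ Q1 := by
        rcases le_or_gt (8 * g * c2) M with h | h
        · exact (Nat.mul_le_mul_left _ h).trans F3
        · exact (Nat.mul_le_mul_right _ h.le).trans hB1
      have h2 : 8 * g * (M * c2) ≤ 8 * g * m := by
        refine le_trans (le_of_eq ?_) (h1.trans hm3)
        ring
      exact Nat.le_of_mul_le_mul_left h2 (by omega)
    have core := stepanov_core p D g Ew hgpos hm hg hΘ hPw hirr μ ν hν M m J hMp (by
      rw [← hQ1, mul_add]
      have h1 : 4 * (g * m) ≤ Q1 := by linarith
      omega) (by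
      rw [← hP0, ← hc1]
      have h1 : m * (M * P0 + K) ≤ m * (g * J) := Nat.mul_le_mul_left _ hJ1
      have h2 : M * P0 * (D * g) ≤ Q1 * (D * g) := Nat.mul_le_mul_right _ F4
      have h3 : P0 * (M * M) * (D * g) ≤ Q1 * (D * g) := Nat.mul_le_mul_right _ F1
      have h4 : M * J ≤ Q1 + M * (K + g) := by
        have h5 : J ≤ g * J := Nat.le_mul_of_pos_left _ hgpos
        have h6 : M * J ≤ M * (M * P0 + K + g) := Nat.mul_le_mul_left _ (h5.trans hJ2)
        have h7 : M * (M * P0 + K + g) = P0 * (M * M) + M * (K + g) := by ring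
        omega
      have h7 : Q1 * (2 * (D * g) + 1) ≤ 8 * g * m * (2 * (D * g) + 1) := Nat.mul_le_mul_right _ hm3
      have h8 : m * K = 8 * g * m * (2 * (D * g) + 1) + 2 * m := by rw [hK]; ring
      have h9 : M * c2 = M * (K + g) + M * (c1 + 1) := by rw [hc2]; ring
      calc M * (P0 * (m + D * g + M * (D * g)) + J + c1 + 1)
          = m * (M * P0) + M * P0 * (D * g) + P0 * (M * M) * (D * g) + M * J + M * (c1 + 1) := by ring
        _ < m * (M * P0 + K) := by rw [mul_add]; linarith
        _ ≤ m * (g * J) := h1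
        _ = g * m * J := by ring) S (by
      rw [← hP0, ← hQ1, ← hqPQ]; exact hS)
    rw [← hQ1] at core
    have h1 : M * S.card ≤ M * q + c3 * Q1 := by
      refine core.trans ?_
      have e1 : g * (m + D * g + (J + D * g) * Q1)
        = g * m + g * (D * g) + g * J * Q1 + g * (D * g) * Q1 := by ring
      have e2 : g * J * Q1 ≤ (M * P0 + K + g) * Q1 := Nat.mul_le_mul_right _ hJ2
      have e3 : g * (D * g) ≤ g * (D * g) * Q1 := Nat.le_mul_of_pos_right _ hQ11
      have e4 : g * m ≤ Q1 := by linarith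
      rw [e1, hqPQ, hc3]
      linarith
    have h2 : (Q1 : ℝ) ≤ 2 * M * Real.sqrt q := by
      have h3 : (Q1 : ℝ) = Real.sqrt ((Q1 : ℝ) ^ 2) := (Real.sqrt_sq (by positivity)).symm
      have h4 : (2 * M : ℝ) = Real.sqrt ((2 * M : ℝ) ^ 2) := (Real.sqrt_sq (by positivity)).symm
      rw [h3, h4, ← Real.sqrt_mul (by positivity)]
      apply Real.sqrt_le_sqrt
      have : Q1 ^ 2 ≤ (2 * M) ^ 2 * q := by
        rw [hqPQ, sq]
        refine (Nat.mul_le_mul_right _ F2).trans (le_of_eq ?_)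
        ring
      exact_mod_cast this
    have h3 : (M : ℝ) * S.card ≤ M * q + c3 * Q1 := by exact_mod_cast h1
    have hM0 : (0 : ℝ) < M := by exact_mod_cast hM1
    have h4 : (c3 : ℝ) * Q1 ≤ c3 * (2 * M * Real.sqrt q) := mul_le_mul_of_nonneg_left h2 (by positivity)
    have h5 : (M : ℝ) * S.card ≤ M * (q + 2 * c3 * Real.sqrt q) := by linarith
    have h6 := le_of_mul_le_mul_left h5 hM0
    have h7 : (0:ℝ) ≤ g * B0 * Real.sqrt q := by positivity
    linarith

end BH

namespace BH

theorem lift_aux {A B K : Type} [CommRing A] [CommRing B] [IsDomain A] [IsDomain B] [Field K]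
    [IsAlgClosed K]
    (ψ : A →+* B) (χ : A →+* K) (hintg : ψ.IsIntegral) (h1 : Function.Injective ψ)
    (h2 : Function.Injective χ) : ∃ β : B →+* K, β.comp ψ = χ := by
  let a1 : Algebra A K := χ.toAlgebra
  let a2 : Algebra A B := ψ.toAlgebra
  have : FaithfulSMul A K := (faithfulSMul_iff_algebraMap_injective _ _).2 h2
  have : FaithfulSMul A B := (faithfulSMul_iff_algebraMap_injective _ _).2 h1
  have : Algebra.IsIntegral A B := ⟨hintg⟩
  let γ : B →ₐ[A] K := IsAlgClosed.lift
  exact ⟨γ.toRingHom, RingHom.ext fun a => γ.commutes a⟩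

theorem lift_prime {A B : Type} [CommRing A] [CommRing B]
    (ψ : A →+* B) (P : Ideal A) [P.IsPrime] (hintg : ψ.IsIntegral) (hker : RingHom.ker ψ ≤ P) :
    ∃ Q : Ideal B, Q.IsPrime ∧ Q.comap ψ = P := by
  let a2 : Algebra A B := ψ.toAlgebra
  have : Algebra.IsIntegral A B := ⟨hintg⟩
  obtain ⟨Q, -, hQ, hQP⟩ := Ideal.exists_ideal_over_prime_of_isIntegral (S := B) P ⊥ hker
  exact ⟨Q, hQ, hQP⟩

theorem lift_over' {A B K : Type} [CommRing A] [CommRing B] [Field K] [IsAlgClosed K]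
    (ψ : A →+* B) (χ : A →+* K) (hintg : ψ.IsIntegral) (P : Ideal A) (Q : Ideal B) [P.IsPrime]
    [Q.IsPrime] (hQP : Q.comap ψ = P) (χ' : A ⧸ P →+* K) (hχ' : Function.Injective χ')
    (hχ2 : ∀ a, χ' (Ideal.Quotient.mk P a) = χ a) :
    ∃ β : B →+* K, β.comp ψ = χ := by
  have hi : (Ideal.quotientMap Q ψ hQP.ge).IsIntegral := by
    intro x
    obtain ⟨y, rfl⟩ := Ideal.Quotient.mk_surjective x
    obtain ⟨f, hf, hy⟩ := hintg y
    refine ⟨f.map (Ideal.Quotient.mk P), hf.map _, ?_⟩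
    rw [eval₂_map, Ideal.quotientMap_comp_mk, ← hom_eval₂, hy, map_zero]
  obtain ⟨β, hβ⟩ := lift_aux (Ideal.quotientMap Q ψ hQP.ge) χ' hi
    (Ideal.quotientMap_injective' hQP.le) hχ'
  refine ⟨β.comp (Ideal.Quotient.mk Q), ?_⟩
  ext a
  rw [← hχ2, ← hβ, RingHom.comp_apply, RingHom.comp_apply, RingHom.comp_apply,
    Ideal.quotientMap_mk]

theorem lift_over {A B K : Type} [CommRing A] [CommRing B] [Field K] [IsAlgClosed K]
    (ψ : A →+* B) (χ : A →+* K) (hintg : ψ.IsIntegral) (hker : RingHom.ker ψ ≤ RingHom.ker χ) :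
    ∃ β : B →+* K, β.comp ψ = χ := by
  have : (RingHom.ker χ).IsPrime := RingHom.ker_isPrime χ
  obtain ⟨Q, hQ, hQP⟩ := lift_prime ψ (RingHom.ker χ) hintg hker
  exact lift_over' ψ χ hintg (RingHom.ker χ) Q hQP (RingHom.kerLift χ) (RingHom.kerLift_injective χ)
    fun a => rfl

theorem swap_coeff {R : Type} [CommRing R] (p : R[X][X]) (i j : ℕ) :
    ((Bivariate.swap p).coeff i).coeff j = (p.coeff j).coeff i := by
  induction p using Polynomial.induction_on' with
  | add p q hp hq => simp [hp, hq]
  | monomial n a =>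
    induction a using Polynomial.induction_on' with
    | add p q hp hq => simp only [map_add, coeff_add, hp, hq]
    | monomial m a =>
      rw [← C_mul_X_pow_eq_monomial, ← C_mul_X_pow_eq_monomial, map_mul, map_pow, C_mul, map_mul,
        C_pow, map_pow, Bivariate.swap_X, Bivariate.swap_Y, Bivariate.swap_C_C]
      have : (C (C a) * X ^ m * C X ^ n : R[X][X]) = C (C a * X ^ n) * X ^ m := by
        simp only [C_mul, C_pow]; ring
      rw [this, ← C_pow, ← C_mul, coeff_C_mul_X_pow, coeff_C_mul_X_pow]
      split_ifs <;> simp_all [coeff_X_pow]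

theorem swap_natDegree_le {R : Type} [CommRing R] (p : R[X][X]) (D : ℕ) :
    (Bivariate.swap p).natDegree ≤ D ↔ ∀ s, (p.coeff s).natDegree ≤ D := by
  simp only [natDegree_le_iff_coeff_eq_zero]
  constructor
  · intro h s i hi
    rw [← swap_coeff, h i hi, coeff_zero]
  · intro h i hi
    ext s
    rw [swap_coeff, h s i hi, coeff_zero]


/-- generic monic bivariate polynomial -/
noncomputable def bp {A : Type} [CommRing A] (g D : ℕ) (c : Fin g × Fin (D + 1) → A) : A[X][X] :=
  X ^ g + ∑ s : Fin g, C (∑ i : Fin (D + 1), C (c (s, i)) * X ^ (i : ℕ)) * X ^ (s : ℕ)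

theorem bp_map {A B : Type} [CommRing A] [CommRing B] (φ : A →+* B) (g D : ℕ)
    (c : Fin g × Fin (D + 1) → A) :
    (bp g D c).map (mapRingHom φ) = bp g D (fun x => φ (c x)) := by
  simp [bp, Polynomial.map_sum]

theorem bp_deg_lt {A : Type} [CommRing A] (g D : ℕ) (c : Fin g × Fin (D + 1) → A) :
    (∑ s : Fin g, C (∑ i : Fin (D + 1), C (c (s, i)) * X ^ (i : ℕ)) * X ^ (s : ℕ) : A[X][X]).degree
      < g := by
  refine (degree_sum_le _ _).trans_lt ?_
  refine (Finset.sup_lt_iff (WithBot.bot_lt_coe g)).2 ?_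
  intro s _
  refine (degree_C_mul_X_pow_le _ _).trans_lt ?_
  exact WithBot.coe_lt_coe.2 s.2

theorem bp_monic {A : Type} [CommRing A] (g D : ℕ) (c : Fin g × Fin (D + 1) → A) :
    (bp g D c).Monic := monic_X_pow_add (bp_deg_lt g D c)

theorem bp_natDegree {A : Type} [CommRing A] [Nontrivial A] (g D : ℕ)
    (c : Fin g × Fin (D + 1) → A) : (bp g D c).natDegree = g := by
  rw [bp, add_comm, natDegree_add_eq_right_of_degree_lt, natDegree_X_pow]
  rw [degree_X_pow]
  exact bp_deg_lt g D c

theorem bp_coeff {A : Type} [CommRing A] (g D : ℕ) (c : Fin g × Fin (D + 1) → A) (s : Fin g)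
    (i : Fin (D + 1)) : ((bp g D c).coeff s).coeff i = c (s, i) := by
  have h1 : (bp g D c).coeff s = ∑ i : Fin (D + 1), C (c (s, i)) * X ^ (i : ℕ) := by
    rw [bp, coeff_add, coeff_X_pow, if_neg s.2.ne, zero_add, finsetSum_coeff]
    simp only [coeff_C_mul_X_pow]
    rw [Finset.sum_eq_single s]
    · simp
    · intro b _ hb
      rw [if_neg]
      intro h; exact hb (Fin.ext h.symm)
    · simp
  rw [h1, finsetSum_coeff]
  simp only [coeff_C_mul_X_pow]
  rw [Finset.sum_eq_single i]
  · simp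
  · intro b _ hb
    rw [if_neg]
    intro h; exact hb (Fin.ext h.symm)
  · simp

theorem bp_coeff_deg {A : Type} [CommRing A] (g D : ℕ) (c : Fin g × Fin (D + 1) → A) (s : ℕ) :
    ((bp g D c).coeff s).natDegree ≤ D := by
  rw [bp, coeff_add, coeff_X_pow, finsetSum_coeff]
  refine natDegree_add_le_of_degree_le ?_ (natDegree_sum_le_of_forall_le _ _ ?_)
  · split_ifs <;> simp
  · intro s' _
    rw [coeff_C_mul_X_pow]
    split_ifs
    · refine natDegree_sum_le_of_forall_le _ _ ?_
      intro i _
      exact (natDegree_C_mul_X_pow_le _ _).trans (Nat.lt_succ_iff.1 i.2)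
    · simp

theorem eq_bp {A : Type} [CommRing A] [Nontrivial A] (g D : ℕ) (P : A[X][X]) (hm : P.Monic)
    (hg : P.natDegree = g)
    (hD : ∀ s, s < g → (P.coeff s).natDegree ≤ D) :
    P = bp g D (fun x => (P.coeff x.1).coeff x.2) := by
  ext s i
  rcases lt_trichotomy s g with h | h | h
  · rcases Nat.lt_or_ge i (D + 1) with h' | h'
    · exact (bp_coeff g D (fun x => (P.coeff x.1).coeff x.2) ⟨s, h⟩ ⟨i, h'⟩).symm
    · rw [coeff_eq_zero_of_natDegree_lt ((hD s h).trans_lt h'),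
        coeff_eq_zero_of_natDegree_lt ((bp_coeff_deg g D _ s).trans_lt h')]
  · have h1 : P.coeff s = 1 := by rw [h, ← hg]; exact hm
    have h2 := bp_monic g D (fun x => (P.coeff x.1).coeff x.2)
    rw [Monic, leadingCoeff, bp_natDegree] at h2
    rw [h1, h, h2]
  · rw [coeff_eq_zero_of_natDegree_lt (p := P) (by omega),
      coeff_eq_zero_of_natDegree_lt (p := bp g D _)]
    rw [bp_natDegree]; exact h

end BH

namespace BH

theorem integral_of_bp {A B : Type} [CommRing A] [CommRing B] (ψ : A →+* B) (e f D : ℕ)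
    (c : Fin (e + f) × Fin (D + 1) → A) (b1 : Fin e × Fin (D + 1) → B)
    (Q : B[X][X])
    (h : bp (e + f) D (fun x => ψ (c x)) = bp e D b1 * Q) (x : Fin e × Fin (D + 1)) :
    ψ.IsIntegralElem (b1 x) := by
  let a2 : Algebra A B := ψ.toAlgebra
  let a3 : Algebra A[X] B[X] := Polynomial.algebra A B
  have h1 : (bp (e + f) D c).map (algebraMap A[X] B[X]) = bp (e + f) D (fun x => ψ (c x)) :=
    bp_map ψ (e + f) D c
  have h2 := isIntegral_coeff_of_dvd (bp (e + f) D c) (bp e D b1) (bp_monic _ _ _) (bp_monic _ _ _)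
    (by rw [h1, h]; exact dvd_mul_right _ _) x.1
  have h3 := (Polynomial.isIntegral_iff_isIntegral_coeff).1 h2 x.2
  rw [bp_coeff] at h3
  exact h3

theorem univ_e (e f D : ℕ) : ∃ h : Finset (MvPolynomial (Fin (e + f) × Fin (D + 1)) ℤ),
    (∀ (K : Type) [Field K] [IsAlgClosed K] (c : Fin (e + f) × Fin (D + 1) → K),
      (∀ P ∈ h, MvPolynomial.aeval c P = 0) →
        ∃ b1 b2, bp (e + f) D c = bp e D b1 * bp f D b2) ∧
    (∀ (K : Type) [Field K] (c : Fin (e + f) × Fin (D + 1) → K) b1 b2,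
      bp (e + f) D c = bp e D b1 * bp f D b2 → ∀ P ∈ h, MvPolynomial.aeval c P = 0) := by
  let U := MvPolynomial ((Fin e × Fin (D + 1)) ⊕ (Fin f × Fin (D + 1))) ℤ
  let PU : U[X][X] := bp e D (fun x => MvPolynomial.X (Sum.inl x)) *
    bp f D (fun x => MvPolynomial.X (Sum.inr x))
  let I : Ideal U := Ideal.span {x | ∃ s i, D < i ∧ x = (PU.coeff s).coeff i}
  let π : U →+* U ⧸ I := Ideal.Quotient.mk I
  let cB : Fin (e + f) × Fin (D + 1) → U ⧸ I := fun x => π ((PU.coeff x.1).coeff x.2)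
  let ψ : MvPolynomial (Fin (e + f) × Fin (D + 1)) ℤ →+* U ⧸ I := (MvPolynomial.aeval cB).toRingHom
  have hPU : PU.map (mapRingHom π) = bp e D (fun x => π (MvPolynomial.X (Sum.inl x))) *
    bp f D (fun x => π (MvPolynomial.X (Sum.inr x))) := by
    simp only [PU, Polynomial.map_mul, bp_map]
  have hcB : PU.map (mapRingHom π) = bp (e + f) D cB := by
    rcases subsingleton_or_nontrivial (U ⧸ I) with hs | hs
    · exact Subsingleton.elim _ _
    rw [eq_bp (e + f) D (PU.map (mapRingHom π))]
    · congr 1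
      funext x
      simp [cB]
    · rw [hPU]; exact (bp_monic _ _ _).mul (bp_monic _ _ _)
    · rw [hPU, (bp_monic _ _ _).natDegree_mul (bp_monic _ _ _), bp_natDegree, bp_natDegree]
    · intro s _
      rw [natDegree_le_iff_coeff_eq_zero]
      intro i hi
      rw [coeff_map, coe_mapRingHom, coeff_map]
      exact Ideal.Quotient.eq_zero_iff_mem.2 (Ideal.subset_span ⟨s, i, hi, rfl⟩)
  have hψX : ∀ x, ψ (MvPolynomial.X x) = cB x := fun x => MvPolynomial.aeval_X cB x
  have hψint : ψ.IsIntegral := by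
    intro y
    obtain ⟨u, rfl⟩ := Ideal.Quotient.mk_surjective y
    induction u using MvPolynomial.induction_on with
    | C n =>
      have : (Ideal.Quotient.mk I) (MvPolynomial.C n) = ψ (MvPolynomial.C n) := by
        rw [eq_intCast, map_intCast, eq_intCast, map_intCast]
      rw [this]
      exact RingHom.isIntegralElem_map ψ
    | add p q hp hq => rw [map_add]; exact RingHom.IsIntegralElem.add ψ hp hq
    | mul_X p x hp =>
      rw [map_mul]
      refine RingHom.IsIntegralElem.mul ψ hp ?_
      rcases x with x | x
      · refine integral_of_bp ψ e f D (fun x => MvPolynomial.X x)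
          (fun x => π (MvPolynomial.X (Sum.inl x)))
          (bp f D (fun x => π (MvPolynomial.X (Sum.inr x)))) ?_ x
        simp only [hψX]
        rw [← hcB, hPU]
      · have hc : ∀ (g : ℕ) (hg : e + f = g) (c : Fin (e + f) × Fin (D + 1) → U ⧸ I),
            bp (e + f) D c = bp g D (fun x => c (Fin.cast hg.symm x.1, x.2)) := by
          intro g hg c; subst hg; rfl
        refine integral_of_bp ψ f e D
          (fun x => MvPolynomial.X (Fin.cast (add_comm f e) x.1, x.2))
          (fun x => π (MvPolynomial.X (Sum.inr x)))
          (bp e D (fun x => π (MvPolynomial.X (Sum.inl x)))) ?_ x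
        simp only [hψX]
        rw [← hc _ (add_comm e f) cB, ← hcB, hPU, mul_comm]
  obtain ⟨h, hh⟩ : (RingHom.ker ψ).FG := IsNoetherian.noetherian _
  refine ⟨h, ?_, ?_⟩
  · intro K _ _ c hc
    obtain ⟨β, hβ⟩ := lift_over ψ (MvPolynomial.aeval c : _ →ₐ[ℤ] K).toRingHom hψint (by
      rw [← hh]
      refine Submodule.span_le.2 ?_
      intro P hP
      exact hc P hP)
    refine ⟨fun x => β (π (MvPolynomial.X (Sum.inl x))), fun x => β (π (MvPolynomial.X (Sum.inr x))), ?_⟩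
    rw [← bp_map β e D (fun x => π (MvPolynomial.X (Sum.inl x))),
      ← bp_map β f D (fun x => π (MvPolynomial.X (Sum.inr x))), ← Polynomial.map_mul, ← hPU, hcB, bp_map]
    congr 1
    funext x
    rw [← hψX, ← RingHom.comp_apply, hβ]
    exact (MvPolynomial.aeval_X c x).symm
  · intro K _ c b1 b2 hb P hP
    let ε : U →+* K := (MvPolynomial.aeval (Sum.elim b1 b2) : U →ₐ[ℤ] K).toRingHom
    have hε1 : ∀ x, ε (MvPolynomial.X x) = Sum.elim b1 b2 x := fun x => MvPolynomial.aeval_X _ x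
    have hεU : PU.map (mapRingHom ε) = bp (e + f) D c := by
      rw [hb, Polynomial.map_mul, bp_map, bp_map]
      simp only [hε1, Sum.elim_inl, Sum.elim_inr]
    have hco : ∀ s i, ε ((PU.coeff s).coeff i) = ((bp (e + f) D c).coeff s).coeff i := by
      intro s i
      rw [← hεU, coeff_map, coe_mapRingHom, coeff_map]
    have hI : ∀ x ∈ I, ε x = 0 := by
      intro x hx
      have : I ≤ RingHom.ker ε := by
        refine Ideal.span_le.2 ?_
        rintro _ ⟨s, i, hi, rfl⟩
        change ε _ = 0
        rw [hco]
        exact coeff_eq_zero_of_natDegree_lt ((bp_coeff_deg _ _ _ _).trans_lt hi)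
      exact this hx
    let β : U ⧸ I →+* K := Ideal.Quotient.lift I ε hI
    have hβ : β.comp ψ = (MvPolynomial.aeval c : _ →ₐ[ℤ] K).toRingHom := by
      apply MvPolynomial.ringHom_ext
      · intro n; simp
      · intro x
        rw [RingHom.comp_apply, hψX]
        refine (hco x.1 x.2).trans ?_
        rw [bp_coeff]
        exact (MvPolynomial.aeval_X c x).symm
    have hP0 : ψ P = 0 := by
      have : P ∈ RingHom.ker ψ := by rw [← hh]; exact Submodule.subset_span hP
      exact this
    have := RingHom.congr_fun hβ P
    rw [RingHom.comp_apply, hP0, map_zero] at this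
    exact this.symm

end BH

namespace BH

theorem bp_irreducible_iff {K : Type} [Field K] (g D : ℕ) (hg : 0 < g)
    (c : Fin g × Fin (D + 1) → K) : Irreducible (bp g D c) ↔
    ∀ e f, 0 < e → 0 < f → e + f = g → ∀ b1 b2, bp g D c ≠ bp e D b1 * bp f D b2 := by
  have hm := bp_monic g D c
  have hd := bp_natDegree g D c
  constructor
  · intro h e f he hf hef b1 b2 hb
    rcases h.isUnit_or_isUnit hb with h1 | h1
    · have := (bp_monic e D b1).eq_one_of_isUnit h1
      have h2 := bp_natDegree e D b1
      rw [this, natDegree_one] at h2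
      omega
    · have := (bp_monic f D b2).eq_one_of_isUnit h1
      have h2 := bp_natDegree f D b2
      rw [this, natDegree_one] at h2
      omega
  · intro h
    rw [hm.irreducible_iff_natDegree']
    refine ⟨?_, ?_⟩
    · intro h1
      rw [h1, natDegree_one] at hd
      omega
    · intro A B hA hB hAB hmem
      rw [Finset.mem_Ioc, hd] at hmem
      have hdeg : A.natDegree + B.natDegree = g := by
        rw [← hA.natDegree_mul hB, hAB, hd]
      have hsw : (Bivariate.swap A).natDegree + (Bivariate.swap B).natDegree ≤ D := by
        rw [← natDegree_mul, ← map_mul, hAB]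
        · exact (swap_natDegree_le _ D).2 (bp_coeff_deg g D c)
        · simpa using hA.ne_zero
        · simpa using hB.ne_zero
      have hAD := (swap_natDegree_le A D).1 (by omega)
      have hBD := (swap_natDegree_le B D).1 (by omega)
      refine h A.natDegree B.natDegree (by omega) hmem.1 hdeg
        (fun x => (A.coeff x.1).coeff x.2) (fun x => (B.coeff x.1).coeff x.2) ?_
      rw [← eq_bp A.natDegree D A hA rfl (fun s _ => hAD s),
        ← eq_bp B.natDegree D B hB rfl (fun s _ => hBD s), hAB]

theorem bn_univ (g D : ℕ) (hg : 0 < g) :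
    ∃ h : ℕ → Finset (MvPolynomial (Fin g × Fin (D + 1)) ℤ),
    (∀ (K : Type) [Field K] [IsAlgClosed K] (c : Fin g × Fin (D + 1) → K),
      Irreducible (bp g D c) → ∀ e, 0 < e → e < g → ∃ P ∈ h e, MvPolynomial.aeval c P ≠ 0) ∧
    (∀ (K : Type) [Field K] (c : Fin g × Fin (D + 1) → K),
      (∀ e, 0 < e → e < g → ∃ P ∈ h e, MvPolynomial.aeval c P ≠ 0) → Irreducible (bp g D c)) := by
  have key : ∀ e, ∃ h : Finset (MvPolynomial (Fin g × Fin (D + 1)) ℤ), 0 < e → e < g →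
      (∀ (K : Type) [Field K] [IsAlgClosed K] (c : Fin g × Fin (D + 1) → K),
      (∀ P ∈ h, MvPolynomial.aeval c P = 0) →
        ∃ b1 b2, bp g D c = bp e D b1 * bp (g - e) D b2) ∧
    (∀ (K : Type) [Field K] (c : Fin g × Fin (D + 1) → K) b1 b2,
      bp g D c = bp e D b1 * bp (g - e) D b2 → ∀ P ∈ h, MvPolynomial.aeval c P = 0) := by
    intro e
    by_cases he : e < g
    · obtain ⟨f, rfl⟩ : ∃ f, g = e + f := ⟨g - e, by omega⟩
      obtain ⟨h, h1, h2⟩ := univ_e e f D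
      have : e + f - e = f := by omega
      rw [this]
      exact ⟨h, fun _ _ => ⟨h1, h2⟩⟩
    · exact ⟨∅, fun _ h => absurd h he⟩
  choose h hh using key
  refine ⟨h, ?_, ?_⟩
  · intro K _ _ c hirr e he heg
    by_contra hcon
    push Not at hcon
    obtain ⟨b1, b2, hb⟩ := (hh e he heg).1 K c hcon
    exact (bp_irreducible_iff g D hg c).1 hirr e (g - e) he (by omega) (by omega) b1 b2 hb
  · intro K _ c hc
    rw [bp_irreducible_iff g D hg c]
    intro e f he hf hef b1 b2 hb
    obtain rfl : f = g - e := by omega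
    obtain ⟨P, hP, hP0⟩ := hc e he (by omega)
    exact hP0 ((hh e he (by omega)).2 K c b1 b2 hb P hP)

theorem exists_coeff_bound {A : Type} [CommRing A] (P : A[X][X]) :
    ∃ D, ∀ s, (P.coeff s).natDegree ≤ D :=
  ⟨(Bivariate.swap P).natDegree, (swap_natDegree_le P _).1 le_rfl⟩

/-- geometric irreducibility is preserved by field extension -/
theorem irreducible_ext {k E : Type} [Field k] [IsAlgClosed k] [Field E] (φ : k →+* E)
    (P : k[X][X]) (hm : P.Monic) (hd : 0 < P.natDegree) (hirr : Irreducible P) :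
    Irreducible (P.map (mapRingHom φ)) := by
  obtain ⟨D, hD⟩ := exists_coeff_bound P
  obtain ⟨h, h1, h2⟩ := bn_univ P.natDegree D hd
  have hP := eq_bp P.natDegree D P hm rfl (fun s _ => hD s)
  rw [hP] at hirr ⊢
  rw [bp_map]
  have h3 := h1 k _ hirr
  apply h2
  intro e he heg
  obtain ⟨Q, hQ, hQ0⟩ := h3 e he heg
  refine ⟨Q, hQ, ?_⟩
  have : ∀ c : Fin P.natDegree × Fin (D + 1) → k,
      MvPolynomial.aeval (fun x => φ (c x)) Q = φ (MvPolynomial.aeval c Q) := by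
    intro c
    rw [MvPolynomial.aeval_def, MvPolynomial.aeval_def, MvPolynomial.hom_eval₂]
    congr 1
    exact RingHom.ext_int _ _
  rw [this]
  exact (map_ne_zero φ).2 hQ0

theorem totalDegree_aeval_le {σ ι k : Type} [Field k] (c : σ → MvPolynomial ι k) (E0 : ℕ)
    (hc : ∀ x, (c x).totalDegree ≤ E0) (P : MvPolynomial σ ℤ) :
    (MvPolynomial.aeval c P).totalDegree ≤ P.totalDegree * E0 := by
  rw [MvPolynomial.aeval_def, MvPolynomial.eval₂_eq]
  refine MvPolynomial.totalDegree_finsetSum_le ?_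
  intro d hd
  refine (MvPolynomial.totalDegree_mul _ _).trans ?_
  have h1 : ((algebraMap ℤ (MvPolynomial ι k)) (MvPolynomial.coeff d P)).totalDegree = 0 := by
    rw [eq_intCast, ← map_intCast (MvPolynomial.C : k →+* MvPolynomial ι k)]
    exact MvPolynomial.totalDegree_C _
  rw [h1, zero_add]
  refine (MvPolynomial.totalDegree_finsetProd _ _).trans ?_
  calc _ ≤ ∑ i ∈ d.support, d i * E0 := Finset.sum_le_sum fun i _ =>
        (MvPolynomial.totalDegree_pow _ _).trans (Nat.mul_le_mul_left _ (hc i))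
    _ = (∑ i ∈ d.support, d i) * E0 := by rw [Finset.sum_mul]
    _ ≤ _ := Nat.mul_le_mul_right _ (MvPolynomial.le_totalDegree hd)

theorem bertini_noether (g D E0 : ℕ) (hg : 0 < g) : ∃ E : ℕ, ∀ (k : Type) [Field k]
    (ι : Type) (Θ : (MvPolynomial ι k)[X][X]), Θ.Monic → Θ.natDegree = g →
    (∀ s, (Θ.coeff s).natDegree ≤ D) → (∀ s i, ((Θ.coeff s).coeff i).totalDegree ≤ E0) →
    ∀ (Ω : Type) [Field Ω] [IsAlgClosed Ω] (φ : MvPolynomial ι k →+* Ω),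
      Irreducible (Θ.map (mapRingHom φ)) →
      ∃ Q : MvPolynomial ι k, φ Q ≠ 0 ∧ Q.totalDegree ≤ E ∧
        ∀ (K : Type) [Field K] (ev : MvPolynomial ι k →+* K), ev Q ≠ 0 →
          Irreducible (Θ.map (mapRingHom ev)) := by
  classical
  obtain ⟨h, h1, h2⟩ := bn_univ g D hg
  refine ⟨∑ e ∈ Finset.Ioo 0 g, ((h e).sup MvPolynomial.totalDegree) * E0, ?_⟩
  intro k _ ι Θ hm hd hD hE Ω _ _ φ hirr
  have hΘ := eq_bp g D Θ hm hd (fun s _ => hD s)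
  obtain ⟨c, hc⟩ : ∃ c : Fin g × Fin (D + 1) → MvPolynomial ι k,
    c = fun x => (Θ.coeff x.1).coeff x.2 := ⟨_, rfl⟩
  rw [← hc] at hΘ
  rw [hΘ, bp_map] at hirr
  have hev : ∀ (K : Type) [Field K] (ev : MvPolynomial ι k →+* K) (P : MvPolynomial _ ℤ),
      MvPolynomial.aeval (fun x => ev (c x)) P = ev (MvPolynomial.aeval c P) := by
    intro K _ ev P
    rw [MvPolynomial.aeval_def, MvPolynomial.aeval_def, MvPolynomial.hom_eval₂]
    congr 1
    exact RingHom.ext_int _ _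
  have h3 := h1 Ω _ hirr
  choose! P hP hP0 using h3
  refine ⟨∏ e ∈ Finset.Ioo 0 g, MvPolynomial.aeval c (P e), ?_, ?_, ?_⟩
  · rw [map_prod, Finset.prod_ne_zero_iff]
    intro e he
    rw [Finset.mem_Ioo] at he
    rw [← hev]
    exact hP0 e he.1 he.2
  · refine (MvPolynomial.totalDegree_finsetProd _ _).trans (Finset.sum_le_sum ?_)
    intro e he
    rw [Finset.mem_Ioo] at he
    refine (totalDegree_aeval_le c E0 (fun x => by rw [hc]; exact hE _ _) _).trans ?_
    exact Nat.mul_le_mul_right _ (Finset.le_sup (f := MvPolynomial.totalDegree) (hP e he.1 he.2))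
  · intro K _ ev hQ
    rw [map_prod, Finset.prod_ne_zero_iff] at hQ
    rw [hΘ, bp_map]
    apply h2
    intro e he heg
    refine ⟨P e, hP e he heg, ?_⟩
    rw [hev]
    exact hQ e (Finset.mem_Ioo.2 ⟨he, heg⟩)

end BH

namespace BH

open MvPolynomial in
theorem one_block (N : ℕ) (A : Type) [CommRing A] (H : MvPolynomial (Fin N) A) :
    ∃ G : MvPolynomial (Fin N) A, ∀ (B : Type) [CommRing B] (φ : A →+* B) (τ : Fin N → B),
      eval₂ φ (fun j => (∏ j', (Polynomial.X - Polynomial.C (τ j'))).coeff j) G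
        = ∏ g : Equiv.Perm (Fin N), eval₂ φ (fun j => τ (g j)) H := by
  have hsym : (∏ g : Equiv.Perm (Fin N), rename g H).IsSymmetric := by
    intro e
    rw [map_prod]
    simp only [rename_rename]
    exact Fintype.prod_equiv (Equiv.mulLeft e) _ _ (fun g => rfl)
  obtain ⟨G0, hG0⟩ := (esymmAlgHom_fin_surjective (R := A) (le_refl N))
    ⟨_, hsym⟩
  have hG1 : aeval (fun i : Fin N => esymm (Fin N) A (i + 1)) G0
      = ∏ g : Equiv.Perm (Fin N), rename g H := by
    rw [← esymmAlgHom_apply, hG0]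
  refine ⟨aeval (fun i : Fin N => (-1) ^ ((i : ℕ) + 1) * X i.rev) G0, ?_⟩
  intro B _ φ τ
  have h1 : ∏ g : Equiv.Perm (Fin N), eval₂ φ (fun j => τ (g j)) H
      = eval₂Hom φ τ (∏ g : Equiv.Perm (Fin N), rename g H) := by
    rw [map_prod]
    refine Finset.prod_congr rfl fun g _ => ?_
    rw [coe_eval₂Hom, eval₂_rename]
    rfl
  rw [h1, ← hG1]
  change eval₂Hom φ _ (aeval _ G0) = _
  rw [MvPolynomial.aeval_def, MvPolynomial.aeval_def, MvPolynomial.hom_eval₂, MvPolynomial.hom_eval₂]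
  have h2 : ∀ f : Fin N → B, (eval₂Hom φ f).comp (algebraMap A (MvPolynomial (Fin N) A)) = φ := by
    intro f; ext a; simp
  rw [h2, h2]
  congr 1
  funext i
  have h3 := Multiset.prod_X_sub_C_coeff (Finset.univ.val.map τ) (k := (i.rev : ℕ)) (by
    simp)
  rw [Multiset.map_map] at h3
  have h4 : (∏ j', (Polynomial.X - Polynomial.C (τ j'))).coeff (i.rev : ℕ) =
    (-1) ^ ((i : ℕ) + 1) * (Finset.univ.val.map τ).esymm (i + 1) := by
    have : Multiset.card (Multiset.map τ Finset.univ.val) - (i.rev : ℕ) = i + 1 := by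
      simp [Fin.rev]; omega
    rw [this] at h3
    exact h3
  simp only [map_mul, map_pow, map_neg, map_one, coe_eval₂Hom, MvPolynomial.eval₂_X]
  rw [h4, ← mul_assoc, ← mul_pow]
  simp only [mul_neg, mul_one, neg_neg, one_pow, one_mul]
  rw [Finset.esymm_map_val, esymm, MvPolynomial.eval₂_sum]
  simp [MvPolynomial.eval₂_prod]

open MvPolynomial in
theorem blocks : ∀ (m : ℕ) (N : Fin m → ℕ) (A : Type) [CommRing A]
    (H : MvPolynomial (Σ i, Fin (N i)) A),
    ∃ G : MvPolynomial (Σ i, Fin (N i)) A, ∀ (B : Type) [CommRing B] (φ : A →+* B)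
      (τ : ∀ i, Fin (N i) → B),
      eval₂ φ (fun x => (∏ j', (Polynomial.X - Polynomial.C (τ x.1 j'))).coeff x.2) G
        = ∏ g : ∀ i, Equiv.Perm (Fin (N i)), eval₂ φ (fun x => τ x.1 (g x.1 x.2)) H
  | 0, N, A, _, H => by
    refine ⟨H, fun B _ φ τ => ?_⟩
    rw [Fintype.prod_unique]
    congr 1
    funext x
    exact x.1.elim0
  | m + 1, N, A, _, H => by
    let f1 : (Σ i, Fin (N i)) → MvPolynomial (Fin (N 0)) (MvPolynomial (Σ i : Fin m, Fin (N i.succ)) A) :=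
      fun x => Fin.cases (motive := fun i => Fin (N i) → MvPolynomial (Fin (N 0)) (MvPolynomial (Σ i : Fin m, Fin (N i.succ)) A))
        (fun j => X j) (fun i j => C (X ⟨i, j⟩)) x.1 x.2
    obtain ⟨G1, hG1⟩ := one_block (N 0) (MvPolynomial (Σ i : Fin m, Fin (N i.succ)) A)
      (eval₂ (C.comp C) f1 H)
    let G2 : MvPolynomial (Σ i : Fin m, Fin (N i.succ)) (MvPolynomial (Fin (N 0)) A) :=
      eval₂ (eval₂Hom (C.comp C) X) (fun j => C (X j)) G1
    obtain ⟨G3, hG3⟩ := blocks m (fun i => N i.succ) (MvPolynomial (Fin (N 0)) A) G2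
    refine ⟨eval₂ (eval₂Hom C (fun j => X ⟨0, j⟩)) (fun x => X ⟨x.1.succ, x.2⟩) G3, ?_⟩
    intro B _ φ τ
    change eval₂Hom φ _ (eval₂ _ _ G3) = _
    rw [MvPolynomial.hom_eval₂]
    have e1 : ∀ f : (Σ i, Fin (N i)) → B, (eval₂Hom φ f).comp (eval₂Hom C (fun j : Fin (N 0) => X ⟨0, j⟩))
        = eval₂Hom φ (fun j => f ⟨0, j⟩) := by
      intro f
      apply MvPolynomial.ringHom_ext <;> intro x <;> simp
    rw [e1]
    simp only [coe_eval₂Hom, MvPolynomial.eval₂_X]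
    have := hG3 B (eval₂Hom φ (fun j : Fin (N 0) =>
      (∏ j', (Polynomial.X - Polynomial.C (τ 0 j'))).coeff j)) (fun i => τ i.succ)
    refine this.trans ?_
    rw [← Fintype.prod_equiv (Fin.consEquiv (fun i => Equiv.Perm (Fin (N i))))
      (fun p => eval₂ φ (fun x => τ x.1 ((Fin.consEquiv (fun i => Equiv.Perm (Fin (N i))) p) x.1 x.2)) H)
      _ (fun p => rfl), Fintype.prod_prod_type, Finset.prod_comm]
    refine Finset.prod_congr rfl fun g _ => ?_
    have h5 : eval₂ (eval₂Hom φ (fun j : Fin (N 0) =>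
      (∏ j', (Polynomial.X - Polynomial.C (τ 0 j'))).coeff j)) (fun x => τ x.1.succ (g x.1 x.2)) G2
      = eval₂ (eval₂Hom φ (fun x : Σ i : Fin m, Fin (N i.succ) => τ x.1.succ (g x.1 x.2)))
        (fun j => (∏ j', (Polynomial.X - Polynomial.C (τ 0 j'))).coeff j) G1 := by
      change eval₂Hom _ _ (eval₂ _ _ G1) = _
      rw [MvPolynomial.hom_eval₂]
      congr 1
      · apply MvPolynomial.ringHom_ext <;> intro x <;> simp
      · funext j; simp
    rw [h5, hG1]
    refine Finset.prod_congr rfl fun g0 _ => ?_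
    change eval₂Hom _ _ (eval₂ _ _ H) = _
    rw [MvPolynomial.hom_eval₂]
    congr 1
    · ext x; simp
    · funext x
      obtain ⟨i, j⟩ := x
      refine Fin.cases (fun j => ?_) (fun i j => ?_) i j
      · simp [f1, Fin.consEquiv]
      · simp [f1, Fin.consEquiv]

end BH

namespace BH

abbrev JJ {m : ℕ} (N : Fin m → ℕ) : Type := Σ i, Fin (N i)

/-- coefficients of the monic polynomials with given roots -/
noncomputable def cf {m : ℕ} {N : Fin m → ℕ} {B : Type} [CommRing B] (τ : ∀ i, Fin (N i) → B) :
    JJ N → B :=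
  fun x => (∏ j', (X - C (τ x.1 j'))).coeff x.2

/-- evaluation of integral polynomials -/
noncomputable def zev {σ : Type} {B : Type} [CommRing B] (c : σ → B) : MvPolynomial σ ℤ →+* B :=
  MvPolynomial.eval₂Hom (Int.castRingHom B) c

@[simp] theorem zev_X {σ : Type} {B : Type} [CommRing B] (c : σ → B) (x : σ) :
    zev c (MvPolynomial.X x) = c x := by simp [zev]

theorem cf_map {m : ℕ} {N : Fin m → ℕ} {B B' : Type} [CommRing B] [CommRing B'] (f : B →+* B')
    (τ : ∀ i, Fin (N i) → B) (x : JJ N) :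
    cf (fun i j => f (τ i j)) x = f (cf τ x) := by
  unfold cf
  rw [← Polynomial.coeff_map, Polynomial.map_prod]
  simp

/-- monic polynomials over a domain split over some algebraically closed field -/
theorem exists_cf {m : ℕ} {N : Fin m → ℕ} {L : Type} [Field L] [IsAlgClosed L]
    (b : JJ N → L) : ∃ τ : ∀ i, Fin (N i) → L, cf τ = b := by
  have key : ∀ i, ∃ t : Fin (N i) → L, ∀ j : Fin (N i), (∏ j', (X - C (t j'))).coeff j = b ⟨i, j⟩ := by
    intro i
    let P : L[X] := X ^ (N i) + ∑ j : Fin (N i), C (b ⟨i, j⟩) * X ^ (j : ℕ)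
    have hlt : (∑ j : Fin (N i), C (b ⟨i, j⟩) * X ^ (j : ℕ)).degree < (N i : WithBot ℕ) := by
      exact Polynomial.degree_sum_fin_lt (fun j => b ⟨i, j⟩)
    have hPm : P.Monic := monic_X_pow_add hlt
    have hPd : P.natDegree = N i := by
      have : P.degree = N i := by
        simp only [P]
        rw [degree_add_eq_left_of_degree_lt]
        · simp
        · simpa using hlt
      exact natDegree_eq_of_degree_eq_some this
    have hsp := IsAlgClosed.splits P
    have hcard : P.roots.card = N i := by rw [← hPd]; exact hsp.natDegree_eq_card_roots.symm
    have hprod := hsp.eq_prod_roots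
    rw [hPm.leadingCoeff, C_1, one_mul] at hprod
    let l := P.roots.toList
    have hl : l.length = N i := by simp [l, hcard]
    refine ⟨fun j => l.get (j.cast hl.symm), fun j => ?_⟩
    have : ∏ j' : Fin (N i), (X - C (l.get (j'.cast hl.symm))) = P := by
      rw [hprod]
      have h2 : P.roots = Multiset.ofList l := by simp [l]
      rw [h2, Multiset.map_coe, Multiset.prod_coe, ← List.prod_ofFn]
      congr 1
      apply List.ext_get
      · simp [hl]
      · intro n h1 h2
        simp
    rw [this]
    simp only [P, coeff_add, coeff_X_pow, finsetSum_coeff, coeff_C_mul]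
    rw [if_neg (by omega), zero_add]
    rw [Finset.sum_eq_single j]
    · simp
    · intro b _ hb
      rw [if_neg (fun h => hb (Fin.ext h.symm))]
      simp
    · simp
  choose t ht using key
  exact ⟨t, by funext ⟨i, j⟩; exact ht i j⟩

/-- linear form -/
noncomputable def lf {m : ℕ} {N : Fin m → ℕ} {B : Type} [CommRing B] (c : JJ N → B)
    (τ : ∀ i, Fin (N i) → B) (g : ∀ i, Equiv.Perm (Fin (N i))) : B :=
  ∑ x : JJ N, c x * τ x.1 (g x.1 x.2)

theorem lf_map {m : ℕ} {N : Fin m → ℕ} {B B' : Type} [CommRing B] [CommRing B'] (f : B →+* B')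
    (c : JJ N → B) (τ : ∀ i, Fin (N i) → B) (g : ∀ i, Equiv.Perm (Fin (N i))) :
    lf (fun x => f (c x)) (fun i j => f (τ i j)) g = f (lf c τ g) := by
  simp [lf]

theorem resolvent (m : ℕ) (N : Fin m → ℕ) :
    ∃ (U : (MvPolynomial (JJ N ⊕ JJ N) ℤ)[X]),
      U.Monic ∧ U.natDegree = Fintype.card (∀ i, Equiv.Perm (Fin (N i))) ∧
      (∀ (B : Type) [CommRing B] (c : JJ N → B) (τ : ∀ i, Fin (N i) → B),
        U.map (zev (Sum.elim c (cf τ)))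
          = ∏ g : ∀ i, Equiv.Perm (Fin (N i)), (X - C (lf c τ g))) := by
  obtain ⟨G, hG⟩ := blocks m N ((MvPolynomial (JJ N) ℤ)[X])
    (MvPolynomial.C X - ∑ x : JJ N, MvPolynomial.C (C (MvPolynomial.X x)) * MvPolynomial.X x)
  let U : (MvPolynomial (JJ N ⊕ JJ N) ℤ)[X] := MvPolynomial.eval₂
    (mapRingHom (MvPolynomial.rename Sum.inl).toRingHom) (fun x => C (MvPolynomial.X (Sum.inr x))) G
  have h3 : ∀ (B : Type) [CommRing B] (c : JJ N → B) (τ : ∀ i, Fin (N i) → B),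
        U.map (zev (Sum.elim c (cf τ)))
          = ∏ g : ∀ i, Equiv.Perm (Fin (N i)), (X - C (lf c τ g)) := by
    intro B _ c τ
    have := hG B[X] (mapRingHom (zev c)) (fun i j => C (τ i j))
    simp only [U]
    change mapRingHom _ (MvPolynomial.eval₂ _ _ G) = _
    rw [MvPolynomial.hom_eval₂]
    have e1 : (mapRingHom (zev (Sum.elim c (cf τ)))).comp
       (mapRingHom (MvPolynomial.rename (R := ℤ) (Sum.inl : JJ N → JJ N ⊕ JJ N)).toRingHom) =
       mapRingHom (zev c) := by
      rw [mapRingHom_comp]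
      congr 1
      apply MvPolynomial.ringHom_ext
      · intro r; simp
      · intro x; simp
    rw [e1]
    have e2 : (fun i : JJ N => (mapRingHom (zev (Sum.elim c (cf τ))))
        (C (MvPolynomial.X (Sum.inr i)))) = cf (fun i j => C (τ i j)) := by
      funext x
      rw [cf_map]
      simp
    rw [e2]
    refine Eq.trans this ?_
    refine Finset.prod_congr rfl fun g _ => ?_
    rw [← MvPolynomial.coe_eval₂Hom]
    simp [lf]
  refine ⟨U, ?_, ?_, h3⟩
  all_goals
    let K := AlgebraicClosure (FractionRing (MvPolynomial (JJ N ⊕ JJ N) ℤ))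
    let f : MvPolynomial (JJ N ⊕ JJ N) ℤ →+* K := (algebraMap (FractionRing (MvPolynomial (JJ N ⊕ JJ N) ℤ)) K).comp
      (algebraMap (MvPolynomial (JJ N ⊕ JJ N) ℤ) (FractionRing (MvPolynomial (JJ N ⊕ JJ N) ℤ)))
    have hf : Function.Injective f :=
      (algebraMap (FractionRing (MvPolynomial (JJ N ⊕ JJ N) ℤ)) K).injective.comp
        (IsFractionRing.injective _ _)
    obtain ⟨τ, hτ⟩ := exists_cf (fun x : JJ N => f (MvPolynomial.X (Sum.inr x)))
    have h4 := h3 K (fun x : JJ N => f (MvPolynomial.X (Sum.inl x))) τ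
    have e3 : (zev (Sum.elim (fun x : JJ N => f (MvPolynomial.X (Sum.inl x))) (cf τ)))
        = f := by
      apply MvPolynomial.ringHom_ext
      · intro r; simp
      · rw [hτ]
        rintro (x | x) <;> simp
    rw [e3] at h4
  · refine Polynomial.monic_of_injective hf ?_
    rw [h4]
    exact monic_prod_of_monic _ _ fun g _ => monic_X_sub_C _
  · rw [← natDegree_map_eq_of_injective hf, h4, natDegree_prod_of_monic _ _ fun g _ => monic_X_sub_C _]
    simp

theorem resolvent' (m : ℕ) (N : Fin m → ℕ) :
    ∃ (U : (MvPolynomial (JJ N ⊕ JJ N) ℤ)[X])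
      (V : (MvPolynomial (JJ N ⊕ JJ N ⊕ JJ N) ℤ)[X]),
      U.Monic ∧ U.natDegree = Fintype.card (∀ i, Equiv.Perm (Fin (N i))) ∧
      (∀ (B : Type) [CommRing B] (c : JJ N → B) (τ : ∀ i, Fin (N i) → B),
        U.map (zev (Sum.elim c (cf τ)))
          = ∏ g : ∀ i, Equiv.Perm (Fin (N i)), (X - C (lf c τ g))) ∧
      (∀ (B : Type) [CommRing B] (c c' : JJ N → B) (τ : ∀ i, Fin (N i) → B),
        V.map (zev (Sum.elim c (Sum.elim c' (cf τ))))
          = ∑ g : ∀ i, Equiv.Perm (Fin (N i)), C (lf c' τ g) *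
            ∏ h ∈ Finset.univ.erase g, (X - C (lf c τ h))) := by
  obtain ⟨U, hU1, hU2, hU3⟩ := resolvent m N
  let θ : MvPolynomial (JJ N ⊕ JJ N) ℤ →+* (MvPolynomial (JJ N ⊕ JJ N ⊕ JJ N) ℤ)[X][X] :=
    zev (Sum.elim (fun x : JJ N => C (C (MvPolynomial.X (R := ℤ) (Sum.inl x : JJ N ⊕ JJ N ⊕ JJ N))) +
      X * C (C (MvPolynomial.X (R := ℤ) (Sum.inr (Sum.inl x) : JJ N ⊕ JJ N ⊕ JJ N))))
      (fun x : JJ N => C (C (MvPolynomial.X (R := ℤ) (Sum.inr (Sum.inr x) : JJ N ⊕ JJ N ⊕ JJ N)))))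
  refine ⟨U, -(derivative (U.eval₂ θ (C X))).eval 0, hU1, hU2, hU3, ?_⟩
  intro B _ c c' τ
  set f : MvPolynomial (JJ N ⊕ JJ N ⊕ JJ N) ℤ →+* B := (zev (Sum.elim c (Sum.elim c' (cf τ)))) with hf
  have e1 : (-(derivative (U.eval₂ θ (C X))).eval 0).map f
      = -(derivative ((U.eval₂ θ (C X)).map (mapRingHom f))).eval 0 := by
    rw [Polynomial.map_neg, derivative_map, eval_map]
    rw [← coe_mapRingHom, ← eval₂_at_apply]
    simp
  rw [e1]
  have e2 : (U.eval₂ θ (C X)).map (mapRingHom f) =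
      ∏ g : ∀ i, Equiv.Perm (Fin (N i)), (C (X - C (lf c τ g)) - X * C (C (lf c' τ g))) := by
    rw [← coe_mapRingHom, hom_eval₂]
    have := hU3 B[X][X] (fun x => C (C (c x)) + X * C (C (c' x))) (fun i j => C (C (τ i j)))
    have e3 : (mapRingHom (mapRingHom f)).comp θ = (zev
        (Sum.elim (fun x => C (C (c x)) + X * C (C (c' x))) (cf (fun i j => C (C (τ i j)))))) := by
      apply MvPolynomial.ringHom_ext
      · intro r; simp
      · rintro (x | x)
        · simp [θ, hf]
        · have := cf_map ((C : B[X] →+* B[X][X]).comp C) τ x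
          simp only [RingHom.comp_apply] at this
          simp [θ, hf, this]
    rw [e3, ← eval_map, this, eval_prod]
    refine Finset.prod_congr rfl fun g _ => ?_
    simp only [lf, coe_mapRingHom, map_C, map_X, eval_sub, eval_X, eval_C, add_mul, Finset.sum_add_distrib,
      map_sub, map_sum, map_mul]
    rw [Finset.mul_sum, ← sub_sub]
    congr 1
    exact Finset.sum_congr rfl fun x _ => by ring
  rw [e2, derivative_prod_finset]
  rw [eval_finsetSum, ← Finset.sum_neg_distrib]
  refine Finset.sum_congr rfl fun g _ => ?_
  rw [eval_mul, eval_prod, mul_comm (C _), ← mul_neg]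
  congr 1
  · refine Finset.prod_congr rfl fun h _ => ?_
    simp
  · simp

end BH

namespace BH

variable {k κ : Type} [Field k] [Field κ] [Algebra k κ]

/-- relative algebraic closure of the field generated by `s` -/
noncomputable def cl (k : Type) {κ : Type} [Field k] [Field κ] [Algebra k κ] (s : Set κ) :
    IntermediateField k κ where
  toSubalgebra := (Subalgebra.algebraicClosure (Algebra.adjoin k s) κ).restrictScalars k
  inv_mem' := by
    intro x hx
    exact IsAlgebraic.inv hx

theorem mem_cl_iff {s : Set κ} {x : κ} : x ∈ cl k s ↔ IsAlgebraic (Algebra.adjoin k s) x := Iff.rfl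

theorem cl_coe (s : Set κ) : (cl k s : Set κ) = (AlgebraicIndependent.matroid k κ).closure s := by
  rw [AlgebraicIndependent.matroid_closure_eq]; rfl

theorem subset_cl (s : Set κ) : s ⊆ cl k s := by
  rw [cl_coe]; exact Matroid.subset_closure _ _ (Set.subset_univ _)

theorem cl_le {s t : Set κ} (h : s ⊆ cl k t) : cl k s ≤ cl k t := by
  intro x hx
  have hx' : x ∈ (cl k s : Set κ) := hx
  change x ∈ (cl k t : Set κ)
  rw [cl_coe] at *
  exact Matroid.closure_subset_closure_of_subset_closure h hx'

theorem cl_mono {s t : Set κ} (h : s ⊆ t) : cl k s ≤ cl k t := cl_le (h.trans (subset_cl t))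

theorem mem_cl_of_root {s : Set κ} {P : κ[X]} (hP : P ≠ 0) (hc : ∀ i, P.coeff i ∈ cl k s) {x : κ}
    (hx : P.eval x = 0) : x ∈ cl k s := by
  have hP2 : P ∈ Polynomial.lifts (algebraMap (Algebra.adjoin k (cl k s : Set κ)) κ) := by
    rw [Polynomial.lifts_iff_coeff_lifts]
    intro i
    exact ⟨⟨_, Algebra.subset_adjoin (hc i)⟩, rfl⟩
  obtain ⟨Q, hQ⟩ := (Polynomial.mem_lifts _).1 hP2
  have halg : x ∈ cl k (cl k s : Set κ) := by
    refine ⟨Q, ?_, ?_⟩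
    · rintro rfl; simp at hQ; exact hP hQ.symm
    · rw [aeval_def, ← eval_map, hQ, hx]
  exact cl_le (le_refl _) halg

theorem indep_iff {ι : Type} (y : ι → κ) : AlgebraicIndependent k y ↔
    (AlgebraicIndependent.matroid k κ).Indep (Set.range y) ∧ Function.Injective y := by
  constructor
  · intro h
    refine ⟨?_, h.injective⟩
    rw [AlgebraicIndependent.matroid_indep_iff]
    exact (algebraicIndependent_subtype_range h.injective).2 h
  · rintro ⟨h1, h2⟩
    rw [AlgebraicIndependent.matroid_indep_iff] at h1
    exact (algebraicIndependent_subtype_range h2).1 h1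

theorem encard_range {ι κ : Type} [Fintype ι] {y : ι → κ} (hy : Function.Injective y) :
    (Set.range y).encard = Fintype.card ι := by
  rw [← Set.image_univ, hy.encard_image, Set.encard_univ, ENat.card_eq_coe_fintype_card]

theorem encard_range_le {ι κ : Type} [Fintype ι] (y : ι → κ) :
    (Set.range y).encard ≤ Fintype.card ι := by
  rw [← Set.image_univ]
  refine (Set.encard_image_le _ _).trans ?_
  rw [Set.encard_univ, ENat.card_eq_coe_fintype_card]

theorem td_rk {ι : Type} [Fintype ι] {y : ι → κ} (hy : AlgebraicIndependent k y) {t : Set κ}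
    (h : ∀ i, y i ∈ cl k t) : (Fintype.card ι : ℕ∞) ≤ (AlgebraicIndependent.matroid k κ).eRk t := by
  obtain ⟨h1, h2⟩ := (indep_iff y).1 hy
  rw [← Matroid.eRk_closure_eq, ← encard_range h2]
  refine h1.encard_le_eRk_of_subset ?_
  rw [← cl_coe]
  rintro _ ⟨i, rfl⟩
  exact h i

theorem td_le {ι ι' : Type} [Fintype ι] [Fintype ι'] {y : ι → κ} (hy : AlgebraicIndependent k y)
    {z : ι' → κ} (h : ∀ i, y i ∈ cl k (Set.range z)) : Fintype.card ι ≤ Fintype.card ι' := by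
  have := (td_rk hy h).trans ((Matroid.eRk_le_encard _ _).trans (encard_range_le z))
  exact_mod_cast this

theorem td_eq {ι ι' : Type} [Fintype ι] [Fintype ι'] {y : ι → κ} (hy : AlgebraicIndependent k y)
    {z : ι' → κ} (h : ∀ i, y i ∈ cl k (Set.range z)) (hc : Fintype.card ι' ≤ Fintype.card ι) :
    AlgebraicIndependent k z := by
  rw [indep_iff]
  have h1 := td_rk hy h
  have h2 : (Set.range z).encard = Fintype.card ι' := by
    refine le_antisymm (encard_range_le z) (le_trans ?_ ((h1.trans (Matroid.eRk_le_encard _ _))))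
    exact_mod_cast hc
  constructor
  · obtain ⟨I, hI⟩ := (AlgebraicIndependent.matroid k κ).exists_isBasis (Set.range z) (Set.subset_univ _)
    have h3 : I = Set.range z := by
      refine ((Set.finite_range z).subset hI.subset).eq_of_subset_of_encard_le hI.subset ?_
      rw [hI.encard_eq_eRk, h2]
      refine le_trans ?_ h1
      exact_mod_cast hc
    rw [← h3]; exact hI.indep
  · have h4 : (Set.univ : Set ι').InjOn z := by
      refine (Set.finite_univ).injOn_of_encard_image_eq ?_
      rw [Set.image_univ, h2, Set.encard_univ, ENat.card_eq_coe_fintype_card]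
    exact Set.injOn_univ.1 h4

theorem notMem_cl {ι : Type} {y : ι → κ} (hy : AlgebraicIndependent k y) (i : ι) :
    y i ∉ cl k (y '' {j | j ≠ i}) := by
  obtain ⟨h1, h2⟩ := (indep_iff y).1 hy
  have := h1.notMem_closure_sdiff_of_mem (Set.mem_range_self i)
  rw [← cl_coe] at this
  intro h
  apply this
  refine cl_mono ?_ h
  rintro _ ⟨j, hj, rfl⟩
  exact ⟨Set.mem_range_self j, fun h => hj (h2 h)⟩

theorem notMem_cl' {ι : Type} {y : ι → κ} (hy : AlgebraicIndependent k y) (i : ι) (s : Set κ)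
    (hs : ∀ x ∈ s, ∃ j, j ≠ i ∧ y j = x) : y i ∉ cl k s := fun h =>
  notMem_cl hy i (cl_mono (fun x hx => by obtain ⟨j, h1, h2⟩ := hs x hx; exact ⟨j, h1, h2⟩) h)

/-- exchange -/
theorem cl_exchange {s : Set κ} {x y : κ} (hx : x ∈ cl k (insert y s)) (hx' : x ∉ cl k s) :
    y ∈ cl k (insert x s) := by
  have h1 : x ∈ (cl k (insert y s) : Set κ) := hx
  have h2 : x ∉ (cl k s : Set κ) := hx'
  change y ∈ (cl k (insert x s) : Set κ)
  rw [cl_coe] at *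
  exact Matroid.mem_closure_insert h2 h1

end BH

namespace BH

variable {k κ : Type} [Field k] [Field κ] [Algebra k κ]

/-- bivariate evaluation -/
noncomputable def ee {k κ : Type} [Field k] [Field κ] [Algebra k κ] (t x : κ) : k[X][X] →+* κ :=
  eval₂RingHom (eval₂RingHom (algebraMap k κ) t) x

theorem ee_map {k E κ : Type} [Field k] [Field E] [Field κ] [Algebra k κ] [Algebra k E] [Algebra E κ]
    [IsScalarTower k E κ] (t x : κ) (F : k[X][X]) :
    ee t x (F.map (mapRingHom (algebraMap k E))) = ee t x F := by
  simp only [ee, coe_eval₂RingHom]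
  rw [eval₂_map]
  congr 1
  ext a
  · simp [← IsScalarTower.algebraMap_apply]
  · simp

section point
variable {E : Type} [Field E] [Algebra E κ]

theorem trans_inj {t : κ} (ht : Transcendental E t) :
    Function.Injective (eval₂RingHom (algebraMap E κ) t) := by
  rw [injective_iff_map_eq_zero]
  intro P hP
  by_contra h
  exact ht ⟨P, h, hP⟩

/-- the embedding of the rational function field -/
noncomputable def psi {t : κ} (ht : Transcendental E t) : FractionRing E[X] →+* κ :=
  IsFractionRing.lift (trans_inj ht)

theorem psi_apply {t : κ} (ht : Transcendental E t) (P : E[X]) :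
    psi ht (algebraMap _ _ P) = eval₂ (algebraMap E κ) t P := by
  unfold psi
  rw [IsFractionRing.lift_algebraMap]; rfl

theorem psi_comp {t : κ} (ht : Transcendental E t) :
    (psi ht).comp (algebraMap E[X] (FractionRing E[X])) = eval₂RingHom (algebraMap E κ) t :=
  RingHom.ext fun P => psi_apply ht P

theorem irr_frac [IsAlgClosed k] [Algebra k E] {F : k[X][X]} (hm : F.Monic) (hd : 0 < F.natDegree)
    (hirr : Irreducible F) :
    Irreducible ((F.map (mapRingHom (algebraMap k E))).map (algebraMap E[X] (FractionRing E[X]))) := by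
  rw [← Monic.irreducible_iff_irreducible_map_fraction_map (hm.map _)]
  exact irreducible_ext (algebraMap k E) F hm hd hirr

theorem point_dvd [IsAlgClosed k] [Algebra k E] {F : k[X][X]} (hm : F.Monic) (hd : 0 < F.natDegree)
    (hirr : Irreducible F) {t x : κ} (ht : Transcendental E t)
    (hx : ee t x (F.map (mapRingHom (algebraMap k E))) = 0) {G : E[X][X]} (hG : ee t x G = 0) :
    F.map (mapRingHom (algebraMap k E)) ∣ G := by
  have h1 := irr_frac (E := E) hm hd hirr
  have hM := hm.map (mapRingHom (algebraMap k E))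
  generalize F.map (mapRingHom (algebraMap k E)) = FE at *
  rw [hM.isPrimitive.dvd_iff_fraction_map_dvd_fraction_map (FractionRing E[X])]
  by_contra hnd
  have hcop := (h1.coprime_iff_not_dvd).2 hnd
  obtain ⟨a, b, hab⟩ := hcop
  have := congrArg (eval₂ (psi ht) x) hab
  rw [eval₂_add, eval₂_mul, eval₂_mul, eval₂_map, eval₂_map, psi_comp, eval₂_one] at this
  simp only [ee, coe_eval₂RingHom] at hx hG
  rw [hx, hG] at this
  simp at this

end point

theorem ext_equiv {L M1 M2 : Type} [Field L] [Field M1] [Field M2] [IsAlgClosed M1] [IsAlgClosed M2]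
    (f1 : L →+* M1) (f2 : L →+* M2) (h1 : ∀ y : M1, ∃ P : L[X], P ≠ 0 ∧ eval₂ f1 y P = 0)
    (h2 : ∀ y : M2, ∃ P : L[X], P ≠ 0 ∧ eval₂ f2 y P = 0) :
    ∃ γ : M1 ≃+* M2, ∀ x, γ (f1 x) = f2 x := by
  let := f1.toAlgebra
  let := f2.toAlgebra
  have a1 : Algebra.IsAlgebraic L M1 := ⟨fun y => h1 y⟩
  have a2 : Algebra.IsAlgebraic L M2 := ⟨fun y => h2 y⟩
  have b1 : IsAlgClosure L M1 := ⟨inferInstance, a1⟩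
  have b2 : IsAlgClosure L M2 := ⟨inferInstance, a2⟩
  exact ⟨(IsAlgClosure.equiv L M1 M2).toRingEquiv, fun x => (IsAlgClosure.equiv L M1 M2).commutes x⟩

/-- one-step automorphism -/
theorem one_step [IsAlgClosed k] [IsAlgClosed κ] {F : k[X][X]} (hm : F.Monic) (hd : 0 < F.natDegree)
    (hirr : Irreducible F) (E : IntermediateField k κ) {t x t' x' : κ}
    (ht : Transcendental E t) (ht' : Transcendental E t')
    (hx : ee t x F = 0) (hx' : ee t' x' F = 0)
    (hall : ∀ y, y ∈ cl k (insert t (E : Set κ))) (hall' : ∀ y, y ∈ cl k (insert t' (E : Set κ))) :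
    ∃ γ : κ ≃+* κ, (∀ e : E, γ e = e) ∧ γ t = t' ∧ γ x = x' := by
  have hI := irr_frac (E := E) hm hd hirr
  set FK := (F.map (mapRingHom (algebraMap k E))).map (algebraMap E[X] (FractionRing E[X])) with hFK
  have : Fact (Irreducible FK) := ⟨hI⟩
  have key : ∀ {t x : κ} (ht : Transcendental E t) (hx : ee t x F = 0)
      (hall : ∀ y, y ∈ cl k (insert t (E : Set κ))),
      ∃ f : AdjoinRoot FK →+* κ, (∀ e : E, f (AdjoinRoot.of FK (algebraMap E[X] _ (C e))) = e) ∧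
        f (AdjoinRoot.of FK (algebraMap E[X] _ X)) = t ∧ f (AdjoinRoot.root FK) = x ∧
        (∀ y : κ, ∃ P : (AdjoinRoot FK)[X], P ≠ 0 ∧ eval₂ f y P = 0) := by
    intro t x ht hx hall
    let f : AdjoinRoot FK →+* κ := AdjoinRoot.lift (psi ht) x (by
      rw [hFK, eval₂_map, psi_comp]
      have := ee_map (E := E) t x F
      rw [hx] at this
      exact this)
    have f1 : ∀ e : E, f (AdjoinRoot.of FK (algebraMap E[X] _ (C e))) = e := by
      intro e; simp only [f, AdjoinRoot.lift_of, psi_apply]; simp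
    have f2 : f (AdjoinRoot.of FK (algebraMap E[X] _ X)) = t := by
      simp only [f, AdjoinRoot.lift_of, psi_apply]; simp
    refine ⟨f, f1, f2, by simp [f], ?_⟩
    intro y
    have hsub : ∀ z ∈ Algebra.adjoin k (insert t (E : Set κ)), z ∈ f.range := by
      intro z hz
      induction hz using Algebra.adjoin_induction with
      | mem z hz =>
        rcases hz with rfl | hz
        · exact ⟨_, f2⟩
        · exact ⟨_, f1 ⟨z, hz⟩⟩
      | algebraMap r => exact ⟨_, f1 (algebraMap k E r)⟩
      | add x y _ _ h1 h2 => exact add_mem h1 h2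
      | mul x y _ _ h1 h2 => exact mul_mem h1 h2
    obtain ⟨Q, hQ0, hQ⟩ := mem_cl_iff.1 (hall y)
    have hQ1 : Q.map (algebraMap _ κ) ∈ Polynomial.lifts f := by
      rw [Polynomial.lifts_iff_coeff_lifts]
      intro i
      rw [coeff_map]
      exact hsub _ (Q.coeff i).2
    obtain ⟨P, hP⟩ := (Polynomial.mem_lifts _).1 hQ1
    refine ⟨P, ?_, ?_⟩
    · rintro rfl
      rw [Polynomial.map_zero] at hP
      exact hQ0 ((Polynomial.map_eq_zero_iff (FaithfulSMul.algebraMap_injective _ _)).1 hP.symm)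
    · rw [← eval_map, hP, eval_map, ← aeval_def, hQ]
  obtain ⟨f, f1, f2, f3, f4⟩ := key ht hx hall
  obtain ⟨f', f1', f2', f3', f4'⟩ := key ht' hx' hall'
  obtain ⟨γ, hγ⟩ := ext_equiv f f' f4 f4'
  refine ⟨γ, fun e => ?_, ?_, ?_⟩
  · rw [← f1 e, hγ, f1']
    exact (f1 e).symm
  · rw [← f2, hγ, f2']
  · rw [← f3, hγ, f3']

end BH

namespace BH

/-- substitution `F(T, f(T))` -/
noncomputable def Wp {k A : Type} [Field k] [CommRing A] (φ : k →+* A) (F : k[X][X]) (f : A[X]) : A[X] :=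
  eval₂ (mapRingHom φ) f F

/-- coefficientwise derivative -/
noncomputable def Ft {k : Type} [Field k] (F : k[X][X]) : k[X][X] :=
  ∑ j ∈ Finset.range (F.natDegree + 1), C (derivative (F.coeff j)) * X ^ j

theorem Ft_coeff {k : Type} [Field k] (F : k[X][X]) (j : ℕ) : (Ft F).coeff j = derivative (F.coeff j) := by
  unfold Ft
  rw [finsetSum_coeff]
  simp only [coeff_C_mul, coeff_X_pow, mul_ite, mul_one, mul_zero]
  rw [Finset.sum_ite_eq]
  split_ifs with h
  · rfl
  · have h' : F.natDegree < j := by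
      rw [Finset.mem_range] at h; omega
    rw [coeff_eq_zero_of_natDegree_lt h', derivative_zero]

section
variable {k A B : Type} [Field k] [CommRing A] [CommRing B] (φ : k →+* A)

theorem Wp_map (g : A →+* B) (F : k[X][X]) (f : A[X]) :
    (Wp φ F f).map g = Wp (g.comp φ) F (f.map g) := by
  unfold Wp
  rw [← coe_mapRingHom, hom_eval₂, mapRingHom_comp]

theorem Wp_eval (F : k[X][X]) (f : A[X]) (t : A) :
    (Wp φ F f).eval t = eval₂ (eval₂RingHom φ t) (f.eval t) F := by
  unfold Wp
  rw [← coe_evalRingHom, hom_eval₂]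
  congr 1
  ext <;> simp

theorem Wp_add (F G : k[X][X]) (f : A[X]) : Wp φ (F + G) f = Wp φ F f + Wp φ G f := eval₂_add _ _

theorem Wp_deriv (F : k[X][X]) (f : A[X]) :
    derivative (Wp φ F f) = Wp φ (Ft F) f + derivative f * Wp φ (derivative F) f := by
  induction F using Polynomial.induction_on' with
  | add p q hp hq =>
    have : Ft (p + q) = Ft p + Ft q := by
      ext j; simp [Ft_coeff]
    rw [this, Wp_add, derivative_add, Wp_add, derivative_add, Wp_add, hp, hq]; ring
  | monomial j a =>
    have : Ft (monomial j a) = monomial j (derivative a) := by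
      ext1 i; simp only [Ft_coeff, coeff_monomial]; split_ifs <;> simp
    rw [this]
    unfold Wp
    rw [derivative_monomial, eval₂_monomial, eval₂_monomial, eval₂_monomial]
    simp only [derivative_mul, derivative_pow, coe_mapRingHom, derivative_map, Polynomial.map_mul,
      Polynomial.map_natCast]
    simp only [map_natCast]
    ring

theorem Wp_taylor (F : k[X][X]) (f h : A[X]) : ∃ R : A[X],
    Wp φ F (f + h) = Wp φ F f + Wp φ (derivative F) f * h + R * h ^ 2 := by
  obtain ⟨R, hR⟩ := binomExpansion (F.map (mapRingHom φ)) f h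
  refine ⟨R, ?_⟩
  unfold Wp
  rw [← eval_map, ← eval_map, ← eval_map, hR, derivative_map]

variable {φ} {F : k[X][X]} {n : ℕ} {f : A[X]}

/-- leading form -/
noncomputable def Lam (n : ℕ) (F : k[X][X]) : k[X] :=
  ∑ j ∈ Finset.range (F.natDegree + 1), C ((F.coeff j).coeff ((F.natDegree - j) * n)) * X ^ j

theorem Wp_natDegree_le (hs : ∀ j ≤ F.natDegree, (F.coeff j).natDegree ≤ (F.natDegree - j) * n)
    (hf : f.natDegree ≤ n) : (Wp φ F f).natDegree ≤ F.natDegree * n := by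
  unfold Wp
  rw [eval₂_eq_sum_range]
  refine natDegree_sum_le_of_forall_le _ _ fun j hj => ?_
  have hj' : j ≤ F.natDegree := by simpa [Nat.lt_succ_iff] using hj
  refine natDegree_mul_le.trans ?_
  have h1 : (mapRingHom φ (F.coeff j)).natDegree ≤ (F.natDegree - j) * n :=
    (natDegree_map_le).trans (hs j hj')
  have h2 : (f ^ j).natDegree ≤ j * n := natDegree_pow_le_of_le _ hf
  have : (F.natDegree - j) * n + j * n = F.natDegree * n := by rw [← add_mul]; congr 1; omega
  omega

theorem Wp_coeff (hs : ∀ j ≤ F.natDegree, (F.coeff j).natDegree ≤ (F.natDegree - j) * n)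
    (hf : f.natDegree ≤ n) : (Wp φ F f).coeff (F.natDegree * n) = eval₂ φ (f.coeff n) (Lam n F) := by
  unfold Wp Lam
  rw [eval₂_eq_sum_range, finsetSum_coeff, eval₂_finsetSum]
  refine Finset.sum_congr rfl fun j hj => ?_
  have hj' : j ≤ F.natDegree := by simpa [Nat.lt_succ_iff] using hj
  have h1 : (mapRingHom φ (F.coeff j)).natDegree ≤ (F.natDegree - j) * n :=
    (natDegree_map_le).trans (hs j hj')
  have h2 : (f ^ j).natDegree ≤ j * n := natDegree_pow_le_of_le _ hf
  have : (F.natDegree - j) * n + j * n = F.natDegree * n := by rw [← add_mul]; congr 1; omega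
  rw [← this, coeff_mul_add_eq_of_natDegree_le h1 h2, eval₂_mul, eval₂_C, eval₂_pow, eval₂_X,
    coeff_pow_of_natDegree_le hf]
  simp

theorem Lam_monic (hm : F.Monic) : (Lam n F).Monic ∧ (Lam n F).natDegree = F.natDegree := by
  have h1 : (Lam n F).natDegree ≤ F.natDegree := by
    refine natDegree_sum_le_of_forall_le _ _ fun j hj => ?_
    have hj' : j ≤ F.natDegree := by simpa [Nat.lt_succ_iff] using hj
    exact (natDegree_C_mul_X_pow_le _ _).trans hj'
  have h2 : (Lam n F).coeff F.natDegree = 1 := by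
    unfold Lam
    rw [finsetSum_coeff]
    simp only [coeff_C_mul, coeff_X_pow, mul_ite, mul_one, mul_zero]
    rw [Finset.sum_ite_eq]
    simp [hm.coeff_natDegree]
  exact ⟨monic_of_natDegree_le_of_coeff_eq_one _ h1 h2,
    le_antisymm h1 (le_natDegree_of_ne_zero (by rw [h2]; exact one_ne_zero))⟩

end

/-- the polynomial with coefficients `a 0, …, a n` -/
noncomputable def fp {A : Type} [CommRing A] (n : ℕ) (a : ℕ → A) : A[X] :=
  ∑ l ∈ Finset.range (n + 1), C (a l) * X ^ l

section
variable {A B : Type} [CommRing A] [CommRing B] {n : ℕ} (a : ℕ → A)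

theorem fp_coeff (l : ℕ) : (fp n a).coeff l = if l ≤ n then a l else 0 := by
  unfold fp
  rw [finsetSum_coeff]
  simp only [coeff_C_mul, coeff_X_pow, mul_ite, mul_one, mul_zero]
  rw [Finset.sum_ite_eq]
  simp [Nat.lt_succ_iff]

theorem fp_natDegree_le : (fp n a).natDegree ≤ n := by
  refine natDegree_sum_le_of_forall_le _ _ fun j hj => ?_
  have hj' : j ≤ n := by simpa [Nat.lt_succ_iff] using hj
  exact (natDegree_C_mul_X_pow_le _ _).trans hj'

theorem fp_map (g : A →+* B) : (fp n a).map g = fp n (fun l => g (a l)) := by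
  ext l
  rw [coeff_map, fp_coeff, fp_coeff]
  split_ifs <;> simp

theorem fp_eval (t : A) : (fp n a).eval t = ∑ l ∈ Finset.range (n + 1), a l * t ^ l := by
  simp [fp, eval_finsetSum]

end

section
variable {k κ : Type} [Field k] [Field κ] [Algebra k κ]

theorem Wp_ee (F : k[X][X]) (f : κ[X]) (t : κ) :
    (Wp (algebraMap k κ) F f).eval t = ee t (f.eval t) F := Wp_eval _ _ _ _

/-- points lie in the closure -/
theorem ee_mem_cl {s : Set κ} {t x : κ} (F : k[X][X]) (ht : t ∈ cl k s) (hx : x ∈ cl k s) :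
    ee t x F ∈ cl k s := by
  have : ee t x F = algebraMap (cl k s) κ (ee (⟨t, ht⟩ : cl k s) (⟨x, hx⟩ : cl k s) F) := by
    simp only [ee, coe_eval₂RingHom]
    rw [hom_eval₂]
    congr 1
    ext <;> simp
  rw [this]
  exact (ee (⟨t, ht⟩ : cl k s) (⟨x, hx⟩ : cl k s) F).2

theorem eval_mem_cl {s : Set κ} {t : κ} (P : κ[X]) (ht : t ∈ cl k s) (hP : ∀ i, P.coeff i ∈ cl k s) :
    P.eval t ∈ cl k s := by
  rw [eval_eq_sum_range]
  exact sum_mem fun i _ => mul_mem (hP i) (pow_mem ht i)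

theorem root_mem_cl {s : Set κ} {t x : κ} {F : k[X][X]} (hm : F.Monic) (ht : t ∈ cl k s)
    (hx : ee t x F = 0) : x ∈ cl k s := by
  have h1 : (F.map (eval₂RingHom (algebraMap k κ) t)).Monic := hm.map _
  refine mem_cl_of_root h1.ne_zero (fun i => ?_) (x := x) ?_
  · rw [coeff_map, coe_eval₂RingHom, ← eval_map]
    refine eval_mem_cl _ ht fun j => ?_
    rw [coeff_map]
    exact (cl k s).algebraMap_mem _
  · rw [eval_map]; exact hx

/-- transcendence over a closure -/
theorem trans_cl {s : Set κ} {t : κ} (h : t ∉ cl k s) : Transcendental (cl k s) t := by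
  rintro ⟨P, hP, h0⟩
  apply h
  refine mem_cl_of_root (P := P.map (algebraMap _ κ)) ?_ (fun i => ?_) ?_
  · exact (Polynomial.map_ne_zero_iff (FaithfulSMul.algebraMap_injective _ _)).2 hP
  · rw [coeff_map]; exact (P.coeff i).2
  · rw [eval_map]; exact h0

theorem trans_k {t : κ} (h : t ∉ cl k (∅ : Set κ)) : Transcendental k t := by
  rintro ⟨P, hP, h0⟩
  apply h
  refine mem_cl_of_root (P := P.map (algebraMap _ κ)) ?_ (fun i => ?_) ?_
  · exact (Polynomial.map_ne_zero_iff (FaithfulSMul.algebraMap_injective _ _)).2 hP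
  · rw [coeff_map]; exact (cl k _).algebraMap_mem _
  · rw [eval_map]; exact h0

/-- a lower-degree polynomial does not vanish at a generic point -/
theorem Fx_ne [IsAlgClosed k] {F : k[X][X]} (hm : F.Monic) (hd : 0 < F.natDegree)
    (hirr : Irreducible F) {G : k[X][X]} (hG : G ≠ 0) (hGd : G.natDegree < F.natDegree)
    {t x : κ} (ht : t ∉ cl k (∅ : Set κ)) (hx : ee t x F = 0) :
    ee t x G ≠ 0 := by
  intro h
  have := point_dvd (E := k) hm hd hirr (trans_k ht) (by simpa using hx) h
  rw [Algebra.algebraMap_self, mapRingHom_id, Polynomial.map_id] at this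
  exact absurd (eq_zero_of_dvd_of_natDegree_lt this hGd) hG

theorem deriv_natDegree_lt {F : k[X][X]} (hd : 0 < F.natDegree) :
    (derivative F).natDegree < F.natDegree := natDegree_derivative_lt hd.ne'

theorem eq_of_point [IsAlgClosed k] {F G : k[X][X]} (hm : F.Monic) (hd : 0 < F.natDegree)
    (hirr : Irreducible F) (hm' : G.Monic)
    (hirr' : Irreducible G) {t x : κ} (ht : t ∉ cl k (∅ : Set κ)) (hx : ee t x F = 0)
    (hx' : ee t x G = 0) : F = G := by
  have := point_dvd (E := k) hm hd hirr (trans_k ht) (by simpa using hx) hx'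
  rw [Algebra.algebraMap_self, mapRingHom_id, Polynomial.map_id] at this
  exact eq_of_monic_of_associated hm hm' (hirr.associated_of_dvd hirr' this)

end
end BH

namespace BH

variable {k κ : Type} [Field k] [Field κ] [Algebra k κ]

theorem fp_split {n : ℕ} (hn : 3 ≤ n) (a : ℕ → κ) : fp n a = C (a 0) + C (a 1) * X + C (a 2) * X ^ 2
    + C (a 3) * X ^ 3 + fp n (fun l => if l < 4 then 0 else a l) := by
  ext j
  simp only [coeff_add, coeff_C_mul, coeff_X_pow, coeff_X, coeff_C, fp_coeff]
  rcases (by omega : j = 0 ∨ j = 1 ∨ j = 2 ∨ j = 3 ∨ 4 ≤ j) with rfl | rfl | rfl | rfl | h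
  · simp
  · simp; omega
  · simp; omega
  · simp; omega
  · have : ¬ (j < 4) := by omega
    rw [if_neg (by omega : ¬ j = 0), if_neg (by omega : ¬ 1 = j), if_neg (by omega : ¬ j = 2),
      if_neg (by omega : ¬ j = 3), if_neg this]
    ring

theorem deriv_mem_cl {s : Set κ} {P : κ[X]} (hP : ∀ i, P.coeff i ∈ cl k s) (i : ℕ) :
    (derivative P).coeff i ∈ cl k s := by
  rw [coeff_derivative]
  exact mul_mem (hP _) (add_mem (natCast_mem _ _) (one_mem _))

theorem herm {n : ℕ} (hn : 3 ≤ n) {a : ℕ → κ} {s : Set κ} (ha : ∀ l, 4 ≤ l → l ≤ n → a l ∈ cl k s)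
    {t0 t1 : κ} (h01 : t0 ≠ t1) (ht0 : t0 ∈ cl k s) (ht1 : t1 ∈ cl k s)
    (h1 : (fp n a).eval t0 ∈ cl k s) (h2 : (derivative (fp n a)).eval t0 ∈ cl k s)
    (h3 : (fp n a).eval t1 ∈ cl k s) (h4 : (derivative (fp n a)).eval t1 ∈ cl k s) :
    a 2 ∈ cl k s ∧ a 3 ∈ cl k s := by
  have hh : ∀ i, (fp n (fun l => if l < 4 then 0 else a l)).coeff i ∈ cl k s := by
    intro i
    rw [fp_coeff]
    split_ifs with h h'
    · exact zero_mem _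
    · exact ha i (by omega) h
    · exact zero_mem _
  have e1 := eval_mem_cl _ ht0 hh
  have e2 := eval_mem_cl _ ht0 (deriv_mem_cl hh)
  have e3 := eval_mem_cl _ ht1 hh
  have e4 := eval_mem_cl _ ht1 (deriv_mem_cl hh)
  rw [fp_split hn a] at h1 h2 h3 h4
  generalize fp n (fun l => if l < 4 then 0 else a l) = h at *
  simp only [eval_add, eval_mul, eval_C, eval_X, eval_pow, derivative_add, derivative_mul, derivative_C,
    derivative_X_pow, derivative_X, map_natCast, eval_natCast, eval_zero, eval_one] at h1 h2 h3 h4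
  have g1 := sub_mem h1 e1
  have g2 := sub_mem h2 e2
  have g3 := sub_mem h3 e3
  have g4 := sub_mem h4 e4
  have hs : t1 - t0 ≠ 0 := sub_ne_zero.2 h01.symm
  have hsm : t1 - t0 ∈ cl k s := sub_mem ht1 ht0
  have h2m : (2 : κ) ∈ cl k s := by exact_mod_cast natCast_mem (cl k s) 2
  have a3 : a 3 ∈ cl k s := by
    have := mul_mem (sub_mem (mul_mem (add_mem g2 g4) hsm) (mul_mem h2m (sub_mem g3 g1)))
      (inv_mem (pow_mem hsm 3))
    convert this using 1
    rw [eq_mul_inv_iff_mul_eq₀ (pow_ne_zero 3 hs)]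
    push_cast
    ring
  refine ⟨?_, a3⟩
  have := mul_mem (sub_mem (sub_mem (sub_mem g3 g1) (mul_mem g2 hsm))
      (mul_mem (mul_mem a3 (pow_mem hsm 2)) (add_mem ht1 (mul_mem h2m ht0))))
      (inv_mem (pow_mem hsm 2))
  convert this using 1
  rw [eq_mul_inv_iff_mul_eq₀ (pow_ne_zero 2 hs)]
  push_cast
  ring

theorem fp_split2 {n : ℕ} (hn : 3 ≤ n) (a : ℕ → κ) : fp n a = C (a 0) + C (a 1) * X + C (a 2) * X ^ 2
    + fp n (fun l => if l < 3 then 0 else a l) := by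
  ext j
  simp only [coeff_add, coeff_C_mul, coeff_X_pow, coeff_X, coeff_C, fp_coeff]
  rcases (by omega : j = 0 ∨ j = 1 ∨ j = 2 ∨ 3 ≤ j) with rfl | rfl | rfl | h
  · simp
  · simp; omega
  · simp; omega
  · have : ¬ (j < 3) := by omega
    rw [if_neg (by omega : ¬ j = 0), if_neg (by omega : ¬ 1 = j), if_neg (by omega : ¬ j = 2), if_neg this]
    ring

theorem herm3 {n : ℕ} (hn : 3 ≤ n) {a : ℕ → κ} {s : Set κ} (ha : ∀ l, 3 ≤ l → l ≤ n → a l ∈ cl k s)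
    {t0 t1 : κ} (h01 : t0 ≠ t1) (ht0 : t0 ∈ cl k s) (ht1 : t1 ∈ cl k s)
    (h1 : (fp n a).eval t0 ∈ cl k s) (h2 : (derivative (fp n a)).eval t0 ∈ cl k s)
    (h3 : (fp n a).eval t1 ∈ cl k s) : a 2 ∈ cl k s := by
  have hh : ∀ i, (fp n (fun l => if l < 3 then 0 else a l)).coeff i ∈ cl k s := by
    intro i
    rw [fp_coeff]
    split_ifs with h h'
    · exact zero_mem _
    · exact ha i (by omega) h
    · exact zero_mem _
  have e1 := eval_mem_cl _ ht0 hh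
  have e2 := eval_mem_cl _ ht0 (deriv_mem_cl hh)
  have e3 := eval_mem_cl _ ht1 hh
  rw [fp_split2 hn a] at h1 h2 h3
  generalize fp n (fun l => if l < 3 then 0 else a l) = h at *
  simp only [eval_add, eval_mul, eval_C, eval_X, eval_pow, derivative_add, derivative_mul, derivative_C,
    derivative_X_pow, derivative_X, map_natCast, eval_natCast, eval_zero, eval_one] at h1 h2 h3
  have g1 := sub_mem h1 e1
  have g2 := sub_mem h2 e2
  have g3 := sub_mem h3 e3
  have hs : t1 - t0 ≠ 0 := sub_ne_zero.2 h01.symm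
  have hsm : t1 - t0 ∈ cl k s := sub_mem ht1 ht0
  have := mul_mem (sub_mem (sub_mem g3 g1) (mul_mem g2 hsm)) (inv_mem (pow_mem hsm 2))
  convert this using 1
  rw [eq_mul_inv_iff_mul_eq₀ (pow_ne_zero 2 hs)]
  push_cast
  ring

section indep
variable {n : ℕ} {t0 : κ} {a : ℕ → κ}

/-- the family `t0, a 2, …, a n` -/
def yy (n : ℕ) (t0 : κ) (a : ℕ → κ) (l : Fin n) : κ := if (l : ℕ) = 0 then t0 else a (l + 1)

theorem ind_t0 (hn : 3 ≤ n) (hy : AlgebraicIndependent k (yy n t0 a)) : t0 ∉ cl k (a '' Set.Icc 2 n) := by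
  refine notMem_cl' hy (⟨0, by omega⟩ : Fin n) _ ?_
  rintro _ ⟨l, hl, rfl⟩
  have := hl.1; have := hl.2
  refine ⟨⟨l - 1, by omega⟩, by simp; omega, ?_⟩
  unfold yy
  rw [if_neg (by simp; omega)]
  congr 1
  simp; omega

theorem ind_a (hy : AlgebraicIndependent k (yy n t0 a)) {j : ℕ} (hj : 2 ≤ j) (hjn : j ≤ n) :
    a j ∉ cl k (insert t0 (a '' {l | 2 ≤ l ∧ l ≤ n ∧ l ≠ j})) := by
  have := notMem_cl' hy (⟨j - 1, by omega⟩ : Fin n) (insert t0 (a '' {l | 2 ≤ l ∧ l ≤ n ∧ l ≠ j})) ?_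
  · unfold yy at this
    rw [if_neg (by simp; omega)] at this
    have h : ((⟨j - 1, by omega⟩ : Fin n) : ℕ) + 1 = j := by simp; omega
    rwa [h] at this
  · rintro x (rfl | ⟨l, hl, rfl⟩)
    · exact ⟨⟨0, by omega⟩, by simp; omega, by simp [yy]⟩
    · obtain ⟨h1, h2, h3⟩ := hl
      refine ⟨⟨l - 1, by omega⟩, by simp; omega, ?_⟩
      unfold yy
      rw [if_neg (by simp; omega)]
      congr 1
      simp; omega

theorem ind_23 (hn : 3 ≤ n) (hy : AlgebraicIndependent k (yy n t0 a)) (t1 : κ)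
    (h2 : a 2 ∈ cl k (insert t0 (insert t1 (a '' Set.Icc 4 n))))
    (h3 : a 3 ∈ cl k (insert t0 (insert t1 (a '' Set.Icc 4 n)))) : False := by
  have hle : cl k (insert t0 (insert t1 (a '' Set.Icc 4 n))) ≤ cl k (Set.range
      (fun l : Fin (n - 1) => if (l : ℕ) = 0 then t0 else if (l : ℕ) = 1 then t1 else a (l + 2))) := by
    apply cl_mono
    rintro x (rfl | rfl | ⟨l, hl, rfl⟩)
    · exact ⟨⟨0, by omega⟩, by simp⟩
    · exact ⟨⟨1, by omega⟩, by simp⟩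
    · have := hl.1; have := hl.2
      refine ⟨⟨l - 2, by omega⟩, ?_⟩
      simp only
      rw [if_neg (by omega), if_neg (by omega)]
      congr 1; omega
  have hsub := subset_cl (k := k) (insert t0 (insert t1 (a '' Set.Icc 4 n)))
  have := td_le hy (fun l => hle (by
    obtain ⟨l, hl⟩ := l
    unfold yy
    simp only
    split_ifs with h
    · exact hsub (by simp)
    · rcases (by omega : l = 1 ∨ l = 2 ∨ 3 ≤ l) with rfl | rfl | h
      · exact h2
      · exact h3
      · exact hsub (Or.inr (Or.inr ⟨l + 1, ⟨by omega, by omega⟩, rfl⟩))))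
  simp at this
  omega

end indep
end BH

namespace BH

variable {k κ : Type} [Field k] [Field κ] [Algebra k κ]

theorem slope_mem [IsAlgClosed k] {F : k[X][X]} (hm : F.Monic) (hd : 0 < F.natDegree)
    (hirr : Irreducible F) (hsep : derivative F ≠ 0) {s : Set κ} {t x p : κ} (ht : t ∈ cl k s)
    (htk : t ∉ cl k (∅ : Set κ)) (hx : ee t x F = 0)
    (hp : ee t x (Ft F) + p * ee t x (derivative F) = 0) : x ∈ cl k s ∧ p ∈ cl k s := by
  have hxm := root_mem_cl hm ht hx
  refine ⟨hxm, ?_⟩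
  have h0 := Fx_ne hm hd hirr hsep (deriv_natDegree_lt hd) htk hx
  have : p = - ee t x (Ft F) * (ee t x (derivative F))⁻¹ := by
    rw [eq_mul_inv_iff_mul_eq₀ h0]; linear_combination hp
  rw [this]
  exact mul_mem (neg_mem (ee_mem_cl _ ht hxm)) (inv_mem (ee_mem_cl _ ht hxm))

theorem deriv_eval {F : k[X][X]} {f : κ[X]} {t : κ} (h : (derivative (Wp (algebraMap k κ) F f)).eval t = 0) :
    ee t (f.eval t) (Ft F) + (derivative f).eval t * ee t (f.eval t) (derivative F) = 0 := by
  rw [Wp_deriv, eval_add, eval_mul, Wp_ee, Wp_ee] at h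
  exact h

section
variable {n : ℕ} {t0 : κ} {a : ℕ → κ}

/-- all other roots are simple -/
theorem other_simple [IsAlgClosed k] (hn : 3 ≤ n) (hy : AlgebraicIndependent k (yy n t0 a))
    {F : k[X][X]} (hm : F.Monic) (hd : 0 < F.natDegree)
    (hirr : Irreducible F) (hsep : derivative F ≠ 0)
    (h0 : (Wp (algebraMap k κ) F (fp n a)).eval t0 = 0)
    (h1 : (derivative (Wp (algebraMap k κ) F (fp n a))).eval t0 = 0)
    {G : k[X][X]} (hGm : G.Monic) (hGd : 0 < G.natDegree)
    (hGirr : Irreducible G) (hGsep : derivative G ≠ 0) {t1 : κ}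
    (h0' : (Wp (algebraMap k κ) G (fp n a)).eval t1 = 0)
    (h1' : (derivative (Wp (algebraMap k κ) G (fp n a))).eval t1 = 0) : t1 = t0 ∧ F = G := by
  have ht0 : t0 ∉ cl k (∅ : Set κ) := fun h => ind_t0 hn hy (cl_mono (Set.empty_subset _) h)
  have g1 := deriv_eval h1
  have g1' := deriv_eval h1'
  rw [Wp_ee] at h0 h0'
  by_cases h : t0 = t1
  · subst h
    exact ⟨rfl, eq_of_point hm hd hirr hGm hGirr ht0 h0 h0'⟩
  exfalso
  by_cases ht1 : t1 ∈ cl k {t0}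
  · set s := insert t0 (a '' {l | 2 ≤ l ∧ l ≤ n ∧ l ≠ 2}) with hs
    have hts : t0 ∈ cl k s := subset_cl _ (by simp [hs])
    have ht1s : t1 ∈ cl k s := cl_mono (by simp [hs]) ht1
    obtain ⟨e1, e2⟩ := slope_mem hm hd hirr hsep hts ht0 h0 g1
    have e3 := root_mem_cl hGm ht1s h0'
    exact ind_a hy (le_refl 2) (by omega) (herm3 hn (fun l hl hl' => subset_cl _ (by
      right; exact ⟨l, ⟨by omega, hl', by omega⟩, rfl⟩)) h hts ht1s e1 e2 e3)
  · have ht1k : t1 ∉ cl k (∅ : Set κ) := fun h => ht1 (cl_mono (Set.empty_subset _) h)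
    set s := insert t0 (insert t1 (a '' Set.Icc 4 n)) with hs
    have hts : t0 ∈ cl k s := subset_cl _ (by simp [hs])
    have ht1s : t1 ∈ cl k s := subset_cl _ (by simp [hs])
    obtain ⟨e1, e2⟩ := slope_mem hm hd hirr hsep hts ht0 h0 g1
    obtain ⟨e3, e4⟩ := slope_mem hGm hGd hGirr hGsep ht1s ht1k h0' g1'
    obtain ⟨q1, q2⟩ := herm hn (fun l hl hl' => subset_cl _ (by
      right; right; exact ⟨l, ⟨by omega, hl'⟩, rfl⟩)) h hts ht1s e1 e2 e3 e4
    exact ind_23 hn hy t1 q1 q2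

/-- independence of `a 1, …, a n` -/
theorem indep_a [IsAlgClosed k] (hn : 3 ≤ n) (hy : AlgebraicIndependent k (yy n t0 a))
    {F : k[X][X]} (hm : F.Monic) (hd : 0 < F.natDegree)
    (hirr : Irreducible F) (hsep : derivative F ≠ 0)
    (h0 : (Wp (algebraMap k κ) F (fp n a)).eval t0 = 0)
    (h1 : (derivative (Wp (algebraMap k κ) F (fp n a))).eval t0 = 0) :
    AlgebraicIndependent k (fun l : Fin n => a (l + 1)) := by
  have ht0 : t0 ∉ cl k (∅ : Set κ) := fun h => ind_t0 hn hy (cl_mono (Set.empty_subset _) h)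
  have g1 := deriv_eval h1
  rw [Wp_ee] at h0
  have hr : Set.range (fun l : Fin n => a (l + 1)) = insert (a 1) (a '' Set.Icc 2 n) := by
    ext x
    constructor
    · rintro ⟨⟨l, hl⟩, rfl⟩
      rcases Nat.eq_zero_or_pos l with rfl | h
      · left; rfl
      · right; exact ⟨l + 1, ⟨by omega, by omega⟩, rfl⟩
    · rintro (rfl | ⟨l, ⟨hl, hl'⟩, rfl⟩)
      · exact ⟨⟨0, by omega⟩, rfl⟩
      · refine ⟨⟨l - 1, by omega⟩, ?_⟩
        simp only; congr 1; omega
  have key : t0 ∈ cl k (Set.range (fun l : Fin n => a (l + 1))) := by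
    rw [hr]
    set s := a '' Set.Icc 2 n with hs
    have hsub : ∀ l, 2 ≤ l → l ≤ n → a l ∈ cl k s := fun l h h' => subset_cl _ ⟨l, ⟨h, h'⟩, rfl⟩
    by_cases h : a 1 ∈ cl k s
    · exfalso
      -- f' has coefficients in E
      have hpm : ∀ i, (derivative (fp n a)).coeff i ∈ cl k s := by
        intro i
        rw [coeff_derivative, fp_coeff]
        refine mul_mem ?_ (add_mem (natCast_mem _ _) (one_mem _))
        split_ifs with hi
        · rcases Nat.eq_zero_or_pos i with rfl | hi'
          · exact h
          · exact hsub _ (by omega) hi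
        · exact zero_mem _
      obtain ⟨p, hp⟩ := (Polynomial.mem_lifts (f := algebraMap (cl k s) κ) _).1
        ((Polynomial.lifts_iff_coeff_lifts _).2 (fun i => ⟨⟨_, hpm i⟩, rfl⟩) :
          derivative (fp n a) ∈ Polynomial.lifts (algebraMap (cl k s) κ))
      have hp' : (derivative (fp n a)).eval t0 = eval₂ (algebraMap (cl k s) κ) t0 p := by
        rw [← hp, eval_map]
      set G : (cl k s)[X][X] := (Ft F).map (mapRingHom (algebraMap k (cl k s))) +
        C p * (derivative F).map (mapRingHom (algebraMap k (cl k s))) with hG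
      have hG0 : ee t0 ((fp n a).eval t0) G = 0 := by
        rw [hG, map_add, map_mul, ee_map, ee_map, ← g1, hp']
        congr 2
        simp [ee]
      have hdvd := point_dvd hm hd hirr (trans_cl (ind_t0 hn hy)) (by rw [ee_map]; exact h0) hG0
      have hGdeg : G.natDegree < (F.map (mapRingHom (algebraMap k (cl k s)))).natDegree := by
        rw [hm.natDegree_map, ← Nat.le_sub_one_iff_lt hd]
        refine natDegree_add_le_of_degree_le (natDegree_map_le.trans ?_) ((natDegree_C_mul_le _ _).trans
          (natDegree_map_le.trans (Nat.le_sub_one_of_lt (deriv_natDegree_lt hd))))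
        rw [natDegree_le_iff_coeff_eq_zero]
        intro N hN
        rw [Ft_coeff]
        rcases (by omega : N = F.natDegree ∨ F.natDegree < N) with rfl | h
        · rw [hm.coeff_natDegree, derivative_one]
        · rw [coeff_eq_zero_of_natDegree_lt h, derivative_zero]
      have hGz := eq_zero_of_dvd_of_natDegree_lt hdvd hGdeg
      obtain ⟨j, hj⟩ : ∃ j, (derivative F).coeff j ≠ 0 := by
        by_contra hcon
        push Not at hcon
        exact hsep (Polynomial.ext (by simpa using hcon))
      have hc := congrArg (fun P => P.coeff j) hGz
      simp only [hG, coeff_add, coeff_C_mul, coeff_map, coeff_zero, coe_mapRingHom] at hc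
      have hdv : ((derivative F).coeff j).map (algebraMap k (cl k s)) ∣
          ((Ft F).coeff j).map (algebraMap k (cl k s)) := ⟨-p, by linear_combination hc⟩
      rw [Polynomial.map_dvd_map'] at hdv
      obtain ⟨q, hq⟩ := hdv
      have hpq : p = (-q).map (algebraMap k (cl k s)) := by
        rw [hq, Polynomial.map_mul] at hc
        have hne := (Polynomial.map_ne_zero_iff (FaithfulSMul.algebraMap_injective k (cl k s))).2 hj
        apply mul_left_cancel₀ hne
        rw [Polynomial.map_neg]
        linear_combination hc
      have hcoef : ∀ i, (derivative (fp n a)).coeff i ∈ cl k (∅ : Set κ) := by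
        intro i
        rw [← hp, hpq, Polynomial.map_map, coeff_map]
        exact (cl k (∅ : Set κ)).algebraMap_mem _
      have c1 := hcoef 1
      have c2 := hcoef 2
      rw [coeff_derivative, fp_coeff, if_pos (by omega)] at c1 c2
      have n2 := ind_a hy (le_refl 2) (by omega)
      have n3 := ind_a hy (by omega : 2 ≤ 3) (by omega)
      have hlow : ∀ {s : Set κ} {x}, x ∈ cl k (∅ : Set κ) → x ∈ cl k s :=
        fun h => cl_mono (Set.empty_subset _) h
      norm_num at c1 c2
      by_cases hch : (2 : κ) = 0
      · apply n3
        apply hlow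
        have h3 : (3 : κ) = 1 := by linear_combination hch
        rwa [h3, mul_one] at c2
      · apply n2
        apply hlow
        have h2m : (2 : κ) ∈ cl k (∅ : Set κ) := by exact_mod_cast natCast_mem (cl k (∅ : Set κ)) 2
        have := mul_mem c1 (inv_mem h2m)
        rwa [mul_assoc, mul_inv_cancel₀ hch, mul_one] at this
    · refine cl_exchange ?_ h
      have hts : t0 ∈ cl k (insert t0 s) := subset_cl _ (by simp)
      have e2 := (slope_mem hm hd hirr hsep hts ht0 h0 g1).2
      -- f'(t0) = a 1 + rest
      have : derivative (fp n a) = C (a 1) + derivative (fp n (fun l => if l < 2 then 0 else a l)) := by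
        ext i
        rw [coeff_add, coeff_derivative, coeff_derivative, fp_coeff, fp_coeff, coeff_C]
        rcases Nat.eq_zero_or_pos i with rfl | hi'
        · rw [if_pos (by omega)]; simp
        · rw [if_neg (by omega : ¬ i = 0), if_neg (by omega : ¬ i + 1 < 2)]; ring
      rw [this, eval_add, eval_C] at e2
      have e3 : (derivative (fp n (fun l => if l < 2 then 0 else a l))).eval t0 ∈ cl k (insert t0 s) := by
        refine eval_mem_cl _ hts (deriv_mem_cl fun i => ?_)
        rw [fp_coeff]
        split_ifs with h h'
        · exact zero_mem _
        · exact cl_mono (Set.subset_insert _ _) (hsub i (by omega) h)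
        · exact zero_mem _
      have := sub_mem e2 e3
      rwa [add_sub_cancel_right] at this
  refine td_eq hy (fun l => ?_) (le_refl _)
  obtain ⟨l, hl⟩ := l
  unfold yy
  simp only
  split_ifs with h
  · exact key
  · exact subset_cl _ ⟨⟨l, hl⟩, rfl⟩

/-- exact double root -/
theorem not_triple [IsAlgClosed k] (hn : 3 ≤ n) (hy : AlgebraicIndependent k (yy n t0 a))
    {F : k[X][X]} (hm : F.Monic) (hd : 0 < F.natDegree)
    (hirr : Irreducible F) (hsep : derivative F ≠ 0)
    (h0 : (Wp (algebraMap k κ) F (fp n a)).eval t0 = 0)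
    (h1 : (derivative (Wp (algebraMap k κ) F (fp n a))).eval t0 = 0) :
    ¬ (X - C t0) ^ 3 ∣ Wp (algebraMap k κ) F (fp n a) := by
  have ht0 : t0 ∉ cl k (∅ : Set κ) := fun h => ind_t0 hn hy (cl_mono (Set.empty_subset _) h)
  have g1 := deriv_eval h1
  rw [Wp_ee] at h0
  intro hdvd
  set s := insert t0 (a '' {l | 2 ≤ l ∧ l ≤ n ∧ l ≠ 2}) with hs
  have hts : t0 ∈ cl k s := subset_cl _ (by simp [hs])
  obtain ⟨e1, e2⟩ := slope_mem hm hd hirr hsep hts ht0 h0 g1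
  apply ind_a hy (le_refl 2) (by omega)
  rw [← hs]
  set fE := fp n a - C (a 2) * (X - C t0) ^ 2 with hfE
  have hf0 : fE.eval t0 = (fp n a).eval t0 := by simp [hfE]
  -- coefficients in E
  have hh : ∀ i, (fp n (fun l => if l < 3 then 0 else a l)).coeff i ∈ cl k s := by
    intro i
    rw [fp_coeff]
    split_ifs with h h'
    · exact zero_mem _
    · exact subset_cl _ (by right; exact ⟨i, ⟨by omega, h, by omega⟩, rfl⟩)
    · exact zero_mem _
  have q1 := eval_mem_cl _ hts hh
  have q2 := eval_mem_cl _ hts (deriv_mem_cl hh)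
  have hfE2 : fE = C (a 0 - a 2 * t0 ^ 2) + C (a 1 + 2 * a 2 * t0) * X
      + fp n (fun l => if l < 3 then 0 else a l) := by
    rw [hfE, fp_split2 hn a]
    simp only [C_add, C_mul, C_sub, C_pow]
    have : (C (2 : κ) : κ[X]) = 2 := rfl
    rw [this]
    ring
  rw [fp_split2 hn a] at e1 e2
  have hcE : ∀ i, fE.coeff i ∈ cl k s := by
    have b1 : a 1 + 2 * a 2 * t0 ∈ cl k s := by
      convert sub_mem e2 q2 using 1
      simp
      ring
    have b0 : a 0 - a 2 * t0 ^ 2 ∈ cl k s := by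
      convert sub_mem (sub_mem e1 q1) (mul_mem b1 hts) using 1
      simp
      ring
    intro i
    rw [hfE2, coeff_add, coeff_add, coeff_C, coeff_C_mul, coeff_X]
    refine add_mem (add_mem ?_ (mul_mem b1 ?_)) (hh i)
    · split_ifs; exacts [b0, zero_mem _]
    · split_ifs; exacts [one_mem _, zero_mem _]
  obtain ⟨g, hg⟩ := (Polynomial.mem_lifts (f := algebraMap (cl k s) κ) _).1
    ((Polynomial.lifts_iff_coeff_lifts _).2 (fun i => ⟨⟨_, hcE i⟩, rfl⟩) :
      fE ∈ Polynomial.lifts (algebraMap (cl k s) κ))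
  have hWg : (Wp (algebraMap k (cl k s)) F g).map (algebraMap (cl k s) κ) = Wp (algebraMap k κ) F fE := by
    rw [Wp_map, hg, ← IsScalarTower.algebraMap_eq]
  obtain ⟨R, hR⟩ := Wp_taylor (algebraMap k κ) F fE (C (a 2) * (X - C t0) ^ 2)
  have hff : fE + C (a 2) * (X - C t0) ^ 2 = fp n a := by rw [hfE]; ring
  rw [hff] at hR
  have hd2 : (X - C t0) ^ 2 ∣ Wp (algebraMap k κ) F fE := by
    have h2 : (X - C t0) ^ 2 ∣ Wp (algebraMap k κ) F (fp n a) := (pow_dvd_pow _ (by norm_num)).trans hdvd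
    obtain ⟨Z, hZ⟩ := h2
    refine ⟨Z - Wp (algebraMap k κ) (derivative F) fE * C (a 2) -
      R * C (a 2) ^ 2 * (X - C t0) ^ 2, ?_⟩
    linear_combination hZ - hR
  have hmapX : (X - C t0) ^ 2 = ((X - C (⟨t0, hts⟩ : cl k s)) ^ 2).map (algebraMap (cl k s) κ) := by
    simp only [Polynomial.map_pow, Polynomial.map_sub, map_X, map_C]
    rfl
  rw [hmapX, ← hWg, Polynomial.map_dvd_map'] at hd2
  obtain ⟨Q, hQ⟩ := hd2
  have hQ' := congrArg (Polynomial.map (algebraMap (cl k s) κ)) hQ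
  rw [hWg, Polynomial.map_mul, ← hmapX] at hQ'
  obtain ⟨Z, hZ⟩ := hdvd
  have hne : (X - C t0) ^ 2 ≠ 0 := pow_ne_zero _ (X_sub_C_ne_zero _)
  have hfin : (X - C t0) * Z = Q.map (algebraMap (cl k s) κ) +
      Wp (algebraMap k κ) (derivative F) fE * C (a 2) + R * C (a 2) ^ 2 * (X - C t0) ^ 2 := by
    apply mul_left_cancel₀ hne
    linear_combination hR - hZ + hQ'
  have hev := congrArg (eval t0) hfin
  simp only [eval_mul, eval_add, eval_sub, eval_X, eval_C, eval_pow, sub_self, zero_mul] at hev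
  rw [Wp_ee, hf0] at hev
  have hFx := Fx_ne hm hd hirr hsep (deriv_natDegree_lt hd) ht0 h0
  have hFm : ee t0 ((fp n a).eval t0) (derivative F) ∈ cl k s := by
    rw [← fp_split2 hn a] at e1
    exact ee_mem_cl _ hts e1
  have hQm : (Q.map (algebraMap (cl k s) κ)).eval t0 ∈ cl k s :=
    eval_mem_cl _ hts fun i => by rw [coeff_map]; exact (Q.coeff i).2
  have : a 2 = - (Q.map (algebraMap (cl k s) κ)).eval t0 * (ee t0 ((fp n a).eval t0) (derivative F))⁻¹ := by
    rw [eq_mul_inv_iff_mul_eq₀ hFx]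
    linear_combination -hev
  rw [this]
  exact mul_mem (neg_mem hQm) (inv_mem hFm)

end

/-- generic separability -/
theorem generic_simple [IsAlgClosed k] {n : ℕ} (hn : 3 ≤ n) {b : ℕ → κ}
    (hb : AlgebraicIndependent k (fun l : Fin (n + 1) => b l))
    {F : k[X][X]} (hm : F.Monic) (hd : 0 < F.natDegree)
    (hirr : Irreducible F) (hsep : derivative F ≠ 0) {t : κ}
    (h0 : (Wp (algebraMap k κ) F (fp n b)).eval t = 0) :
    t ∉ cl k (∅ : Set κ) ∧ (derivative (Wp (algebraMap k κ) F (fp n b))).eval t ≠ 0 := by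
  have hfs : ∀ j, fp n b = fp n (fun l => if l < j then b l else 0) + fp n (fun l => if l < j then 0 else b l) := by
    intro j
    ext i
    simp only [coeff_add, fp_coeff]
    split_ifs <;> simp
  have hcf : ∀ j (s : Set κ), (∀ l, j ≤ l → l ≤ n → b l ∈ s) →
      ∀ i, (fp n (fun l => if l < j then 0 else b l)).coeff i ∈ cl k s := by
    intro j s h i
    rw [fp_coeff]
    split_ifs with h1 h2
    · exact zero_mem _
    · exact subset_cl _ (h i (by omega) h1)
    · exact zero_mem _
  rw [Wp_ee] at h0
  have hf1 : fp n (fun l => if l < 1 then b l else 0) = C (b 0) := by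
    ext i
    rw [fp_coeff, coeff_C]
    rcases Nat.eq_zero_or_pos i with rfl | h
    · simp
    · rw [if_neg (by omega : ¬ i < 1), if_neg (by omega : ¬ i = 0)]; simp
  have hf2 : fp n (fun l => if l < 2 then b l else 0) = C (b 0) + C (b 1) * X := by
    ext i
    rw [fp_coeff, coeff_add, coeff_C, coeff_C_mul, coeff_X]
    rcases (by omega : i = 0 ∨ i = 1 ∨ 2 ≤ i) with rfl | rfl | h
    · simp
    · simp; omega
    · rw [if_neg (by omega : ¬ i < 2), if_neg (by omega : ¬ i = 0), if_neg (by omega : ¬ 1 = i)]; simp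
  have htk : t ∉ cl k (∅ : Set κ) := by
    intro ht
    have hx := root_mem_cl hm ht h0
    have := notMem_cl' hb (⟨0, by omega⟩ : Fin (n + 1)) (b '' Set.Icc 1 n) (by
      rintro _ ⟨l, ⟨hl, hl'⟩, rfl⟩
      exact ⟨⟨l, by omega⟩, by simp; omega, rfl⟩)
    apply this
    have hlow : ∀ {s : Set κ} {x}, x ∈ cl k (∅ : Set κ) → x ∈ cl k s :=
        fun h => cl_mono (Set.empty_subset _) h
    have h2 := eval_mem_cl _ (hlow ht) (hcf 1 (b '' Set.Icc 1 n) (fun l h h' => ⟨l, ⟨h, h'⟩, rfl⟩))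
    have h3 := sub_mem (hlow hx) h2
    rw [hfs 1, hf1, eval_add, eval_C, add_sub_cancel_right] at h3
    exact h3
  refine ⟨htk, fun h1 => ?_⟩
  have g1 := deriv_eval h1
  have hts : t ∈ cl k (insert t (b '' Set.Icc 2 n)) := subset_cl _ (by simp)
  obtain ⟨e1, e2⟩ := slope_mem hm hd hirr hsep hts htk h0 g1
  have hc2 := hcf 2 (insert t (b '' Set.Icc 2 n)) (fun l h h' => Or.inr ⟨l, ⟨h, h'⟩, rfl⟩)
  have q1 := eval_mem_cl _ hts hc2
  have q2 := eval_mem_cl _ hts (deriv_mem_cl hc2)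
  have g1 := sub_mem e1 q1
  have g2 := sub_mem e2 q2
  rw [hfs 2, hf2, derivative_add, eval_add, add_sub_cancel_right] at g2
  rw [hfs 2, hf2, eval_add, add_sub_cancel_right] at g1
  simp at g1 g2
  have g0 := sub_mem g1 (mul_mem g2 hts)
  rw [add_sub_cancel_right] at g0
  have hle : cl k (insert t (b '' Set.Icc 2 n)) ≤ cl k (Set.range
      (fun l : Fin n => if (l : ℕ) = 0 then t else b (l + 1))) := by
    apply cl_mono
    rintro x (rfl | ⟨l, ⟨hl, hl'⟩, rfl⟩)
    · exact ⟨⟨0, by omega⟩, by simp⟩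
    · refine ⟨⟨l - 1, by omega⟩, ?_⟩
      simp only
      rw [if_neg (by omega)]
      congr 1; omega
  have := td_le hb (fun l => hle (by
    obtain ⟨l, hl⟩ := l
    rcases (by omega : l = 0 ∨ l = 1 ∨ 2 ≤ l) with rfl | rfl | h
    · exact g0
    · exact g2
    · exact subset_cl _ (Or.inr ⟨l, ⟨h, by omega⟩, rfl⟩)))
  simp at this

end BH

namespace BH

/-- rational function field -/
abbrev KK (k : Type) [Field k] (n : ℕ) : Type := FractionRing (MvPolynomial (Fin n) k)

/-- its algebraic closure -/
abbrev LL (k : Type) [Field k] (n : ℕ) : Type := AlgebraicClosure (KK k n)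

/-- the generic elements -/
noncomputable def gen (k : Type) [Field k] (n : ℕ) (l : Fin n) : LL k n :=
  algebraMap (KK k n) (LL k n) (algebraMap (MvPolynomial (Fin n) k) (KK k n) (MvPolynomial.X l))

theorem gen_indep (k : Type) [Field k] (n : ℕ) : AlgebraicIndependent k (gen k n) := by
  have h1 : AlgebraicIndependent k (MvPolynomial.X : Fin n → MvPolynomial (Fin n) k) :=
    MvPolynomial.algebraicIndependent_X _ _
  have h2 := h1.map' (f := IsScalarTower.toAlgHom k (MvPolynomial (Fin n) k) (KK k n))
    (IsFractionRing.injective (MvPolynomial (Fin n) k) (KK k n))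
  exact h2.map' (f := IsScalarTower.toAlgHom k (KK k n) (LL k n)) (algebraMap (KK k n) (LL k n)).injective

theorem exists_point_aux {k κ : Type} [Field k] [IsAlgClosed k] [Field κ] [Algebra k κ] [IsAlgClosed κ]
    {n : ℕ} (hn : 3 ≤ n) {F : k[X][X]}
    (hm : F.Monic) (hd : 0 < F.natDegree)
    (hirr : Irreducible F) (hsep : derivative F ≠ 0) (y : Fin n → κ) (hy : AlgebraicIndependent k y) :
    ∃ (t0 : κ) (a : ℕ → κ),
      AlgebraicIndependent k (yy n t0 a) ∧ (Wp (algebraMap k κ) F (fp n a)).eval t0 = 0 ∧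
      (derivative (Wp (algebraMap k κ) F (fp n a))).eval t0 = 0 := by
  set t0 : κ := y ⟨0, by omega⟩ with ht0def
  have htk : t0 ∉ cl k (∅ : Set κ) := notMem_cl' hy _ _ (by simp)
  obtain ⟨x0, hx0⟩ : ∃ x0 : κ, ee t0 x0 F = 0 := by
    have h1 : (F.map (eval₂RingHom (algebraMap k κ) t0)).degree ≠ 0 := by
      have h2 : (F.map (eval₂RingHom (algebraMap k κ) t0)).natDegree = F.natDegree := hm.natDegree_map _
      intro h
      have := natDegree_eq_of_degree_eq_some h
      rw [h2] at this
      exact hd.ne' this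
    obtain ⟨x0, hx0⟩ := IsAlgClosed.exists_root _ h1
    refine ⟨x0, ?_⟩
    rw [IsRoot, eval_map] at hx0
    exact hx0
  have hFx := Fx_ne hm hd hirr hsep (deriv_natDegree_lt hd) htk hx0
  set θ := - ee t0 x0 (Ft F) * (ee t0 x0 (derivative F))⁻¹ with hθ
  let a2 : ℕ → κ := fun l => if h : 2 ≤ l ∧ l ≤ n then y ⟨l - 1, by omega⟩ else 0
  let h := fp n a2
  let a1 : κ := θ - (derivative h).eval t0
  let a0 : κ := x0 - a1 * t0 - h.eval t0
  let a : ℕ → κ := fun l => if l = 0 then a0 else if l = 1 then a1 else a2 l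
  have hfa : fp n a = C a0 + C a1 * X + h := by
    ext i
    simp only [h]
    rw [fp_coeff, coeff_add, coeff_add, coeff_C, coeff_C_mul, coeff_X, fp_coeff]
    rcases (by omega : i = 0 ∨ i = 1 ∨ 2 ≤ i) with rfl | rfl | hi
    · simp [a, a2]
    · simp [a, a2]; omega
    · rw [if_neg (by omega : ¬ i = 0), if_neg (by omega : ¬ 1 = i)]
      simp only [a]
      rw [if_neg (by omega : ¬ i = 0), if_neg (by omega : ¬ i = 1)]; simp
  have e1 : (fp n a).eval t0 = x0 := by
    rw [hfa]; simp [a0]; ring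
  have e2 : (derivative (fp n a)).eval t0 = θ := by
    rw [hfa]; simp [a1]
  refine ⟨t0, a, ?_, ?_, ?_⟩
  · convert hy using 1
    ext l
    obtain ⟨l, hl⟩ := l
    unfold yy
    simp only
    split_ifs with h
    · subst h; rfl
    · simp only [a, a2]
      rw [if_neg (by omega), if_neg (by omega), dif_pos (by omega)]
      rfl
  · rw [Wp_ee, e1, hx0]
  · rw [Wp_deriv, eval_add, eval_mul, Wp_ee, Wp_ee, e1, e2, hθ]
    rw [mul_assoc, inv_mul_cancel₀ hFx]
    ring

theorem exists_point {k : Type} [Field k] [IsAlgClosed k] {n : ℕ} (hn : 3 ≤ n) {F : k[X][X]}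
    (hm : F.Monic) (hd : 0 < F.natDegree)
    (hirr : Irreducible F) (hsep : derivative F ≠ 0) :
    ∃ (t0 : LL k n) (a : ℕ → LL k n),
      AlgebraicIndependent k (yy n t0 a) ∧ (Wp (algebraMap k (LL k n)) F (fp n a)).eval t0 = 0 ∧
      (derivative (Wp (algebraMap k (LL k n)) F (fp n a))).eval t0 = 0 :=
  exists_point_aux hn hm hd hirr hsep (gen k n) (gen_indep k n)

section ps
variable {κ : Type} [Field κ]

theorem ps_hensel (P : (PowerSeries κ)[X]) (hP : P.Monic) (t : κ)
    (h0 : (P.map (PowerSeries.constantCoeff (R := κ))).eval t = 0)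
    (h1 : (derivative (P.map (PowerSeries.constantCoeff (R := κ)))).eval t ≠ 0) :
    ∃ τ : PowerSeries κ, P.eval τ = 0 ∧ PowerSeries.constantCoeff τ = t := by
  have hev : ∀ Q : (PowerSeries κ)[X], PowerSeries.constantCoeff (Q.eval (PowerSeries.C t)) =
      (Q.map (PowerSeries.constantCoeff (R := κ))).eval t := by
    intro Q
    rw [eval_map, ← eval₂_at_apply]; simp
  have hH : HenselianRing (PowerSeries κ) (Ideal.span {PowerSeries.X}) := inferInstance
  obtain ⟨τ, hτ, hτ'⟩ := hH.is_henselian P hP (PowerSeries.C t) (by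
    rw [Ideal.mem_span_singleton, PowerSeries.X_dvd_iff, hev, h0]) (by
    have : IsUnit (eval (PowerSeries.C t) (derivative P)) := by
      rw [PowerSeries.isUnit_iff_constantCoeff, hev, ← derivative_map]
      exact h1.isUnit
    exact this.map _)
  refine ⟨τ, hτ, ?_⟩
  rw [Ideal.mem_span_singleton, PowerSeries.X_dvd_iff] at hτ'
  simpa [sub_eq_zero] using hτ'

theorem ps_split (P : (PowerSeries κ)[X]) (hP : P.Monic) (S : Finset κ)
    (hS : ∀ t ∈ S, (P.map (PowerSeries.constantCoeff (R := κ))).eval t = 0 ∧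
      (derivative (P.map (PowerSeries.constantCoeff (R := κ)))).eval t ≠ 0) :
    ∃ (τ : κ → PowerSeries κ) (Q : (PowerSeries κ)[X]), (∀ t ∈ S, PowerSeries.constantCoeff (τ t) = t) ∧
      Q.Monic ∧ P = (∏ t ∈ S, (X - C (τ t))) * Q := by
  have h : ∀ t : κ, ∃ τ : PowerSeries κ, t ∈ S → P.eval τ = 0 ∧ PowerSeries.constantCoeff τ = t := by
    intro t
    by_cases ht : t ∈ S
    · obtain ⟨τ, h⟩ := ps_hensel P hP t (hS t ht).1 (hS t ht).2
      exact ⟨τ, fun _ => h⟩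
    · exact ⟨0, fun h => absurd h ht⟩
  choose τ hτ using h
  have hinj : Set.InjOn τ S := by
    intro x hx y hy hxy
    rw [← (hτ x hx).2, hxy, (hτ y hy).2]
  have hdvd : (∏ t ∈ S, (X - C (τ t))) ∣ P := by
    classical
    rw [← Finset.prod_image (s := S) (g := τ) (f := fun r => X - C r) hinj]
    have : (Finset.image τ S).val ≤ P.roots := by
      rw [Finset.val_le_iff_val_subset]
      intro r hr
      obtain ⟨t, ht, rfl⟩ := Finset.mem_image.1 hr
      rw [mem_roots hP.ne_zero]
      exact (hτ t ht).1
    have h2 := (Multiset.prod_X_sub_C_dvd_iff_le_roots hP.ne_zero _).2 this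
    exact h2
  obtain ⟨Q, hQ⟩ := hdvd
  refine ⟨τ, Q, fun t ht => (hτ t ht).2, ?_, hQ⟩
  have hm : (∏ t ∈ S, (X - C (τ t))).Monic := monic_prod_of_monic _ _ fun t _ => monic_X_sub_C _
  rw [hQ] at hP
  exact hm.of_mul_monic_left hP

/-- an integral root over Laurent series is a power series -/
theorem ps_root (Q : (PowerSeries κ)[X]) (hQ : Q.Monic) (x : LaurentSeries κ)
    (hx : (Q.map (algebraMap (PowerSeries κ) (LaurentSeries κ))).eval x = 0) :
    ∃ ρ : PowerSeries κ, algebraMap (PowerSeries κ) (LaurentSeries κ) ρ = x ∧ Q.eval ρ = 0 := by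
  have hintg : IsIntegral (PowerSeries κ) x := ⟨Q, hQ, by rw [← eval_map]; exact hx⟩
  obtain ⟨ρ, hρ⟩ := (IsIntegrallyClosed.isIntegral_iff (R := PowerSeries κ) (K := LaurentSeries κ)).1 hintg
  refine ⟨ρ, hρ, ?_⟩
  rw [← hρ, eval_map, eval₂_at_apply] at hx
  exact (map_eq_zero_iff _ (IsFractionRing.injective (PowerSeries κ) (LaurentSeries κ))).1 hx

end ps
end BH

namespace BH

theorem lam_ne {k κ : Type} [Field k] [Field κ] [Algebra k κ] {F : k[X][X]} (hm : F.Monic) {n : ℕ}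
    {x : κ} (hx : x ∉ cl k (∅ : Set κ)) : eval₂ (algebraMap k κ) x (Lam n F) ≠ 0 := fun h =>
  trans_k hx ⟨Lam n F, (Lam_monic hm).1.ne_zero, h⟩

theorem scaled_monic {k A : Type} [Field k] [CommRing A] [Nontrivial A] {φ : k →+* A} {F : k[X][X]} {n : ℕ}
    {f : A[X]} (hs : ∀ j ≤ F.natDegree, (F.coeff j).natDegree ≤ (F.natDegree - j) * n)
    (hf : f.natDegree ≤ n) {u : A} (hu : u * eval₂ φ (f.coeff n) (Lam n F) = 1) :
    (C u * Wp φ F f).Monic ∧ (C u * Wp φ F f).natDegree = F.natDegree * n := by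
  have h1 : (C u * Wp φ F f).natDegree ≤ F.natDegree * n :=
    (natDegree_C_mul_le _ _).trans (Wp_natDegree_le hs hf)
  have h2 : (C u * Wp φ F f).coeff (F.natDegree * n) = 1 := by
    rw [coeff_C_mul, Wp_coeff hs hf, hu]
  exact ⟨monic_of_natDegree_le_of_coeff_eq_one _ h1 h2,
    le_antisymm h1 (le_natDegree_of_ne_zero (by rw [h2]; exact one_ne_zero))⟩

section ps
variable {κ : Type} [Field κ] [IsAlgClosed κ]

theorem ps_all_simple (P : (PowerSeries κ)[X]) (hP : P.Monic)
    (hs : ∀ t, (P.map (PowerSeries.constantCoeff (R := κ))).eval t = 0 →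
      (derivative (P.map (PowerSeries.constantCoeff (R := κ)))).eval t ≠ 0) :
    ∃ (τ : κ → PowerSeries κ) (S : Finset κ), P = ∏ t ∈ S, (X - C (τ t)) := by
  classical
  set Pb := P.map (PowerSeries.constantCoeff (R := κ)) with hPb
  have hPbm : Pb.Monic := hP.map _
  have hmem : ∀ t, t ∈ Pb.roots.toFinset ↔ Pb.eval t = 0 := by
    intro t; rw [Multiset.mem_toFinset, mem_roots hPbm.ne_zero]; rfl
  obtain ⟨τ, Q, h1, h2, h3⟩ := ps_split P hP Pb.roots.toFinset (fun t ht =>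
    ⟨(hmem t).1 ht, hs t ((hmem t).1 ht)⟩)
  have hcard : Pb.roots.toFinset.card = P.natDegree := by
    rw [Multiset.toFinset_card_of_nodup, splits_iff_card_roots.1 (IsAlgClosed.splits Pb), hP.natDegree_map]
    rw [Multiset.nodup_iff_count_le_one]
    intro t
    rw [count_roots]
    by_contra hcon
    push Not at hcon
    rw [one_lt_rootMultiplicity_iff_isRoot hPbm.ne_zero] at hcon
    exact hs t hcon.1 hcon.2
  have hm : (∏ t ∈ Pb.roots.toFinset, (X - C (τ t))).Monic :=
    monic_prod_of_monic _ _ fun t _ => monic_X_sub_C _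
  have hd := congrArg natDegree h3
  rw [hm.natDegree_mul h2, natDegree_prod_of_monic _ _ (fun t _ => monic_X_sub_C _)] at hd
  simp only [natDegree_X_sub_C, Finset.sum_const, smul_eq_mul, mul_one, hcard] at hd
  have hQ : Q = 1 := h2.natDegree_eq_zero.1 (by omega)
  exact ⟨τ, _, by rw [hQ, mul_one] at h3; exact h3⟩

theorem ps_double (P : (PowerSeries κ)[X]) (hP : P.Monic) (t0 : κ)
    (h0 : (P.map (PowerSeries.constantCoeff (R := κ))).eval t0 = 0)
    (h1 : (derivative (P.map (PowerSeries.constantCoeff (R := κ)))).eval t0 = 0)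
    (h3 : ¬ (X - C t0) ^ 3 ∣ P.map (PowerSeries.constantCoeff (R := κ)))
    (hs : ∀ t, t ≠ t0 → (P.map (PowerSeries.constantCoeff (R := κ))).eval t = 0 →
      (derivative (P.map (PowerSeries.constantCoeff (R := κ)))).eval t ≠ 0) :
    ∃ (τ : κ → PowerSeries κ) (S : Finset κ) (Q : (PowerSeries κ)[X]), Q.Monic ∧ Q.natDegree = 2 ∧
      P = (∏ t ∈ S, (X - C (τ t))) * Q ∧
      ∀ ρ, Q.eval ρ = 0 → PowerSeries.constantCoeff ρ = t0 := by
  classical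
  set Pb := P.map (PowerSeries.constantCoeff (R := κ)) with hPb
  have hPbm : Pb.Monic := hP.map _
  have hmem : ∀ t, t ∈ Pb.roots.toFinset ↔ Pb.eval t = 0 := by
    intro t; rw [Multiset.mem_toFinset, mem_roots hPbm.ne_zero]; rfl
  have hsS : ∀ t ∈ Pb.roots.toFinset.erase t0, Pb.eval t = 0 ∧ (derivative Pb).eval t ≠ 0 := by
    intro t ht
    rw [Finset.mem_erase, hmem] at ht
    exact ⟨ht.2, hs t ht.1 ht.2⟩
  obtain ⟨τ, Q, g1, g2, g3⟩ := ps_split P hP (Pb.roots.toFinset.erase t0) hsS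
  have ht0 : t0 ∈ Pb.roots.toFinset := (hmem t0).2 h0
  have hcard : (Pb.roots.toFinset.erase t0).card + 2 = P.natDegree := by
    rw [← hP.natDegree_map (PowerSeries.constantCoeff (R := κ)), ← hPb,
      ← splits_iff_card_roots.1 (IsAlgClosed.splits Pb), ← Multiset.toFinset_sum_count_eq,
      ← Finset.sum_erase_add _ _ ht0]
    congr 1
    · rw [Finset.card_eq_sum_ones]
      refine Finset.sum_congr rfl fun t ht => ?_
      have hle : ¬ 1 < Pb.roots.count t := by
        rw [count_roots, one_lt_rootMultiplicity_iff_isRoot hPbm.ne_zero]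
        exact fun h => (hsS t ht).2 h.2
      have hpos : 0 < Pb.roots.count t := Multiset.count_pos.2 (by
        rw [← Multiset.mem_toFinset]; exact Finset.mem_of_mem_erase ht)
      omega
    · have ha : 1 < Pb.roots.count t0 := by
        rw [count_roots, one_lt_rootMultiplicity_iff_isRoot hPbm.ne_zero]
        exact ⟨h0, h1⟩
      have hb : ¬ 3 ≤ Pb.roots.count t0 := by
        rw [count_roots, le_rootMultiplicity_iff hPbm.ne_zero]
        exact h3
      omega
  have hm : (∏ t ∈ Pb.roots.toFinset.erase t0, (X - C (τ t))).Monic :=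
    monic_prod_of_monic _ _ fun t _ => monic_X_sub_C _
  have hd := congrArg natDegree g3
  rw [hm.natDegree_mul g2, natDegree_prod_of_monic _ _ (fun t _ => monic_X_sub_C _)] at hd
  simp only [natDegree_X_sub_C, Finset.sum_const, smul_eq_mul, mul_one] at hd
  refine ⟨τ, _, Q, g2, by omega, g3, ?_⟩
  intro ρ hρ
  have hev : ∀ P : (PowerSeries κ)[X], (P.map (PowerSeries.constantCoeff (R := κ))).eval
      (PowerSeries.constantCoeff ρ) = PowerSeries.constantCoeff (P.eval ρ) := by
    intro P; rw [eval_map, eval₂_at_apply]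
  have hQb := hev Q
  rw [hρ, map_zero] at hQb
  have hPr : Pb.eval (PowerSeries.constantCoeff ρ) = 0 := by
    rw [hPb, hev, g3, eval_mul, hρ, mul_zero, map_zero]
  by_contra hne
  have hin : PowerSeries.constantCoeff ρ ∈ Pb.roots.toFinset.erase t0 := by
    rw [Finset.mem_erase, hmem]; exact ⟨hne, hPr⟩
  apply (hsS _ hin).2
  have hPb2 : Pb = (∏ t ∈ Pb.roots.toFinset.erase t0, (X - C (τ t))).map (PowerSeries.constantCoeff (R := κ))
      * Q.map (PowerSeries.constantCoeff (R := κ)) := by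
    rw [← Polynomial.map_mul, ← g3]
  have hA : ((∏ t ∈ Pb.roots.toFinset.erase t0, (X - C (τ t))).map (PowerSeries.constantCoeff (R := κ))).eval
      (PowerSeries.constantCoeff ρ) = 0 := by
    rw [Polynomial.map_prod, eval_prod]
    refine Finset.prod_eq_zero hin ?_
    simp [g1 _ hin]
  rw [hPb2, derivative_mul, eval_add, eval_mul, eval_mul, hQb, hA]
  ring

end ps

section swap
variable {k κ : Type} [Field k] [Field κ] [Algebra k κ] [IsAlgClosed κ]

/-- structure map to power series -/
noncomputable abbrev phiR (k κ : Type) [Field k] [Field κ] [Algebra k κ] : k →+* PowerSeries κ :=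
  (PowerSeries.C (R := κ)).comp (algebraMap k κ)

/-- perturbed coefficients -/
noncomputable def aR (a : ℕ → κ) (l : ℕ) : PowerSeries κ :=
  PowerSeries.C (a l) + if l = 0 then PowerSeries.X else 0

theorem fp_aR (n : ℕ) (a : ℕ → κ) : fp n (aR a) = (fp n a).map (PowerSeries.C (R := κ)) + C PowerSeries.X := by
  ext1 i
  rw [fp_coeff, coeff_add, coeff_map, fp_coeff, coeff_C]
  unfold aR
  split_ifs with h1 h2
  · rfl
  · rfl
  · omega
  · simp

theorem Wp_aR (n : ℕ) (a : ℕ → κ) (F : k[X][X]) :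
    (Wp (phiR k κ) F (fp n (aR a))).map (PowerSeries.constantCoeff (R := κ)) =
      Wp (algebraMap k κ) F (fp n a) := by
  rw [Wp_map]
  have e1 : (PowerSeries.constantCoeff (R := κ)).comp (phiR k κ) = algebraMap k κ := by
    ext; simp
  have e2 : (fp n (aR a)).map (PowerSeries.constantCoeff (R := κ)) = fp n a := by
    rw [fp_map]
    unfold fp
    refine Finset.sum_congr rfl fun l _ => ?_
    unfold aR
    by_cases h : l = 0 <;> simp [h]
  rw [e1, e2]

/-- the quadratic factor has no root in power series -/
theorem no_root {n : ℕ} {a : ℕ → κ} {F : k[X][X]} {t0 : κ}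
    (h0 : (Wp (algebraMap k κ) F (fp n a)).eval t0 = 0)
    (h1 : (derivative (Wp (algebraMap k κ) F (fp n a))).eval t0 = 0)
    (hx : (Wp (algebraMap k κ) (derivative F) (fp n a)).eval t0 ≠ 0) {ρ : PowerSeries κ}
    (hρ : PowerSeries.constantCoeff ρ = t0) : (Wp (phiR k κ) F (fp n (aR a))).eval ρ ≠ 0 := by
  intro h
  have hd2 : (X - C t0) ^ 2 ∣ Wp (algebraMap k κ) F (fp n a) := by
    by_cases hz : Wp (algebraMap k κ) F (fp n a) = 0
    · rw [hz]; exact dvd_zero _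
    rw [← le_rootMultiplicity_iff hz]
    have := (one_lt_rootMultiplicity_iff_isRoot hz).2 ⟨h0, h1⟩
    omega
  obtain ⟨Z, hZ⟩ := hd2
  have hρ' : PowerSeries.X ∣ ρ - PowerSeries.C t0 := by
    rw [PowerSeries.X_dvd_iff]; simp [hρ]
  obtain ⟨σ, hσ⟩ := hρ'
  obtain ⟨R, hR⟩ := Wp_taylor (phiR k κ) F ((fp n a).map (PowerSeries.C (R := κ))) (C PowerSeries.X)
  rw [← fp_aR, ← Wp_map, ← Wp_map, hZ] at hR
  rw [hR] at h
  simp only [Polynomial.map_mul, Polynomial.map_pow, Polynomial.map_sub, map_X, map_C, eval_add, eval_mul, eval_pow, eval_sub,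
    eval_X, eval_C, hσ] at h
  have h2 : (PowerSeries.X : PowerSeries κ) * (PowerSeries.X * (σ ^ 2 *
      (Z.map (PowerSeries.C (R := κ))).eval ρ + R.eval ρ) +
      ((Wp (algebraMap k κ) (derivative F) (fp n a)).map (PowerSeries.C (R := κ))).eval ρ) = 0 := by
    linear_combination h
  rcases mul_eq_zero.1 h2 with h3 | h3
  · exact PowerSeries.X_ne_zero h3
  · have h4 := congrArg (PowerSeries.constantCoeff (R := κ)) h3
    simp only [map_add, map_mul, PowerSeries.constantCoeff_X, zero_mul, zero_add, map_zero] at h4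
    apply hx
    rw [← h4]
    generalize Wp (algebraMap k κ) (derivative F) (fp n a) = P
    rw [eval_map, hom_eval₂, hρ]
    have : (PowerSeries.constantCoeff (R := κ)).comp (PowerSeries.C (R := κ)) = RingHom.id κ := by
      ext; simp
    rw [this]
    rfl

end swap
end BH

namespace BH

/-- closure of Laurent series -/
abbrev MM (κ : Type) [Field κ] : Type := AlgebraicClosure (LaurentSeries κ)

/-- power series into the closure -/
noncomputable abbrev psM (κ : Type) [Field κ] : PowerSeries κ →+* MM κ :=
  (algebraMap (LaurentSeries κ) (MM κ)).comp (algebraMap (PowerSeries κ) (LaurentSeries κ))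

theorem psM_inj (κ : Type) [Field κ] : Function.Injective (psM κ) :=
  (algebraMap (LaurentSeries κ) (MM κ)).injective.comp
    (IsFractionRing.injective (PowerSeries κ) (LaurentSeries κ))

/-- swapping the roots of an irreducible quadratic -/
theorem quad_swap {L : Type} [Field L] {q : L[X]} (hq : q.Monic) (h2 : q.natDegree = 2)
    (hn : ∀ x, q.eval x ≠ 0) :
    ∃ (σ : AlgebraicClosure L ≃ₐ[L] AlgebraicClosure L) (τ1 τ2 : AlgebraicClosure L),
      q.map (algebraMap L (AlgebraicClosure L)) = (X - C τ1) * (X - C τ2) ∧ σ τ1 = τ2 ∧ σ τ2 = τ1 := by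
  have hirr : Irreducible q := by
    rw [hq.irreducible_iff_roots_eq_zero_of_degree_le_three (by omega) (by omega)]
    rw [Multiset.eq_zero_iff_forall_notMem]
    intro x hx
    exact hn x (isRoot_of_mem_roots hx)
  set Q := q.map (algebraMap L (AlgebraicClosure L)) with hQ
  have hQm : Q.Monic := hq.map _
  have hcard : Q.roots.card = 2 := by
    rw [splits_iff_card_roots.1 (IsAlgClosed.splits Q), hq.natDegree_map, h2]
  obtain ⟨τ1, τ2, hr⟩ := Multiset.card_eq_two.1 hcard
  have hfac : Q = (X - C τ1) * (X - C τ2) := by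
    have := (IsAlgClosed.splits Q).eq_prod_roots_of_monic hQm
    rw [hr] at this
    rw [this]
    simp
  have r1 : aeval τ1 q = 0 := by
    rw [aeval_def, ← eval_map, ← hQ, hfac]; simp
  have r2 : aeval τ2 q = 0 := by
    rw [aeval_def, ← eval_map, ← hQ, hfac]; simp
  have m1 : q = minpoly L τ1 := minpoly.eq_of_irreducible_of_monic hirr r1 hq
  obtain ⟨σ, hσ⟩ := minpoly.exists_algEquiv_of_root' (x := τ2) (Algebra.IsAlgebraic.isAlgebraic (R := L) τ1)
    (by rw [← m1]; exact r2)
  refine ⟨σ, τ1, τ2, hfac, hσ, ?_⟩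
  have hs : τ1 + τ2 = algebraMap L _ (- q.coeff 1) := by
    have := congrArg (fun P => P.coeff 1) hfac
    simp only [hQ, coeff_map] at this
    have h3 : ((X - C τ1) * (X - C τ2)).coeff 1 = -(τ1 + τ2) := by
      have : (X - C τ1) * (X - C τ2) = X ^ 2 - C (τ1 + τ2) * X + C (τ1 * τ2) := by
        rw [C_add, C_mul]; ring
      rw [this, coeff_add, coeff_sub, coeff_C_mul, coeff_X_pow, coeff_X, coeff_C]
      simp
    rw [h3] at this
    rw [map_neg, this, neg_neg]
  have h4 := congrArg σ hs
  rw [map_add, AlgEquiv.commutes, ← hs, hσ] at h4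
  linear_combination h4

section
variable {k κ : Type} [Field k] [IsAlgClosed k] [Field κ] [Algebra k κ] [IsAlgClosed κ]

theorem local_swap {n : ℕ} (hn : 3 ≤ n) {ι : Type} {F : ι → k[X][X]} (hm : ∀ i, (F i).Monic)
    (hd : ∀ i, 0 < (F i).natDegree) (hirr : ∀ i, Irreducible (F i))
    (hsep : ∀ i, derivative (F i) ≠ 0) (hinj : Function.Injective F)
    (hs : ∀ i, ∀ j ≤ (F i).natDegree, ((F i).coeff j).natDegree ≤ ((F i).natDegree - j) * n)
    (i0 : ι) {t0 : κ} {a : ℕ → κ} (hy : AlgebraicIndependent k (yy n t0 a))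
    (h0 : (Wp (algebraMap k κ) (F i0) (fp n a)).eval t0 = 0)
    (h1 : (derivative (Wp (algebraMap k κ) (F i0) (fp n a))).eval t0 = 0) :
    ∃ (σ : MM κ ≃ₐ[LaurentSeries κ] MM κ) (τ1 τ2 : MM κ), σ τ1 = τ2 ∧ σ τ2 = τ1 ∧
      (X - C τ1) * (X - C τ2) ∣ (Wp (phiR k κ) (F i0) (fp n (aR a))).map (psM κ) ∧
      ∀ i x, ((Wp (phiR k κ) (F i) (fp n (aR a))).map (psM κ)).eval x = 0 →
        σ x = x ∨ (i = i0 ∧ (x = τ1 ∨ x = τ2)) := by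
  have ht0 : t0 ∉ cl k (∅ : Set κ) := fun h => ind_t0 hn hy (cl_mono (Set.empty_subset _) h)
  have han : a n ∉ cl k (∅ : Set κ) := fun h =>
    ind_a hy (by omega : 2 ≤ n) (le_refl n) (cl_mono (Set.empty_subset _) h)
  have hFx : (Wp (algebraMap k κ) (derivative (F i0)) (fp n a)).eval t0 ≠ 0 := by
    rw [Wp_ee]
    rw [Wp_ee] at h0
    exact Fx_ne (hm i0) (hd i0) (hirr i0) (hsep i0) (deriv_natDegree_lt (hd i0)) ht0 h0
  -- normalisation
  have hnorm : ∀ i, ∃ u : κ, u ≠ 0 ∧ (C (PowerSeries.C u) * Wp (phiR k κ) (F i) (fp n (aR a))).Monic := by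
    intro i
    have hl := lam_ne (n := n) (hm i) han
    refine ⟨_, inv_ne_zero hl, (scaled_monic (hs i) (fp_natDegree_le _) ?_).1⟩
    have : (fp n (aR a)).coeff n = PowerSeries.C (a n) := by
      rw [fp_coeff, if_pos le_rfl]; unfold aR; rw [if_neg (by omega), add_zero]
    rw [this, ← hom_eval₂, ← map_mul, inv_mul_cancel₀ hl, map_one]
  choose u hu hmon using hnorm
  have hmap : ∀ i, (C (PowerSeries.C (u i)) * Wp (phiR k κ) (F i) (fp n (aR a))).map
      (PowerSeries.constantCoeff (R := κ)) = C (u i) * Wp (algebraMap k κ) (F i) (fp n a) := by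
    intro i; rw [Polynomial.map_mul, Wp_aR, map_C, PowerSeries.constantCoeff_C]
  have hroot : ∀ i t, ((C (PowerSeries.C (u i)) * Wp (phiR k κ) (F i) (fp n (aR a))).map
      (PowerSeries.constantCoeff (R := κ))).eval t = 0 ↔ (Wp (algebraMap k κ) (F i) (fp n a)).eval t = 0 := by
    intro i t; rw [hmap, eval_mul, eval_C, mul_eq_zero, or_iff_right (hu i)]
  have hroot' : ∀ i t, (derivative ((C (PowerSeries.C (u i)) * Wp (phiR k κ) (F i) (fp n (aR a))).map
      (PowerSeries.constantCoeff (R := κ)))).eval t = 0 ↔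
      (derivative (Wp (algebraMap k κ) (F i) (fp n a))).eval t = 0 := by
    intro i t; rw [hmap, derivative_C_mul, eval_mul, eval_C, mul_eq_zero, or_iff_right (hu i)]
  have hother : ∀ i t, (Wp (algebraMap k κ) (F i) (fp n a)).eval t = 0 →
      (derivative (Wp (algebraMap k κ) (F i) (fp n a))).eval t = 0 → t = t0 ∧ i0 = i := by
    intro i t e1 e2
    have := other_simple hn hy (hm i0) (hd i0) (hirr i0) (hsep i0) h0 h1 (hm i) (hd i) (hirr i) (hsep i) e1 e2
    exact ⟨this.1, hinj this.2⟩
  obtain ⟨τ, S, Q, hQm, hQ2, hQP, hQr⟩ := ps_double _ (hmon i0) t0 ((hroot i0 t0).2 h0) ((hroot' i0 t0).2 h1)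
    (by
      rw [hmap]
      intro h
      apply not_triple hn hy (hm i0) (hd i0) (hirr i0) (hsep i0) h0 h1
      rwa [(isUnit_C.2 (hu i0).isUnit).dvd_mul_left] at h)
    (fun t ht e1 e2 => ht (hother i0 t ((hroot i0 t).1 e1) ((hroot' i0 t).1 e2)).1)
  obtain ⟨σ, τ1, τ2, hfac, s1, s2⟩ := quad_swap (q := Q.map (algebraMap (PowerSeries κ) (LaurentSeries κ)))
    (hQm.map _) (by rw [hQm.natDegree_map, hQ2]) (by
      intro x hx
      obtain ⟨ρ, -, hρ⟩ := ps_root Q hQm x hx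
      have hP0 : (C (PowerSeries.C (u i0)) * Wp (phiR k κ) (F i0) (fp n (aR a))).eval ρ = 0 := by
        rw [hQP, eval_mul, hρ, mul_zero]
      rw [eval_mul, eval_C, mul_eq_zero] at hP0
      refine no_root h0 h1 hFx (hQr ρ hρ) (hP0.resolve_left ?_)
      simpa using hu i0)
  have hfac' : Q.map (psM κ) = (X - C τ1) * (X - C τ2) := by
    rw [← hfac, Polynomial.map_map]
  have hfix : ∀ r : PowerSeries κ, σ (psM κ r) = psM κ r := fun r => σ.commutes _
  have hue : ∀ i x, ((Wp (phiR k κ) (F i) (fp n (aR a))).map (psM κ)).eval x = 0 →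
      ((C (PowerSeries.C (u i)) * Wp (phiR k κ) (F i) (fp n (aR a))).map (psM κ)).eval x = 0 := by
    intro i x hx
    rw [Polynomial.map_mul, eval_mul, hx, mul_zero]
  have hprod : ∀ (τ : κ → PowerSeries κ) (S : Finset κ) (x : MM κ),
      ((∏ t ∈ S, (X - C (τ t))).map (psM κ)).eval x = 0 → σ x = x := by
    intro τ S x hx
    rw [Polynomial.map_prod, eval_prod, Finset.prod_eq_zero_iff] at hx
    obtain ⟨t, -, ht⟩ := hx
    rw [Polynomial.map_sub, map_X, map_C, eval_sub, eval_X, eval_C, sub_eq_zero] at ht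
    rw [ht, hfix]
  refine ⟨σ, τ1, τ2, s1, s2, ?_, ?_⟩
  · have hdv : Q.map (psM κ) ∣ (C (PowerSeries.C (u i0)) * Wp (phiR k κ) (F i0) (fp n (aR a))).map (psM κ) :=
      Polynomial.map_dvd _ ⟨_, by rw [hQP, mul_comm]⟩
    have hun : IsUnit (C (psM κ (PowerSeries.C (u i0)))) := by
      rw [isUnit_C, isUnit_iff_ne_zero, Ne, map_eq_zero_iff _ (psM_inj κ)]
      simpa using hu i0
    rw [hfac', Polynomial.map_mul, map_C, hun.dvd_mul_left] at hdv
    exact hdv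
  · intro i x hx
    have hx' := hue i x hx
    by_cases hi : i = i0
    · subst hi
      rw [hQP, Polynomial.map_mul, eval_mul, mul_eq_zero, hfac'] at hx'
      rcases hx' with hx' | hx'
      · left; exact hprod τ S x hx'
      · right
        refine ⟨rfl, ?_⟩
        simpa [sub_eq_zero] using hx'
    · left
      obtain ⟨τ', S', hP'⟩ := ps_all_simple _ (hmon i) (fun t e1 e2 =>
        hi (hother i t ((hroot i t).1 e1) ((hroot' i t).1 e2)).2.symm)
      rw [hP'] at hx'
      exact hprod τ' S' x hx'

end
end BH

namespace BH

theorem restr {K L M : Type} [Field K] [Field L] [Field M] [Algebra K L] [Algebra K M]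
    [IsAlgClosure K L] (j : L →ₐ[K] M) (σ : M →ₐ[K] M) :
    ∃ ρ : L →ₐ[K] L, ∀ x, j (ρ x) = σ (j x) := by
  have : Normal K L := IsAlgClosure.normal K L
  let _ : Algebra L M := j.toRingHom.toAlgebra
  have : IsScalarTower K L M := IsScalarTower.of_algebraMap_eq (fun x => (j.commutes x).symm)
  exact ⟨σ.restrictNormal L, fun x => AlgHom.restrictNormal_commutes σ L x⟩

theorem transport0 {K L Λ M : Type} [Field K] [Field L] [Algebra K L] [IsAlgClosure K L]
    [Field Λ] [Field M] [IsAlgClosed M] [Algebra Λ M] (e : K →+* Λ) (σ : M →ₐ[Λ] M) :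
    ∃ (j : L →+* M) (ρ : L →+* L),
      (∀ x, j (algebraMap K L x) = algebraMap Λ M (e x)) ∧ ∀ x, j (ρ x) = σ (j x) := by
  let _ : Algebra K Λ := e.toAlgebra
  let _ : Algebra K M := ((algebraMap Λ M).comp e).toAlgebra
  have : IsScalarTower K Λ M := IsScalarTower.of_algebraMap_eq (fun x => rfl)
  have : Algebra.IsAlgebraic K L := IsAlgClosure.isAlgebraic
  let j : L →ₐ[K] M := IsAlgClosed.lift
  obtain ⟨ρ, hρ⟩ := restr j (σ.restrictScalars K)
  exact ⟨j, ρ, fun x => j.commutes x, hρ⟩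

theorem transport {k : Type} [Field k] {N : ℕ} {Λ M : Type} [Field Λ] [Field M] [IsAlgClosed M]
    [Algebra Λ M] (φ : k →+* Λ) (a : Fin N → Λ)
    (ha : Function.Injective (MvPolynomial.eval₂Hom φ a)) (σ : M →ₐ[Λ] M) :
    ∃ (j : LL k N →+* M) (ρ : LL k N →+* LL k N),
      (∀ c, j (algebraMap k _ c) = algebraMap Λ M (φ c)) ∧
      (∀ l, j (gen k N l) = algebraMap Λ M (a l)) ∧ ∀ x, j (ρ x) = σ (j x) := by
  let e : KK k N →+* Λ := IsFractionRing.lift ha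
  have he : ∀ x, e (algebraMap _ _ x) = MvPolynomial.eval₂Hom φ a x :=
    fun x => IsFractionRing.lift_algebraMap ha x
  obtain ⟨j, ρ, hj0, hρ⟩ := transport0 (L := LL k N) e σ
  have hj : ∀ x, j (algebraMap (KK k N) _ (algebraMap _ _ x)) =
      algebraMap Λ M (MvPolynomial.eval₂Hom φ a x) := by
    intro x
    rw [hj0, ← he]
  refine ⟨j, ρ, ?_, ?_, hρ⟩
  · intro c
    have := hj (MvPolynomial.C c)
    rw [MvPolynomial.coe_eval₂Hom, MvPolynomial.eval₂_C] at this
    rw [← this]; rfl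
  · intro l
    have := hj (MvPolynomial.X l)
    rw [MvPolynomial.coe_eval₂Hom, MvPolynomial.eval₂_X] at this
    rw [← this]; rfl

/-- elements algebraic over an algebraically closed image -/
theorem alg_range {k L M κ : Type} [Field k] [Field L] [Field M] [Field κ] [IsAlgClosed κ] [Algebra k L]
    (j : L →+* M) (ψ : κ →+* M) (s : Set L) (hk : ∀ c, j (algebraMap k L c) ∈ ψ.range)
    (hs : ∀ x ∈ s, j x ∈ ψ.range) {x : L} (hx : x ∈ cl k s) : j x ∈ ψ.range := by
  obtain ⟨P, hP, hPx⟩ := mem_cl_iff.1 hx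
  have hA : ∀ y ∈ Algebra.adjoin k s, j y ∈ ψ.range := by
    intro y hy
    induction hy using Algebra.adjoin_induction with
    | mem x hx => exact hs x hx
    | algebraMap r => exact hk r
    | add x y _ _ h1 h2 => rw [map_add]; exact ψ.range.add_mem h1 h2
    | mul x y _ _ h1 h2 => rw [map_mul]; exact ψ.range.mul_mem h1 h2
  let P1 : M[X] := (P.map (algebraMap (Algebra.adjoin k s) L)).map j
  have hP1 : P1 ≠ 0 := by
    simp only [P1]
    rw [Ne, Polynomial.map_eq_zero_iff j.injective, Polynomial.map_eq_zero_iff]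
    · exact hP
    · exact Subtype.val_injective
  have hl : P1 ∈ Polynomial.lifts ψ := by
    rw [Polynomial.lifts_iff_coeff_lifts]
    intro i
    simp only [P1, coeff_map]
    exact hA _ (P.coeff i).2
  obtain ⟨Q, hQ⟩ := (Polynomial.mem_lifts _).1 hl
  have hr : j x ∈ P1.roots := by
    rw [mem_roots hP1, IsRoot]
    simp only [P1]
    rw [eval_map, eval₂_hom, eval_map, ← aeval_def, hPx, map_zero]
  rw [← hQ, (IsAlgClosed.splits Q).roots_map, Multiset.mem_map] at hr
  obtain ⟨r, -, hr⟩ := hr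
  exact ⟨r, hr⟩

section
variable {k : Type} [Field k]

/-- generic coefficients indexed by ℕ -/
noncomputable def bb (k : Type) [Field k] (n : ℕ) (l : ℕ) : LL k (n + 1) :=
  if h : l < n + 1 then gen k (n + 1) ⟨l, h⟩ else 0

theorem bb_indep (k : Type) [Field k] (n : ℕ) : AlgebraicIndependent k (fun l : Fin (n + 1) => bb k n l) := by
  convert gen_indep k (n + 1) using 1
  ext l
  unfold bb
  rw [dif_pos l.2]

/-- the field of constants for the line `u = b 0` -/
noncomputable def OM (k : Type) [Field k] (n : ℕ) : IntermediateField k (LL k (n + 1)) :=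
  cl k (bb k n '' Set.Icc 1 n)

/-- generic values -/
noncomputable abbrev WW (n : ℕ) (F : k[X][X]) : (LL k (n + 1))[X] :=
  Wp (algebraMap k (LL k (n + 1))) F (fp n (bb k n))

theorem aR_inj {κ : Type} [Field κ] [Algebra k κ] {n : ℕ} {a : ℕ → κ}
    (ha : AlgebraicIndependent k (fun l : Fin n => a (l + 1))) :
    Function.Injective (MvPolynomial.eval₂Hom (phiR k κ) (fun l : Fin (n + 1) => aR a l)) := by
  have h1 : MvPolynomial.eval₂Hom (phiR k κ) (fun l : Fin (n + 1) => aR a l) =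
      ((Polynomial.coeToPowerSeries.ringHom (R := κ)).comp
        ((compRingHom (X + C (a 0))).comp (mapRingHom (MvPolynomial.aeval (R := k)
          (fun l : Fin n => a (l + 1))).toRingHom))).comp
        (MvPolynomial.finSuccEquiv k n).toRingEquiv.toRingHom := by
    apply MvPolynomial.ringHom_ext
    · intro c
      simp [MvPolynomial.finSuccEquiv_apply, aR]
    · intro l
      refine Fin.cases ?_ (fun l => ?_) l
      · simp [MvPolynomial.finSuccEquiv_apply, aR, add_comm]
      · simp [MvPolynomial.finSuccEquiv_apply, aR]
  rw [h1]
  intro x y h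
  have h2 := Polynomial.coe_injective κ h
  apply (MvPolynomial.finSuccEquiv k n).injective
  apply Polynomial.map_injective (MvPolynomial.aeval (R := k) (fun l : Fin n => a (l + 1))).toRingHom ha
  apply Polynomial.taylor_injective (a 0)
  rw [taylor_apply, taylor_apply]
  exact h2

theorem global_swap [IsAlgClosed k] {n : ℕ} (hn : 3 ≤ n) {ι : Type} {F : ι → k[X][X]} (hm : ∀ i, (F i).Monic)
    (hd : ∀ i, 0 < (F i).natDegree) (hirr : ∀ i, Irreducible (F i))
    (hsep : ∀ i, derivative (F i) ≠ 0) (hinj : Function.Injective F)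
    (hs : ∀ i, ∀ j ≤ (F i).natDegree, ((F i).coeff j).natDegree ≤ ((F i).natDegree - j) * n)
    (i0 : ι) : ∃ (ρ : LL k (n + 1) →+* LL k (n + 1)) (s1 s2 : LL k (n + 1)), s1 ≠ s2 ∧
      (∀ x ∈ OM k n, ρ x = x) ∧ ρ (bb k n 0) = bb k n 0 ∧ ρ s1 = s2 ∧ ρ s2 = s1 ∧
      (WW n (F i0)).eval s1 = 0 ∧ (WW n (F i0)).eval s2 = 0 ∧
      ∀ i x, (WW n (F i)).eval x = 0 → ρ x = x ∨ (i = i0 ∧ (x = s1 ∨ x = s2)) := by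
  obtain ⟨t0, a, hy, h0, h1⟩ := exists_point hn (hm i0) (hd i0) (hirr i0) (hsep i0)
  have hia := indep_a hn hy (hm i0) (hd i0) (hirr i0) (hsep i0) h0 h1
  obtain ⟨σ, τ1, τ2, e1, e2, hdv, hfix⟩ := local_swap hn hm hd hirr hsep hinj hs i0 hy h0 h1
  have hinj' : Function.Injective (MvPolynomial.eval₂Hom
      ((algebraMap (PowerSeries (LL k n)) (LaurentSeries (LL k n))).comp (phiR k (LL k n)))
      (fun l : Fin (n + 1) => algebraMap (PowerSeries (LL k n)) (LaurentSeries (LL k n)) (aR a l))) := by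
    have h2 := (IsFractionRing.injective (PowerSeries (LL k n)) (LaurentSeries (LL k n))).comp (aR_inj hia)
    convert h2 using 1
    ext p : 1
    simp only [MvPolynomial.coe_eval₂Hom, Function.comp]
    rw [MvPolynomial.hom_eval₂]
  obtain ⟨j, ρ, j1, j2, j3⟩ := transport (M := MM (LL k n)) _ _ hinj' σ.toAlgHom
  have hjb : ∀ l ≤ n, j (bb k n l) = psM _ (aR a l) := by
    intro l hl
    unfold bb
    rw [dif_pos (by omega), j2]; rfl
  have hW : ∀ i, (WW n (F i)).map j = (Wp (phiR k (LL k n)) (F i) (fp n (aR a))).map (psM _) := by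
    intro i
    rw [Wp_map, Wp_map]
    have ex1 : j.comp (algebraMap k (LL k (n + 1))) = (psM (LL k n)).comp (phiR k (LL k n)) :=
      RingHom.ext (fun c => j1 c)
    have ex2 : (fp n (bb k n)).map j = (fp n (aR a)).map (psM (LL k n)) := by
      ext l
      simp only [coeff_map, fp_coeff]
      split_ifs with h
      · exact hjb l h
      · rw [map_zero, map_zero]
    rw [ex1, ex2]
  have hne : ∀ i, WW n (F i) ≠ 0 := by
    intro i h
    refine (generic_simple hn (bb_indep k n) (hm i) (hd i) (hirr i) (hsep i) (t := 0) ?_).2 ?_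
    · change eval 0 (WW n (F i)) = 0
      rw [h]; simp
    · change eval 0 (derivative (WW n (F i))) = 0
      rw [h]; simp
  have hlift : ∀ i x, ((WW n (F i)).map j).eval x = 0 → ∃ s, j s = x ∧ (WW n (F i)).eval s = 0 := by
    intro i x hx
    have hr : x ∈ ((WW n (F i)).map j).roots := by
      rw [mem_roots ((Polynomial.map_ne_zero_iff j.injective).2 (hne i))]; exact hx
    rw [(IsAlgClosed.splits (WW n (F i))).roots_map, Multiset.mem_map] at hr
    obtain ⟨s, hs1, hs2⟩ := hr
    exact ⟨s, hs2, isRoot_of_mem_roots hs1⟩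
  rw [← hW] at hdv
  obtain ⟨s1, hs1, r1⟩ := hlift i0 τ1 (eval_eq_zero_of_dvd_of_eval_eq_zero hdv (by simp))
  obtain ⟨s2, hs2, r2⟩ := hlift i0 τ2 (eval_eq_zero_of_dvd_of_eval_eq_zero hdv (by simp))
  refine ⟨ρ, s1, s2, ?_, ?_, ?_, ?_, ?_, r1, r2, ?_⟩
  · rintro rfl
    have h12 : τ1 = τ2 := hs1.symm.trans hs2
    obtain ⟨G, hG⟩ := hdv
    refine (generic_simple hn (bb_indep k n) (hm i0) (hd i0) (hirr i0) (hsep i0) r1).2 (j.injective ?_)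
    rw [map_zero, ← eval₂_hom, ← eval_map, ← derivative_map, hG, hs1, ← h12]
    simp
  · intro x hx
    have hx2 := alg_range j ((psM (LL k n)).comp PowerSeries.C) _
      (fun c => ⟨algebraMap k (LL k n) c, (j1 c).symm⟩) (by
        rintro _ ⟨l, hl, rfl⟩
        refine ⟨a l, ?_⟩
        rw [hjb l hl.2]
        unfold aR
        rw [if_neg (by have := hl.1; omega), add_zero]; rfl) hx
    obtain ⟨c, hc⟩ := hx2
    apply j.injective
    rw [j3, ← hc]
    exact σ.commutes _
  · apply j.injective
    rw [j3, hjb 0 (by omega)]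
    exact σ.commutes _
  · apply j.injective
    rw [j3, hs1, hs2]; exact e1
  · apply j.injective
    rw [j3, hs1, hs2]; exact e2
  · intro i x hx
    have := hfix i (j x) (by rw [← hW, eval_map, eval₂_hom, hx, map_zero])
    rcases this with h | ⟨h, h'⟩
    · left; apply j.injective; rw [j3]; exact h
    · right
      refine ⟨h, ?_⟩
      rw [← hs1, ← hs2] at h'
      exact h'.imp (fun h => j.injective h) (fun h => j.injective h)

end
end BH

namespace BH

section
variable {k κ : Type} [Field k] [Field κ] [Algebra k κ]

theorem cl_stable (φ : κ →+* κ) (hk : ∀ c : k, φ (algebraMap k κ c) = algebraMap k κ c) {s : Set κ}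
    (hs : ∀ x ∈ s, φ x = x) {x : κ} (hx : x ∈ cl k s) : φ x ∈ cl k s := by
  obtain ⟨P, hP, hPx⟩ := mem_cl_iff.1 hx
  have hA : ∀ y ∈ Algebra.adjoin k s, φ y = y := by
    intro y hy
    induction hy using Algebra.adjoin_induction with
    | mem x hx => exact hs x hx
    | algebraMap r => exact hk r
    | add x y _ _ h1 h2 => rw [map_add, h1, h2]
    | mul x y _ _ h1 h2 => rw [map_mul, h1, h2]
  have hfix : (P.map (algebraMap (Algebra.adjoin k s) κ)).map φ = P.map (algebraMap (Algebra.adjoin k s) κ) := by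
    ext i
    rw [coeff_map, coeff_map]
    exact hA _ (P.coeff i).2
  refine mem_cl_of_root (P := P.map (algebraMap (Algebra.adjoin k s) κ)) ?_ (fun i => ?_) ?_
  · rw [Ne, Polynomial.map_eq_zero_iff]
    · exact hP
    · exact Subtype.val_injective
  · rw [coeff_map]
    exact mem_cl_iff.2 (isAlgebraic_algebraMap _)
  · rw [← hfix, eval_map, eval₂_hom, eval_map, ← aeval_def, hPx, map_zero]

theorem move [IsAlgClosed k] [IsAlgClosed κ] {n : ℕ} (hn : 3 ≤ n) {b : ℕ → κ}
    (hb : AlgebraicIndependent k (fun l : Fin (n + 1) => b l))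
    (hall : ∀ y, y ∈ cl k (Set.range (fun l : Fin (n + 1) => b l)))
    {F : k[X][X]} (hm : F.Monic) (hd : 0 < F.natDegree) (hirr : Irreducible F) {t1 t1' t2 : κ}
    (h1 : (Wp (algebraMap k κ) F (fp n b)).eval t1 = 0)
    (h1' : (Wp (algebraMap k κ) F (fp n b)).eval t1' = 0)
    (h2 : (Wp (algebraMap k κ) F (fp n b)).eval t2 = 0) (h12 : t1 ≠ t2) (h12' : t1' ≠ t2) :
    ∃ γ : κ ≃+* κ, (∀ c : k, γ (algebraMap k κ c) = algebraMap k κ c) ∧ (∀ l ≤ n, γ (b l) = b l) ∧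
      γ t2 = t2 ∧ γ t1 = t1' := by
  let z : Fin n → κ := fun l => if (l : ℕ) = 0 then t2 else b (l + 1)
  let s : Set κ := Set.range z
  let h : κ[X] := fp n (fun l => if l < 2 then 0 else b l)
  have hf : ∀ t, (fp n b).eval t = b 0 + b 1 * t + h.eval t := by
    intro t
    have : fp n b = C (b 0) + C (b 1) * X + h := by
      ext i
      simp only [h]
      rw [coeff_add, coeff_add, coeff_C, coeff_C_mul, coeff_X, fp_coeff, fp_coeff]
      rcases (by omega : i = 0 ∨ i = 1 ∨ 2 ≤ i) with rfl | rfl | hi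
      · simp
      · simp; omega
      · rw [if_neg (by omega : ¬ i = 0), if_neg (by omega : ¬ 1 = i), if_neg (by omega : ¬ i < 2)]
        simp
    rw [this]; simp
  have ht2 : t2 ∈ cl k s := subset_cl s ⟨⟨0, by omega⟩, by simp [z]⟩
  have hbl : ∀ l, 2 ≤ l → l ≤ n → b l ∈ cl k s := by
    intro l h2 hl
    refine subset_cl s ⟨⟨l - 1, by omega⟩, ?_⟩
    simp only [z]
    rw [if_neg (by omega), show l - 1 + 1 = l by omega]
  have hhc : ∀ i, h.coeff i ∈ cl k s := by
    intro i
    simp only [h]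
    rw [fp_coeff]
    split_ifs with a1 a2
    · exact zero_mem _
    · exact hbl i (by omega) a1
    · exact zero_mem _
  rw [Wp_ee] at h1 h1' h2
  have hx2 : (fp n b).eval t2 ∈ cl k s := root_mem_cl hm ht2 h2
  have hh2 : h.eval t2 ∈ cl k s := eval_mem_cl _ ht2 hhc
  have key : ∀ t, ee t ((fp n b).eval t) F = 0 → t ≠ t2 → ∀ l ≤ n, b l ∈ cl k (insert t s) := by
    intro t ht htt l hl
    have hle : cl k s ≤ cl k (insert t s) := cl_mono (Set.subset_insert _ _)
    have ht' : t ∈ cl k (insert t s) := subset_cl _ (Set.mem_insert _ _)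
    have hx : (fp n b).eval t ∈ cl k (insert t s) := root_mem_cl hm ht' ht
    have hh : h.eval t ∈ cl k (insert t s) := eval_mem_cl _ ht' (fun i => hle (hhc i))
    have hb1 : b 1 ∈ cl k (insert t s) := by
      have : b 1 = ((fp n b).eval t - h.eval t - ((fp n b).eval t2 - h.eval t2)) / (t - t2) := by
        rw [eq_div_iff (sub_ne_zero.2 htt), hf, hf]; ring
      rw [this]
      exact div_mem (sub_mem (sub_mem hx hh) (sub_mem (hle hx2) (hle hh2))) (sub_mem ht' (hle ht2))
    rcases (by omega : l = 0 ∨ l = 1 ∨ 2 ≤ l) with rfl | rfl | h2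
    · have : b 0 = (fp n b).eval t - h.eval t - b 1 * t := by rw [hf]; ring
      rw [this]
      exact sub_mem (sub_mem hx hh) (mul_mem hb1 ht')
    · exact hb1
    · exact hle (hbl l h2 hl)
  have hnot : ∀ t, ee t ((fp n b).eval t) F = 0 → t ≠ t2 → t ∉ cl k s := by
    intro t ht htt hmem
    have h3 : ∀ l : Fin (n + 1), b l ∈ cl k s := fun l =>
      cl_le (Set.insert_subset hmem (subset_cl s)) (key t ht htt l (by omega))
    have := td_le hb h3
    simp at this
  have hal : ∀ t, ee t ((fp n b).eval t) F = 0 → t ≠ t2 → ∀ y, y ∈ cl k (insert t (cl k s : Set κ)) := by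
    intro t ht htt y
    refine cl_le ?_ (hall y)
    rintro _ ⟨l, rfl⟩
    exact cl_mono (Set.insert_subset_insert (subset_cl s)) (key t ht htt l (by omega))
  obtain ⟨γ, g1, g2, g3⟩ := one_step hm hd hirr (cl k s) (trans_cl (hnot t1 h1 h12))
    (trans_cl (hnot t1' h1' h12')) h1 h1' (hal t1 h1 h12) (hal t1' h1' h12')
  have gE : ∀ x ∈ cl k s, γ x = x := fun x hx => g1 ⟨x, hx⟩
  have gh : ∀ t, γ (h.eval t) = h.eval (γ t) := by
    intro t
    have : h.map (γ : κ →+* κ) = h := by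
      ext i
      rw [coeff_map]
      exact gE _ (hhc i)
    conv_rhs => rw [← this]
    rw [eval_map]
    exact (eval₂_hom (p := h) (γ : κ →+* κ) t).symm
  have gt2 := gE _ ht2
  have gb1 : γ (b 1) = b 1 := by
    have e0 : b 1 * (t1 - t2) = ((fp n b).eval t1 - h.eval t1 - ((fp n b).eval t2 - h.eval t2)) := by
      rw [hf, hf]; ring
    have e1 : b 1 * (t1' - t2) = ((fp n b).eval t1' - h.eval t1' - ((fp n b).eval t2 - h.eval t2)) := by
      rw [hf, hf]; ring
    have e2 := congrArg γ e0
    rw [map_mul, map_sub, map_sub, map_sub, map_sub, g2, g3, gh, g2, gt2, gE _ hx2, gE _ hh2, ← e1] at e2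
    exact mul_right_cancel₀ (sub_ne_zero.2 h12') e2
  have gb0 : γ (b 0) = b 0 := by
    have e0 : b 0 = (fp n b).eval t2 - h.eval t2 - b 1 * t2 := by rw [hf]; ring
    rw [e0, map_sub, map_sub, map_mul, gE _ hx2, gE _ hh2, gb1, gt2]
  refine ⟨γ, fun c => gE _ ((cl k s).algebraMap_mem c), ?_, gt2, g2⟩
  intro l hl
  rcases (by omega : l = 0 ∨ l = 1 ∨ 2 ≤ l) with rfl | rfl | h2
  · exact gb0
  · exact gb1
  · exact gE _ (hbl l h2 hl)

end

section
variable {k : Type} [Field k]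

theorem bb_all (n : ℕ) (y : LL k (n + 1)) : y ∈ cl k (Set.range (fun l : Fin (n + 1) => bb k n l)) := by
  set s := Set.range (fun l : Fin (n + 1) => bb k n l) with hs
  have h1 : ∀ P : MvPolynomial (Fin (n + 1)) k,
      algebraMap (KK k (n + 1)) (LL k (n + 1)) (algebraMap _ _ P) ∈ cl k s := by
    intro P
    induction P using MvPolynomial.induction_on with
    | C a => exact (cl k s).algebraMap_mem a
    | add p q hp hq => rw [map_add, map_add]; exact add_mem hp hq
    | mul_X p i hp =>
      rw [map_mul, map_mul]
      refine mul_mem hp (subset_cl s ⟨i, ?_⟩)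
      simp only [bb]
      rw [dif_pos i.2]; rfl
  have h2 : ∀ x : KK k (n + 1), algebraMap (KK k (n + 1)) (LL k (n + 1)) x ∈ cl k s := by
    intro x
    obtain ⟨p, q, -, rfl⟩ := IsFractionRing.div_surjective (A := MvPolynomial (Fin (n + 1)) k) x
    rw [map_div₀]
    exact div_mem (h1 p) (h1 q)
  obtain ⟨P, hP, hPy⟩ := (AlgebraicClosure.isAlgebraic (KK k (n + 1))).isAlgebraic y
  refine mem_cl_of_root (P := P.map (algebraMap (KK k (n + 1)) (LL k (n + 1)))) ?_ (fun i => ?_) ?_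
  · exact (Polynomial.map_ne_zero_iff (algebraMap (KK k (n + 1)) (LL k (n + 1))).injective).2 hP
  · rw [coeff_map]; exact h2 _
  · rw [eval_map, ← aeval_def, hPy]

theorem full_group [IsAlgClosed k] {n : ℕ} (hn : 3 ≤ n) {m : ℕ} {F : Fin m → k[X][X]} (hm : ∀ i, (F i).Monic)
    (hd : ∀ i, 0 < (F i).natDegree) (hirr : ∀ i, Irreducible (F i))
    (hsep : ∀ i, derivative (F i) ≠ 0) (hinj : Function.Injective F)
    (hs : ∀ i, ∀ j ≤ (F i).natDegree, ((F i).coeff j).natDegree ≤ ((F i).natDegree - j) * n)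
    {N : Fin m → ℕ} (τ : ∀ i, Fin (N i) → LL k (n + 1)) (hτ : ∀ i, Function.Injective (τ i))
    (hroot : ∀ i x, (WW n (F i)).eval x = 0 ↔ ∃ j, τ i j = x)
    (g : ∀ i, Equiv.Perm (Fin (N i))) :
    ∃ ρ : LL k (n + 1) →+* LL k (n + 1), (∀ x ∈ OM k n, ρ x = x) ∧ ρ (bb k n 0) = bb k n 0 ∧
      ∀ i j, ρ (τ i j) = τ i (g i j) := by
  classical
  let H0 : Submonoid (∀ i, Equiv.Perm (Fin (N i))) :=
    { carrier := {g | ∃ ρ : LL k (n + 1) →+* LL k (n + 1), (∀ x ∈ OM k n, ρ x = x) ∧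
        ρ (bb k n 0) = bb k n 0 ∧ ∀ i j, ρ (τ i j) = τ i (g i j)}
      one_mem' := ⟨RingHom.id _, fun _ _ => rfl, rfl, fun _ _ => rfl⟩
      mul_mem' := by
        rintro g g' ⟨ρ, r1, r2, r3⟩ ⟨ρ', r1', r2', r3'⟩
        refine ⟨ρ.comp ρ', fun x hx => ?_, ?_, fun i j => ?_⟩
        · rw [RingHom.comp_apply, r1' x hx, r1 x hx]
        · rw [RingHom.comp_apply, r2', r2]
        · rw [RingHom.comp_apply, r3', r3]; rfl }
  let H : Subgroup (∀ i, Equiv.Perm (Fin (N i))) :=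
    { H0 with
      inv_mem' := by
        intro x hx
        have h1 : x⁻¹ ∈ Submonoid.powers x :=
          mem_powers_iff_mem_zpowers.2 (inv_mem (Subgroup.mem_zpowers x))
        obtain ⟨e, he⟩ := h1
        simp only at he
        rw [← he]
        exact H0.pow_mem hx e }
  suffices h : g ∈ H from h
  have hmove : ∀ (i : Fin m) (a b c : Fin (N i)), Pi.mulSingle (M := fun i => Equiv.Perm (Fin (N i))) i (Equiv.swap a b) ∈ H → a ≠ b → c ≠ b →
      Pi.mulSingle (M := fun i => Equiv.Perm (Fin (N i))) i (Equiv.swap c b) ∈ H := by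
    rintro i0 a b c ⟨ρ, r1, r2, r3⟩ hab hcb
    obtain ⟨γ, g1, g2, g3, g4⟩ := move hn (bb_indep k n) (bb_all n) (hm i0) (hd i0) (hirr i0)
      ((hroot i0 _).2 ⟨a, rfl⟩) ((hroot i0 _).2 ⟨c, rfl⟩) ((hroot i0 _).2 ⟨b, rfl⟩)
      (fun h => hab (hτ i0 h)) (fun h => hcb (hτ i0 h))
    have gW : ∀ i, (WW n (F i)).map (γ : LL k (n + 1) →+* LL k (n + 1)) = WW n (F i) := by
      intro i
      rw [Wp_map]
      have ex1 : (γ : LL k (n + 1) →+* LL k (n + 1)).comp (algebraMap k (LL k (n + 1))) =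
        algebraMap k (LL k (n + 1)) := RingHom.ext g1
      have ex2 : (fp n (bb k n)).map (γ : LL k (n + 1) →+* LL k (n + 1)) = fp n (bb k n) := by
        ext l
        simp only [coeff_map, fp_coeff]
        split_ifs with h
        · exact g2 l h
        · rw [map_zero]
      rw [ex1, ex2]
    have hper : ∀ i j, ∃ j', τ i j' = γ (τ i j) := by
      intro i j
      rw [← hroot, ← gW i, eval_map]
      have := eval₂_hom (p := WW n (F i)) (γ : LL k (n + 1) →+* LL k (n + 1)) (τ i j)
      rw [(hroot i (τ i j)).2 ⟨j, rfl⟩, map_zero] at this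
      exact this
    choose π0 hπ0 using hper
    have hbij : ∀ i, Function.Bijective (π0 i) := by
      intro i
      rw [← Finite.injective_iff_bijective]
      intro x y hxy
      apply hτ i
      apply γ.injective
      rw [← hπ0, ← hπ0, hxy]
    let π : ∀ i, Equiv.Perm (Fin (N i)) := fun i => Equiv.ofBijective _ (hbij i)
    have hπ : ∀ i j, γ (τ i j) = τ i (π i j) := fun i j => (hπ0 i j).symm
    have hπ' : ∀ i j, γ.symm (τ i j) = τ i ((π i).symm j) := by
      intro i j
      rw [RingEquiv.symm_apply_eq, hπ, Equiv.apply_symm_apply]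
    have e1 : π i0 a = c := hτ i0 (by rw [← hπ, g4])
    have e2 : π i0 b = b := hτ i0 (by rw [← hπ, g3])
    refine ⟨(γ : LL k (n + 1) →+* LL k (n + 1)).comp (ρ.comp (γ.symm : LL k (n + 1) →+* LL k (n + 1))),
      fun x hx => ?_, ?_, fun i j => ?_⟩
    · have h1 : γ.symm x ∈ OM k n := by
        refine cl_stable (γ.symm : LL k (n + 1) →+* LL k (n + 1)) (fun c => ?_) ?_ hx
        · exact (RingEquiv.symm_apply_eq γ).2 (g1 c).symm
        · rintro _ ⟨l, hl, rfl⟩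
          exact (RingEquiv.symm_apply_eq γ).2 (g2 l hl.2).symm
      change γ (ρ (γ.symm x)) = x
      rw [r1 _ h1, RingEquiv.apply_symm_apply]
    · change γ (ρ (γ.symm _)) = _
      have : γ.symm (bb k n 0) = bb k n 0 := (RingEquiv.symm_apply_eq γ).2 (g2 0 (by omega)).symm
      rw [this, r2, g2 0 (by omega)]
    · change γ (ρ (γ.symm _)) = _
      rw [hπ', r3, hπ]
      congr 1
      by_cases hi : i = i0
      · subst hi
        rw [Pi.mulSingle_eq_same, Pi.mulSingle_eq_same]
        have := Equiv.mul_swap_eq_swap_mul (π i) a b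
        rw [e1, e2] at this
        have h5 := congrArg (fun p => p ((π i).symm j)) this
        simp only [Equiv.Perm.mul_apply, Equiv.apply_symm_apply] at h5
        exact h5
      · rw [Pi.mulSingle_eq_of_ne hi, Pi.mulSingle_eq_of_ne hi]
        simp
  have hswap0 : ∀ i0 : Fin m, ∃ a b : Fin (N i0), a ≠ b ∧ Pi.mulSingle (M := fun i => Equiv.Perm (Fin (N i))) i0 (Equiv.swap a b) ∈ H := by
    intro i0
    obtain ⟨ρ, s1, s2, hne, r1, r2, e1, e2, z1, z2, hfix⟩ := global_swap hn hm hd hirr hsep hinj hs i0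
    obtain ⟨a, rfl⟩ := (hroot i0 s1).1 z1
    obtain ⟨b, rfl⟩ := (hroot i0 s2).1 z2
    refine ⟨a, b, fun h => hne (by rw [h]), ρ, r1, r2, fun i j => ?_⟩
    by_cases hi : i = i0
    · subst hi
      rw [Pi.mulSingle_eq_same, Equiv.swap_apply_def]
      split_ifs with c1 c2
      · rw [c1, e1]
      · rw [c2, e2]
      · rcases hfix i (τ i j) ((hroot i _).2 ⟨j, rfl⟩) with h | ⟨-, h | h⟩
        · exact h
        · exact absurd (hτ i h) c1
        · exact absurd (hτ i h) c2
    · rw [Pi.mulSingle_eq_of_ne hi]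
      rcases hfix i (τ i j) ((hroot i _).2 ⟨j, rfl⟩) with h | ⟨h, -⟩
      · exact h
      · exact absurd h hi
  have hswap : ∀ (i0 : Fin m) (x y : Fin (N i0)), x ≠ y → Pi.mulSingle (M := fun i => Equiv.Perm (Fin (N i))) i0 (Equiv.swap x y) ∈ H := by
    intro i0 x y hxy
    obtain ⟨a, b, hab, h1⟩ := hswap0 i0
    by_cases hy : y = b
    · subst hy
      exact hmove i0 a y x h1 hab hxy
    · have h2 := hmove i0 a b y h1 hab hy
      rw [Equiv.swap_comm] at h2
      exact hmove i0 b y x h2 (Ne.symm hy) hxy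
  refine Subgroup.pi_mem_of_mulSingle_mem g (fun i => ?_)
  refine Equiv.Perm.swap_induction_on (motive := fun f => Pi.mulSingle (M := fun i => Equiv.Perm (Fin (N i))) i f ∈ H) (g i) ?_ ?_
  · rw [Pi.mulSingle_one]; exact H.one_mem
  · intro f x y hxy hf
    rw [Pi.mulSingle_mul]
    exact H.mul_mem (hswap i x y hxy) hf

end
end BH

namespace BH

/-- parameters `a_1, …, a_n` -/
abbrev RR (k : Type) [Field k] (n : ℕ) : Type := MvPolynomial (Fin n) k

section
variable {k : Type} [Field k]

/-- generic coefficients, `a_0` being the polynomial variable -/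
noncomputable def Agen (k : Type) [Field k] (n : ℕ) (l : ℕ) : (RR k n)[X] :=
  if l = 0 then X else if h : l - 1 < n then C (MvPolynomial.X ⟨l - 1, h⟩) else 0

noncomputable def kR (k : Type) [Field k] (n : ℕ) : k →+* (RR k n)[X] := C.comp MvPolynomial.C

noncomputable def wgen (n : ℕ) (F : k[X][X]) : (RR k n)[X][X] := Wp (kR k n) F (fp n (Agen k n))

noncomputable def lgen (n : ℕ) (F : k[X][X]) : (RR k n)[X] := eval₂ (kR k n) (Agen k n n) (Lam n F)

noncomputable def bgen {m : ℕ} (n : ℕ) (N : Fin m → ℕ) (F : Fin m → k[X][X]) (x : JJ N) : (RR k n)[X] :=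
  (wgen n (F x.1)).coeff x.2 * (lgen n (F x.1)) ^ (N x.1 - 1 - (x.2 : ℕ))

variable {B : Type} [CommRing B] {n : ℕ}

theorem fp_congr {A : Type} [CommRing A] {n : ℕ} {a b : ℕ → A} (h : ∀ l ≤ n, a l = b l) : fp n a = fp n b := by
  ext l
  rw [fp_coeff, fp_coeff]
  split_ifs with hl
  · exact h l hl
  · rfl

theorem wgen_map (h : (RR k n)[X] →+* B) {ψ : k →+* B} {a : ℕ → B} (hψ : h.comp (kR k n) = ψ)
    (ha : ∀ l ≤ n, h (Agen k n l) = a l) (F : k[X][X]) :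
    (wgen n F).map h = Wp ψ F (fp n a) ∧ h (lgen n F) = eval₂ ψ (a n) (Lam n F) := by
  subst hψ
  constructor
  · unfold wgen
    rw [Wp_map, fp_map]
    congr 1
    exact fp_congr ha
  · unfold lgen
    rw [hom_eval₂, ha n le_rfl]

theorem prod_scale {B : Type} [Field B] {N : ℕ} (t : Fin N → B) (Λ : B) (l : ℕ) :
    (∏ j, (X - C (Λ * t j))).coeff l = (∏ j, (X - C (t j))).coeff l * Λ ^ (N - l) := by
  have : ∀ s : Finset (Fin N), (∏ j ∈ s, (X - C (t j))).scaleRoots Λ = ∏ j ∈ s, (X - C (Λ * t j)) := by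
    intro s
    induction s using Finset.cons_induction with
    | empty => rw [Finset.prod_empty, Finset.prod_empty, ← C_1, scaleRoots_C]
    | cons a s ha ih =>
      rw [Finset.prod_cons, Finset.prod_cons, mul_scaleRoots_of_noZeroDivisors, ih, X_sub_C_scaleRoots, mul_comm Λ]
  rw [← this, coeff_scaleRoots, natDegree_finsetProd_X_sub_C_eq_card]
  simp

theorem cf_scale {B : Type} [Field B] {m : ℕ} {N : Fin m → ℕ} {F : Fin m → k[X][X]}
    (h : (RR k n)[X] →+* B) (t : ∀ i, Fin (N i) → B)
    (hw : ∀ i, (wgen n (F i)).map h = C (h (lgen n (F i))) * ∏ j, (X - C (t i j))) :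
    cf (fun i j => h (lgen n (F i)) * t i j) = fun x : JJ N => h (bgen n N F x) := by
  funext x
  obtain ⟨i, l⟩ := x
  unfold cf bgen
  simp only
  rw [prod_scale, map_mul, map_pow, ← coeff_map, hw, coeff_C_mul]
  have : N i - l = (N i - 1 - l) + 1 := by omega
  rw [this, pow_succ]
  ring

theorem multiset_fin {B : Type} [CommRing B] {N : ℕ} (s : Multiset B) (h4 : s.toList.length = N) :
    ∏ j : Fin N, (X - C (s.toList.get (Fin.cast h4.symm j))) = (s.map (fun x => X - C x)).prod := by
  conv_rhs => rw [← Multiset.coe_toList s, Multiset.map_coe, Multiset.prod_coe]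
  rw [← List.prod_ofFn]
  congr 1
  apply List.ext_get
  · simp [← h4]
  · intro i h1 h2
    simp

theorem roots_exist {B : Type} [Field B] [IsAlgClosed B] {ψ : k →+* B} {F : k[X][X]} {f : B[X]} {N : ℕ}
    (hs : ∀ j ≤ F.natDegree, (F.coeff j).natDegree ≤ (F.natDegree - j) * n) (hN : F.natDegree * n = N)
    (hf : f.natDegree ≤ n) (hne : eval₂ ψ (f.coeff n) (Lam n F) ≠ 0) :
    ∃ t : Fin N → B, Wp ψ F f = C (eval₂ ψ (f.coeff n) (Lam n F)) * ∏ j, (X - C (t j)) := by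
  set Λ := eval₂ ψ (f.coeff n) (Lam n F) with hΛ
  obtain ⟨h1, h2⟩ := scaled_monic (u := Λ⁻¹) hs hf (inv_mul_cancel₀ hne)
  have hsp := IsAlgClosed.splits (C Λ⁻¹ * Wp ψ F f)
  have h3 := hsp.eq_prod_roots_of_monic h1
  have h4 : (C Λ⁻¹ * Wp ψ F f).roots.toList.length = N := by
    rw [Multiset.length_toList, ← hsp.natDegree_eq_card_roots, h2, hN]
  refine ⟨fun j => (C Λ⁻¹ * Wp ψ F f).roots.toList.get (Fin.cast h4.symm j), ?_⟩
  have h5 : ∏ j : Fin N, (X - C ((C Λ⁻¹ * Wp ψ F f).roots.toList.get (Fin.cast h4.symm j)))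
      = C Λ⁻¹ * Wp ψ F f := by
    conv_rhs => rw [h3]
    exact multiset_fin _ h4
  rw [h5, ← mul_assoc, ← C_mul, mul_inv_cancel₀ hne]
  simp

end

end BH

namespace BH

theorem exists_c {k L : Type} [Field k] [Infinite k] [Field L] [Algebra k L] {m : ℕ} {N : Fin m → ℕ}
    (τ : ∀ i, Fin (N i) → L) (hτ : ∀ i, Function.Injective (τ i)) :
    ∃ c : JJ N → k, Function.Injective (fun g => lf (fun x => algebraMap k L (c x)) τ g) := by
  classical
  let T : (∀ i, Equiv.Perm (Fin (N i))) → (JJ N → k) →ₗ[k] L := fun g =>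
    ∑ x : JJ N, (LinearMap.toSpanSingleton k L (τ x.1 (g x.1 x.2))).comp (LinearMap.proj x)
  have hT : ∀ g c, T g c = lf (fun x => algebraMap k L (c x)) τ g := by
    intro g c
    simp [T, lf, Algebra.smul_def]
  let P : Finset ((∀ i, Equiv.Perm (Fin (N i))) × (∀ i, Equiv.Perm (Fin (N i)))) :=
    Finset.univ.filter fun p => p.1 ≠ p.2
  let Q : Finset (Submodule k (JJ N → k)) := P.image fun p => LinearMap.ker (T p.1 - T p.2)
  have hQ : (⊤ : Submodule k (JJ N → k)) ∉ Q := by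
    intro h
    simp only [Q, Finset.mem_image, P, Finset.mem_filter, Finset.mem_univ, true_and] at h
    obtain ⟨⟨g, h⟩, hne, hk⟩ := h
    apply hne
    funext i
    ext j
    simp only
    have h1 : Pi.single (M := fun _ => k) (⟨i, j⟩ : JJ N) 1 ∈ LinearMap.ker (T g - T h) := by rw [hk]; trivial
    rw [LinearMap.mem_ker, LinearMap.sub_apply, hT, hT, sub_eq_zero] at h1
    have h2 : ∀ g, lf (fun x => algebraMap k L (Pi.single (M := fun _ => k) (⟨i, j⟩ : JJ N) 1 x)) τ g = τ i (g i j) := by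
      intro g
      unfold lf
      rw [Finset.sum_eq_single (⟨i, j⟩ : JJ N)]
      · simp
      · intro b _ hb
        simp [Pi.single_eq_of_ne hb]
      · simp
    rw [h2, h2] at h1
    rw [hτ i h1]
  have h3 := Subspace.biUnion_ne_univ_of_top_notMem hQ
  rw [Set.ne_univ_iff_exists_notMem] at h3
  obtain ⟨c, hc⟩ := h3
  refine ⟨c, fun g h hgh => ?_⟩
  by_contra hne
  apply hc
  simp only [Set.mem_iUnion]
  refine ⟨LinearMap.ker (T g - T h), Finset.mem_image.2 ⟨(g, h), by simp [P, hne], rfl⟩, ?_⟩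
  simp only [SetLike.mem_coe, LinearMap.mem_ker, LinearMap.sub_apply, hT]
  exact sub_eq_zero.2 hgh

instance OM_closed {k : Type} [Field k] {n : ℕ} : IsAlgClosed (OM k n) := by
  apply IsAlgClosed.of_exists_root
  intro p hp hirr
  obtain ⟨x, hx⟩ := IsAlgClosed.exists_aeval_eq_zero (LL k (n + 1)) p (degree_pos_of_irreducible hirr).ne'
  have hx' : (p.map (algebraMap (OM k n) (LL k (n + 1)))).eval x = 0 := by rw [eval_map]; exact hx
  have hmem : x ∈ OM k n := mem_cl_of_root (s := bb k n '' Set.Icc 1 n)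
    ((Polynomial.map_ne_zero_iff (algebraMap (OM k n) (LL k (n + 1))).injective).2 hp.ne_zero)
    (fun i => by rw [coeff_map]; exact (p.coeff i).2) hx'
  refine ⟨⟨x, hmem⟩, ?_⟩
  apply (algebraMap (OM k n) (LL k (n + 1))).injective
  rw [← eval₂_at_apply, map_zero, ← eval_map]
  exact hx'

end BH

namespace BH

variable {k : Type} [Field k]

/-- the generic point, with values in the constants -/
noncomputable def phiO (k : Type) [Field k] (n : ℕ) : RR k n →+* OM k n :=
  (MvPolynomial.aeval (fun l : Fin n => (⟨bb k n (l + 1), subset_cl _ ⟨l + 1, ⟨by omega, by omega⟩, rfl⟩⟩ : OM k n))).toRingHom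

noncomputable def eO (k : Type) [Field k] (n : ℕ) : (OM k n)[X] →+* LL k (n + 1) :=
  eval₂RingHom (algebraMap (OM k n) (LL k (n + 1))) (bb k n 0)

noncomputable def hO (k : Type) [Field k] (n : ℕ) : (RR k n)[X] →+* LL k (n + 1) :=
  (eO k n).comp (mapRingHom (phiO k n))

theorem hO_k (n : ℕ) : (hO k n).comp (kR k n) = algebraMap k (LL k (n + 1)) := by
  ext c
  simp only [hO, eO, kR, phiO, RingHom.comp_apply, coe_mapRingHom, map_C, coe_eval₂RingHom, eval₂_C,
    AlgHom.toRingHom_eq_coe, RingHom.coe_coe, MvPolynomial.algHom_C]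
  rfl

theorem hO_A (n : ℕ) (l : ℕ) (hl : l ≤ n) : hO k n (Agen k n l) = bb k n l := by
  unfold Agen
  split_ifs with h1 h2
  · subst h1
    simp [hO, eO]
  · simp only [hO, eO, phiO, RingHom.comp_apply, coe_mapRingHom, map_C, coe_eval₂RingHom, eval₂_C,
      AlgHom.toRingHom_eq_coe, RingHom.coe_coe, MvPolynomial.aeval_X]
    have : l - 1 + 1 = l := by omega
    simp [this, IntermediateField.algebraMap_apply]
  · omega

theorem generic_irr [IsAlgClosed k] {n : ℕ} (hn : 3 ≤ n) {m : ℕ} {F : Fin m → k[X][X]} (hm : ∀ i, (F i).Monic)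
    (hd : ∀ i, 0 < (F i).natDegree) (hirr : ∀ i, Irreducible (F i))
    (hsep : ∀ i, derivative (F i) ≠ 0) (hinj : Function.Injective F)
    (hs : ∀ i, ∀ j ≤ (F i).natDegree, ((F i).coeff j).natDegree ≤ ((F i).natDegree - j) * n)
    {N : Fin m → ℕ} (hN : ∀ i, (F i).natDegree * n = N i)
    (U : (MvPolynomial (JJ N ⊕ JJ N) ℤ)[X]) (hU1 : U.Monic)
    (hU2 : U.natDegree = Fintype.card (∀ i, Equiv.Perm (Fin (N i))))
    (hU3 : ∀ (B : Type) [CommRing B] (c : JJ N → B) (τ : ∀ i, Fin (N i) → B),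
        U.map (zev (Sum.elim c (cf τ)))
          = ∏ g : ∀ i, Equiv.Perm (Fin (N i)), (X - C (lf c τ g))) :
    ∃ (c : JJ N → k),
      Irreducible ((U.map (zev (Sum.elim (fun x => kR k n (c x)) (bgen n N F)))).map (mapRingHom (phiO k n))) ∧
      (∀ i, hO k n (lgen n (F i)) ≠ 0) ∧ 
      ∃ y : (∀ i, Equiv.Perm (Fin (N i))) → LL k (n + 1), Function.Injective y ∧
        (U.map (zev (Sum.elim (fun x => kR k n (c x)) (bgen n N F)))).map (hO k n) = ∏ g, (X - C (y g)) := by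
  classical
  have hwg := fun i => wgen_map (hO k n) (hO_k n) (hO_A n) (F i)
  have hbn : bb k n n ∉ cl k (∅ : Set (LL k (n + 1))) := by
    have := notMem_cl' (bb_indep k n) (Fin.last n) ∅ (by simp)
    simpa using this
  have hΛ : ∀ i, hO k n (lgen n (F i)) ≠ 0 := by
    intro i
    rw [(hwg i).2]
    exact lam_ne (hm i) hbn
  have hex : ∀ i, ∃ t : Fin (N i) → LL k (n + 1), (wgen n (F i)).map (hO k n) = C (hO k n (lgen n (F i))) * ∏ j, (X - C (t j)) := by
    intro i
    have hcn : (fp n (bb k n)).coeff n = bb k n n := by rw [fp_coeff, if_pos le_rfl]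
    have := hΛ i
    rw [(hwg i).2, ← hcn] at this ⊢
    rw [(hwg i).1]
    exact roots_exist (hs i) (hN i) (fp_natDegree_le _) this
  choose t ht using hex
  have hprod : ∀ i, WW n (F i) = C (hO k n (lgen n (F i))) * ∏ j, (X - C (t i j)) := by
    intro i
    rw [← ht, (hwg i).1]
  have hroot : ∀ i x, (WW n (F i)).eval x = 0 ↔ ∃ j, t i j = x := by
    intro i x
    rw [hprod, eval_mul, eval_C, mul_eq_zero, or_iff_right (hΛ i), eval_prod, Finset.prod_eq_zero_iff]
    simp [sub_eq_zero, eq_comm]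
  have htinj : ∀ i, Function.Injective (t i) := by
    intro i j1 j2 hj
    by_contra hne
    have h0 : (WW n (F i)).eval (t i j1) = 0 := (hroot i _).2 ⟨j1, rfl⟩
    apply (generic_simple hn (bb_indep k n) (hm i) (hd i) (hirr i) (hsep i) h0).2
    change (derivative (WW n (F i))).eval _ = 0
    have hdv : (X - C (t i j1)) ^ 2 ∣ WW n (F i) := by
      rw [hprod]
      apply Dvd.dvd.mul_left
      rw [← Finset.mul_prod_erase _ _ (Finset.mem_univ j1),
        ← Finset.mul_prod_erase _ _ (Finset.mem_erase.2 ⟨Ne.symm hne, Finset.mem_univ j2⟩), ← hj, ← mul_assoc, ← sq]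
      exact dvd_mul_right _ _
    obtain ⟨q, hq⟩ := hdv
    rw [hq, sq, derivative_mul, derivative_mul]
    simp
  have hsinj : ∀ i, Function.Injective (fun j => hO k n (lgen n (F i)) * t i j) := fun i a b hab =>
    htinj i (mul_left_cancel₀ (hΛ i) hab)
  have : Infinite k := IsAlgClosed.instInfinite
  obtain ⟨c, hc⟩ := exists_c (k := k) _ hsinj
  set Θ := U.map (zev (Sum.elim (fun x => kR k n (c x)) (bgen n N F))) with hΘ
  set y := fun g => lf (fun x => algebraMap k (LL k (n + 1)) (c x)) (fun i j => hO k n (lgen n (F i)) * t i j) g with hy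
  have hmap : Θ.map (hO k n) = ∏ g, (X - C (y g)) := by
    rw [hΘ, Polynomial.map_map, ← hU3, cf_scale _ _ ht]
    congr 1
    apply MvPolynomial.ringHom_ext
    · intro r; simp
    · intro x
      rw [RingHom.comp_apply, zev_X, zev_X]
      rcases x with x | x
      · simp only [Sum.elim_inl]
        exact congrArg (fun f => f (c x)) (hO_k n)
      · simp
  refine ⟨c, ?_, hΛ, y, hc, hmap⟩
  have hΘm : Θ.Monic := hU1.map _
  have hΘd : Θ.natDegree = Fintype.card (∀ i, Equiv.Perm (Fin (N i))) := by
    rw [hΘ, hU1.natDegree_map, hU2]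
  have hmap' : (Θ.map (mapRingHom (phiO k n))).map (eO k n) = ∏ g, (X - C (y g)) := by
    rw [← hmap, Polynomial.map_map]; rfl
  have key : ∀ f : (OM k n)[X][X], f.Monic → ∀ g0, (f.map (eO k n)).eval (y g0) = 0 →
      Fintype.card (∀ i, Equiv.Perm (Fin (N i))) ≤ f.natDegree := by
    intro f hf g0 h0
    have hall : ∀ h, (f.map (eO k n)).eval (y h) = 0 := by
      intro h
      obtain ⟨ρ, h1, h2, h3⟩ := full_group hn hm hd hirr hsep hinj hs t htinj hroot (h * g0⁻¹)
      have he : ρ.comp (eO k n) = eO k n := by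
        ext
        · simp [eO]
          exact h1 _ (SetLike.coe_mem _)
        · simp [eO, h2]
      have hk : ρ.comp (algebraMap k (LL k (n + 1))) = algebraMap k (LL k (n + 1)) := by
        ext a
        exact h1 _ (IntermediateField.algebraMap_mem _ a)
      have hρΛ : ∀ i, ρ (hO k n (lgen n (F i))) = hO k n (lgen n (F i)) := by
        intro i
        rw [(hwg i).2, hom_eval₂, hk, h1]
        exact subset_cl _ ⟨n, ⟨by omega, le_rfl⟩, rfl⟩
      have hρy : ρ (y g0) = y h := by
        simp only [hy, lf, map_sum, map_mul, hρΛ, h3]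
        refine Finset.sum_congr rfl fun x _ => ?_
        have : ρ (algebraMap k (LL k (n + 1)) (c x)) = algebraMap k (LL k (n + 1)) (c x) :=
          congrArg (fun f => f (c x)) hk
        rw [this]
        simp
      rw [← hρy, ← he, ← Polynomial.map_map, eval_map, eval₂_at_apply, h0, map_zero]
    have hne : f.map (eO k n) ≠ 0 := (hf.map _).ne_zero
    have hsub : (Finset.univ.image y) ⊆ (f.map (eO k n)).roots.toFinset := by
      intro z hz
      obtain ⟨g, _, rfl⟩ := Finset.mem_image.1 hz
      rw [Multiset.mem_toFinset, mem_roots hne]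
      exact hall g
    have := Finset.card_le_card hsub
    rw [Finset.card_image_of_injective _ hc, Finset.card_univ] at this
    refine this.trans ((Multiset.toFinset_card_le _).trans ((card_roots' _).trans natDegree_map_le))
  rw [(hΘm.map _).irreducible_iff_natDegree]
  have hd' : (Θ.map (mapRingHom (phiO k n))).natDegree = Fintype.card (∀ i, Equiv.Perm (Fin (N i))) := by
    rw [hΘm.natDegree_map, hΘd]
  refine ⟨fun h1 => ?_, fun f g hf hg hfg => ?_⟩
  · rw [h1, natDegree_one] at hd'
    exact Fintype.card_ne_zero hd'.symm
  · have hsum : f.natDegree + g.natDegree = Fintype.card (∀ i, Equiv.Perm (Fin (N i))) := by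
      rw [← hf.natDegree_mul hg, hfg, hd']
    have h0 : (f.map (eO k n)).eval (y 1) * (g.map (eO k n)).eval (y 1) = 0 := by
      rw [← eval_mul, ← Polynomial.map_mul, hfg, hmap', eval_prod]
      exact Finset.prod_eq_zero (Finset.mem_univ 1) (by simp)
    rcases mul_eq_zero.1 h0 with h0 | h0
    · have := key f hf 1 h0
      omega
    · have := key g hg 1 h0
      omega

end BH

namespace BH

section
variable {k : Type} [Field k] {n : ℕ}

/-- bounded in both kinds of variables -/
def Bd (e : ℕ) (P : (RR k n)[X]) : Prop := P.natDegree ≤ e ∧ ∀ i, (P.coeff i).totalDegree ≤ e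

theorem Bd.mono {e e' : ℕ} (h : e ≤ e') {P : (RR k n)[X]} (hP : Bd e P) : Bd e' P :=
  ⟨hP.1.trans h, fun i => (hP.2 i).trans h⟩

theorem Bd_zero (e : ℕ) : Bd e (0 : (RR k n)[X]) := ⟨by simp, fun i => by simp⟩

theorem Bd_kR (c : k) : Bd 0 (kR k n c) := by
  constructor
  · simp [kR]
  · intro i
    simp only [kR, RingHom.comp_apply, coeff_C]
    split_ifs <;> simp

theorem Bd_one : Bd 0 (1 : (RR k n)[X]) := by simpa using Bd_kR (n := n) (1 : k)

theorem Bd_int (z : ℤ) : Bd 0 (z : (RR k n)[X]) := by simpa using Bd_kR (n := n) (z : k)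

theorem Bd.add {e : ℕ} {P Q : (RR k n)[X]} (hP : Bd e P) (hQ : Bd e Q) : Bd e (P + Q) := by
  refine ⟨natDegree_add_le_of_degree_le hP.1 hQ.1, fun i => ?_⟩
  rw [coeff_add]
  exact (MvPolynomial.totalDegree_add _ _).trans (max_le (hP.2 i) (hQ.2 i))

theorem Bd_sum {ι : Type} {e : ℕ} (s : Finset ι) {P : ι → (RR k n)[X]} (hP : ∀ i ∈ s, Bd e (P i)) :
    Bd e (∑ i ∈ s, P i) := by
  classical
  induction s using Finset.cons_induction with
  | empty => exact Bd_zero e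
  | cons a s ha ih =>
    rw [Finset.sum_cons]
    exact (hP a (by simp)).add (ih fun i hi => hP i (by simp [hi]))

theorem Bd.mul {e e' : ℕ} {P Q : (RR k n)[X]} (hP : Bd e P) (hQ : Bd e' Q) : Bd (e + e') (P * Q) := by
  refine ⟨natDegree_mul_le_of_le hP.1 hQ.1, fun i => ?_⟩
  rw [coeff_mul]
  refine MvPolynomial.totalDegree_finsetSum_le fun x _ => ?_
  exact (MvPolynomial.totalDegree_mul _ _).trans (add_le_add (hP.2 _) (hQ.2 _))

theorem Bd.pow {e : ℕ} {P : (RR k n)[X]} (hP : Bd e P) (j : ℕ) : Bd (j * e) (P ^ j) := by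
  induction j with
  | zero => simpa using Bd_one
  | succ j ih =>
    rw [pow_succ, add_mul, one_mul]
    exact ih.mul hP

theorem Bd_prod {ι : Type} {e : ι → ℕ} (s : Finset ι) {P : ι → (RR k n)[X]} (hP : ∀ i ∈ s, Bd (e i) (P i)) :
    Bd (∑ i ∈ s, e i) (∏ i ∈ s, P i) := by
  classical
  induction s using Finset.cons_induction with
  | empty => exact Bd_one
  | cons a s ha ih =>
    rw [Finset.sum_cons, Finset.prod_cons]
    exact (hP a (by simp)).mul (ih fun i hi => hP i (by simp [hi]))

theorem Bd_Agen (l : ℕ) : Bd 1 (Agen k n l) := by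
  unfold Agen
  split_ifs with h1 h2
  · refine ⟨natDegree_X_le, fun i => ?_⟩
    rw [coeff_X]
    split_ifs <;> simp
  · refine ⟨by simp, fun i => ?_⟩
    rw [coeff_C]
    split_ifs <;> simp
  · exact Bd_zero 1

/-- coefficientwise bound -/
def BD (e : ℕ) (P : (RR k n)[X][X]) : Prop := ∀ s, Bd e (P.coeff s)

theorem BD.mul {e e' : ℕ} {P Q : (RR k n)[X][X]} (hP : BD e P) (hQ : BD e' Q) : BD (e + e') (P * Q) := by
  intro s
  rw [coeff_mul]
  exact Bd_sum _ fun x _ => (hP _).mul (hQ _)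

theorem BD.pow {e : ℕ} {P : (RR k n)[X][X]} (hP : BD e P) (j : ℕ) : BD (j * e) (P ^ j) := by
  induction j with
  | zero =>
    intro s
    rw [pow_zero, coeff_one]
    split_ifs
    · simpa using Bd_one
    · exact Bd_zero _
  | succ j ih =>
    rw [pow_succ, add_mul, one_mul]
    exact ih.mul hP

theorem BD_wgen (F : k[X][X]) : BD F.natDegree (wgen n F) := by
  unfold wgen Wp
  rw [eval₂_eq_sum_range]
  intro s
  rw [finsetSum_coeff]
  refine Bd_sum _ fun j hj => ?_
  have hj' : j ≤ F.natDegree := by simpa [Nat.lt_succ_iff] using hj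
  have h1 : BD 0 (mapRingHom (kR k n) (F.coeff j)) := by
    intro s
    rw [coe_mapRingHom, coeff_map]
    exact Bd_kR _
  have h2 : BD 1 (fp n (Agen k n)) := by
    intro s
    rw [fp_coeff]
    split_ifs
    · exact Bd_Agen _
    · exact Bd_zero _
  exact (h1.mul (h2.pow j) s).mono (by omega)

theorem Bd_lgen {F : k[X][X]} (hm : F.Monic) : Bd F.natDegree (lgen n F) := by
  unfold lgen
  rw [eval₂_eq_sum_range, (Lam_monic hm).2]
  refine Bd_sum _ fun j hj => ?_
  have hj' : j ≤ F.natDegree := by simpa [Nat.lt_succ_iff] using hj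
  exact ((Bd_kR _).mul ((Bd_Agen n).pow j)).mono (by omega)

theorem Bd_bgen {m : ℕ} {N : Fin m → ℕ} {F : Fin m → k[X][X]} (hm : ∀ i, (F i).Monic) (E : ℕ)
    (hE : ∀ i, (F i).natDegree + N i * (F i).natDegree ≤ E) (x : JJ N) : Bd E (bgen n N F x) := by
  refine ((BD_wgen (F x.1) x.2).mul ((Bd_lgen (hm x.1)).pow _)).mono ((Nat.add_le_add_left ?_ _).trans (hE x.1))
  exact Nat.mul_le_mul_right _ (by omega)

theorem Bd_zev {σ : Type} {E d : ℕ} {v : σ → (RR k n)[X]} (hv : ∀ x, Bd E (v x)) (P : MvPolynomial σ ℤ)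
    (hP : P.totalDegree ≤ d) : Bd (d * E) (zev v P) := by
  unfold zev
  rw [MvPolynomial.coe_eval₂Hom, MvPolynomial.eval₂_eq]
  refine Bd_sum _ fun s hs => ?_
  have h1 : ∑ i ∈ s.support, s i ≤ d := (MvPolynomial.le_totalDegree hs).trans hP
  have h2 := (Bd_int (k := k) (n := n) (P.coeff s)).mul (Bd_prod s.support (e := fun i => s i * E) fun i _ => (hv i).pow (s i))
  refine h2.mono ?_
  rw [zero_add, ← Finset.sum_mul]
  exact Nat.mul_le_mul_right _ h1

theorem exists_deg {σ : Type} (U : (MvPolynomial σ ℤ)[X]) : ∃ d, ∀ s, (U.coeff s).totalDegree ≤ d := by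
  refine ⟨∑ s ∈ U.support, (U.coeff s).totalDegree, fun s => ?_⟩
  by_cases h : s ∈ U.support
  · exact Finset.single_le_sum (f := fun s => (U.coeff s).totalDegree) (fun _ _ => Nat.zero_le _) h
  · rw [notMem_support_iff.1 h]
    simp

end

end BH

namespace BH

theorem disc_iff {R B ι : Type} [CommRing R] [Field B] [Fintype ι] (U : R[X]) (hU : U.Monic) (φ : R →+* B) (y : ι → B)
    (h : U.map φ = ∏ g, (X - C (y g))) :
    φ (resultant U (derivative U) U.natDegree U.natDegree) ≠ 0 ↔ Function.Injective y := by
  classical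
  have h1 : φ (resultant U (derivative U) U.natDegree U.natDegree)
      = ∏ g, (derivative (U.map φ)).eval (y g) := by
    rw [← resultant_map_map]
    conv_lhs => rw [← hU.natDegree_map φ]
    rw [← derivative_map, resultant_eq_prod_eval]
    · rw [(hU.map φ).leadingCoeff, one_pow, one_mul]
      have hr : (U.map φ).roots = Finset.univ.val.map y := by
        rw [h]
        have : ∏ g, (X - C (y g)) = ((Finset.univ.val.map y).map fun a => X - C a).prod := by
          rw [Multiset.map_map]; rfl
        rw [this, roots_multiset_prod_X_sub_C]
      rw [hr, Multiset.map_map]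
      rfl
    · exact (natDegree_derivative_le _).trans (Nat.sub_le _ _)
    · rw [h]
      exact Splits.prod fun _ _ => Splits.X_sub_C _
  have h2 : ∀ g, (derivative (U.map φ)).eval (y g) = ∏ h ∈ Finset.univ.erase g, (y g - y h) := by
    intro g
    rw [h, derivative_prod_finset, eval_finsetSum, Finset.sum_eq_single g]
    · simp [eval_prod]
    · intro b _ hb
      rw [eval_mul, eval_prod, Finset.prod_eq_zero (i := g)]
      · simp
      · simp [hb.symm]
      · simp
    · simp
  rw [h1, Finset.prod_ne_zero_iff]
  constructor
  · intro h3 a b hab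
    by_contra hne
    refine h3 a (Finset.mem_univ a) ?_
    rw [h2]
    exact Finset.prod_eq_zero (Finset.mem_erase.2 ⟨Ne.symm hne, Finset.mem_univ b⟩) (by rw [hab, sub_self])
  · intro h3 g _
    rw [h2, Finset.prod_ne_zero_iff]
    intro h hh
    rw [sub_ne_zero]
    exact fun he => (Finset.mem_erase.1 hh).1 (h3 he).symm

theorem good_Q {m n : ℕ} (hn : 3 ≤ n) (r : Fin m → ℕ) (hr0 : ∀ i, 0 < r i) {N : Fin m → ℕ} (hN : ∀ i, r i * n = N i)
    (U : (MvPolynomial (JJ N ⊕ JJ N) ℤ)[X]) (hU1 : U.Monic)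
    (hU2 : U.natDegree = Fintype.card (∀ i, Equiv.Perm (Fin (N i))))
    (hU3 : ∀ (B : Type) [CommRing B] (c : JJ N → B) (τ : ∀ i, Fin (N i) → B),
        U.map (zev (Sum.elim c (cf τ)))
          = ∏ g : ∀ i, Equiv.Perm (Fin (N i)), (X - C (lf c τ g))) :
    ∃ E e Eb : ℕ, ∀ (k : Type) [Field k] [IsAlgClosed k] (F : Fin m → k[X][X]), (∀ i, (F i).Monic) →
      (∀ i, (F i).natDegree = r i) → (∀ i, Irreducible (F i)) → (∀ i, derivative (F i) ≠ 0) →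
      Function.Injective F →
      (∀ i, ∀ j ≤ (F i).natDegree, ((F i).coeff j).natDegree ≤ ((F i).natDegree - j) * n) →
      (∀ x, Bd Eb (bgen n N F x)) ∧
      ∃ (c : JJ N → k) (Q : RR k n), Q ≠ 0 ∧ Q.totalDegree ≤ E ∧ ∀ a0 : Fin n → k, MvPolynomial.eval a0 Q ≠ 0 →
        a0 ⟨n - 1, by omega⟩ ≠ 0 ∧
        (∀ i, (Lam n (F i)).eval (a0 ⟨n - 1, by omega⟩) ≠ 0) ∧
        Irreducible (U.map (zev (Sum.elim (fun x => C (c x)) (fun x => (bgen n N F x).map (MvPolynomial.eval a0))))) ∧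
        ∃ bad : Finset k, bad.card ≤ e ∧ ∀ u ∉ bad, ∀ y : (∀ i, Equiv.Perm (Fin (N i))) → k,
          (U.map (zev (Sum.elim (fun x => C (c x)) (fun x => (bgen n N F x).map (MvPolynomial.eval a0))))).map (evalRingHom u)
            = ∏ g, (X - C (y g)) → Function.Injective y := by
  classical
  obtain ⟨dU, hdU⟩ := exists_deg U
  obtain ⟨Eb, hEb⟩ : ∃ Eb, Eb = ∑ i, (r i + N i * r i) := ⟨_, rfl⟩
  obtain ⟨Δ, hΔ⟩ : ∃ Δ, Δ = resultant U (derivative U) U.natDegree U.natDegree := ⟨_, rfl⟩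
  obtain ⟨E1, hE1⟩ := bertini_noether (Fintype.card (∀ i, Equiv.Perm (Fin (N i)))) (dU * Eb) (dU * Eb) Fintype.card_pos
  refine ⟨E1 + Δ.totalDegree * Eb + (∑ i, r i) + 1, Δ.totalDegree * Eb, Eb, ?_⟩
  intro k _ _ F hm hr hirr hsep hinj hs
  have hbg : ∀ x, Bd Eb (bgen n N F x) := by
    refine Bd_bgen hm Eb fun i => ?_
    rw [hr, hEb]
    exact Finset.single_le_sum (f := fun i => r i + N i * r i) (fun _ _ => Nat.zero_le _) (Finset.mem_univ i)
  refine ⟨hbg, ?_⟩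
  obtain ⟨c, h1, h2, y0, h3, h4⟩ := generic_irr hn hm (fun i => by rw [hr]; exact hr0 i) hirr hsep hinj hs
    (fun i => by rw [hr, hN]) U hU1 hU2 hU3
  obtain ⟨v, hv⟩ : ∃ v : JJ N ⊕ JJ N → (RR k n)[X], v = Sum.elim (fun x => kR k n (c x)) (bgen n N F) := ⟨_, rfl⟩
  rw [← hv] at h1 h4
  have hvB : ∀ x, Bd Eb (v x) := by
    intro x
    rw [hv]
    rcases x with x | x
    · exact (Bd_kR _).mono (Nat.zero_le _)
    · exact hbg x
  have hΘB : ∀ s, Bd (dU * Eb) ((U.map (zev v)).coeff s) := by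
    intro s
    rw [coeff_map]
    exact Bd_zev hvB _ (hdU s)
  obtain ⟨Q1, hQ1, hQ1d, hQ1i⟩ := hE1 k (Fin n) (U.map (zev v)) (hU1.map _) (by rw [hU1.natDegree_map, hU2])
    (fun s => (hΘB s).1) (fun s i => (hΘB s).2 i) (OM k n) (phiO k n) h1
  -- discriminant
  have hδB : Bd (Δ.totalDegree * Eb) (zev v Δ) := Bd_zev hvB _ le_rfl
  have hδ0 : zev v Δ ≠ 0 := by
    intro h
    rw [Polynomial.map_map] at h4
    have := (disc_iff U hU1 _ y0 h4).2 h3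
    rw [← hΔ, RingHom.comp_apply, h, map_zero] at this
    exact this rfl
  obtain ⟨i0, hi0⟩ : ∃ i0, (zev v Δ).coeff i0 ≠ 0 := by
    by_contra hcon
    push Not at hcon
    exact hδ0 (Polynomial.ext fun i => by simpa using hcon i)
  -- leading coefficients
  let xn : RR k n := MvPolynomial.X ⟨n - 1, by omega⟩
  let lg : Fin m → RR k n := fun i => eval₂ MvPolynomial.C xn (Lam n (F i))
  have hlg : ∀ i, lgen n (F i) = C (lg i) := by
    intro i
    have hA : Agen k n n = C xn := by
      unfold Agen
      rw [if_neg (by omega), dif_pos (by omega)]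
    simp only [lgen, lg, kR]
    rw [hom_eval₂, hA]
  have hlg0 : ∀ i, lg i ≠ 0 := by
    intro i h
    apply h2 i
    rw [hlg, h]
    simp
  have hlgd : ∀ i, (lg i).totalDegree ≤ r i := by
    intro i
    have := (Bd_lgen (n := n) (hm i)).2 0
    rwa [hlg, coeff_C_zero, hr] at this
  refine ⟨c, Q1 * (zev v Δ).coeff i0 * (∏ i, lg i) * xn, ?_, ?_, ?_⟩
  · have hQ10 : Q1 ≠ 0 := by rintro rfl; simp at hQ1
    exact mul_ne_zero (mul_ne_zero (mul_ne_zero hQ10 hi0) (Finset.prod_ne_zero_iff.2 fun i _ => hlg0 i))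
      (MvPolynomial.X_ne_zero _)
  · have e1 := MvPolynomial.totalDegree_mul (Q1 * (zev v Δ).coeff i0 * (∏ i, lg i)) xn
    have e2 := MvPolynomial.totalDegree_mul (Q1 * (zev v Δ).coeff i0) (∏ i, lg i)
    have e3 := MvPolynomial.totalDegree_mul Q1 ((zev v Δ).coeff i0)
    have e4 := hδB.2 i0
    have e5 : (∏ i, lg i).totalDegree ≤ ∑ i, r i :=
      (MvPolynomial.totalDegree_finsetProd _ _).trans (Finset.sum_le_sum fun i _ => hlgd i)
    have e6 : xn.totalDegree ≤ 1 := by simp [xn]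
    omega
  · intro a0 ha0
    rw [map_mul, map_mul, map_mul] at ha0
    have g1 := right_ne_zero_of_mul ha0
    have g2 := right_ne_zero_of_mul (left_ne_zero_of_mul ha0)
    have g3 := left_ne_zero_of_mul (left_ne_zero_of_mul (left_ne_zero_of_mul ha0))
    have g4 := right_ne_zero_of_mul (left_ne_zero_of_mul (left_ne_zero_of_mul ha0))
    have hxn : MvPolynomial.eval a0 xn = a0 ⟨n - 1, by omega⟩ := by simp [xn]
    have hcomp : (mapRingHom (MvPolynomial.eval a0)).comp (zev v)
        = zev (Sum.elim (fun x => C (c x)) (fun x => (bgen n N F x).map (MvPolynomial.eval a0))) := by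
      apply MvPolynomial.ringHom_ext
      · intro r; simp
      · intro x
        rw [RingHom.comp_apply, zev_X, zev_X, hv]
        rcases x with x | x
        · simp [kR]
        · simp
    refine ⟨by rwa [← hxn], ?_, ?_, ?_⟩
    · intro i
      rw [map_prod, Finset.prod_ne_zero_iff] at g2
      have := g2 i (Finset.mem_univ i)
      simp only [lg] at this
      rw [hom_eval₂, hxn] at this
      convert this using 1
      rw [← eval₂_id]
      congr 1
      ext; simp
    · have := hQ1i k (MvPolynomial.eval a0) g3
      rwa [Polynomial.map_map, hcomp] at this
    · have hne : (zev v Δ).map (MvPolynomial.eval a0) ≠ 0 := by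
        intro h
        apply g4
        rw [← coeff_map, h, coeff_zero]
      refine ⟨((zev v Δ).map (MvPolynomial.eval a0)).roots.toFinset, ?_, ?_⟩
      · exact (Multiset.toFinset_card_le _).trans ((card_roots' _).trans (natDegree_map_le.trans hδB.1))
      · intro u hu y hy
        rw [Multiset.mem_toFinset, mem_roots hne] at hu
        rw [Polynomial.map_map] at hy
        refine (disc_iff U hU1 _ y hy).1 ?_
        rw [← hΔ, ← hcomp]
        exact hu

end BH

namespace BH

theorem natDegree_zev {k σ : Type} [Field k] {E d : ℕ} {v : σ → k[X]} (hv : ∀ x, (v x).natDegree ≤ E)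
    (P : MvPolynomial σ ℤ) (hP : P.totalDegree ≤ d) : (zev v P).natDegree ≤ d * E := by
  unfold zev
  rw [MvPolynomial.coe_eval₂Hom, MvPolynomial.eval₂_eq]
  refine natDegree_sum_le_of_forall_le _ _ fun s hs => ?_
  have h1 : ∑ i ∈ s.support, s i ≤ d := (MvPolynomial.le_totalDegree hs).trans hP
  refine natDegree_mul_le.trans ?_
  have h2 : (∏ i ∈ s.support, v i ^ s i).natDegree ≤ ∑ i ∈ s.support, s i * E :=
    (natDegree_prod_le _ _).trans (Finset.sum_le_sum fun i _ => natDegree_pow_le_of_le _ (hv i))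
  have h3 : (Int.castRingHom k[X] (P.coeff s)).natDegree = 0 := by simp
  rw [h3, zero_add]
  refine h2.trans ?_
  rw [← Finset.sum_mul]
  exact Nat.mul_le_mul_right _ h1

theorem line_sigma {m : ℕ} {N : Fin m → ℕ}
    (U : (MvPolynomial (JJ N ⊕ JJ N) ℤ)[X]) (V : (MvPolynomial (JJ N ⊕ JJ N ⊕ JJ N) ℤ)[X]) (hU1 : U.Monic)
    (hU2 : U.natDegree = Fintype.card (∀ i, Equiv.Perm (Fin (N i))))
    (hU3 : ∀ (B : Type) [CommRing B] (c : JJ N → B) (τ : ∀ i, Fin (N i) → B),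
        U.map (zev (Sum.elim c (cf τ)))
          = ∏ g : ∀ i, Equiv.Perm (Fin (N i)), (X - C (lf c τ g)))
    (hV : ∀ (B : Type) [CommRing B] (c c' : JJ N → B) (τ : ∀ i, Fin (N i) → B),
        V.map (zev (Sum.elim c (Sum.elim c' (cf τ))))
          = ∑ g : ∀ i, Equiv.Perm (Fin (N i)), C (lf c' τ g) *
            ∏ h ∈ Finset.univ.erase g, (X - C (lf c τ h))) (Eb : ℕ) :
    ∃ Cst : ℝ, 0 ≤ Cst ∧ ∀ (k : Type) [Field k] [IsAlgClosed k] (p : ℕ) [Fact p.Prime] [CharP k p] (α : ℕ), α ≠ 0 →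
    ∀ (c : JJ N → k) (β : JJ N → k[X]), (∀ x, (β x).natDegree ≤ Eb) →
    Irreducible (U.map (zev (Sum.elim (fun x => C (c x)) β))) →
    ∀ (G : Finset k) (τ : k → ∀ i, Fin (N i) → k) (π : k → ∀ i, Equiv.Perm (Fin (N i))),
    (∀ u ∈ G, u ^ (p ^ α) = u ∧ (∀ x, cf (τ u) x = (β x).eval u) ∧ Function.Injective (fun g => lf c (τ u) g) ∧
      ∀ i j, (τ u i j) ^ (p ^ α) = τ u i (π u i j)) →
    ∀ σ : ∀ i, Equiv.Perm (Fin (N i)),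
    ((((G ×ˢ Finset.univ).filter fun ug : k × (∀ i, Equiv.Perm (Fin (N i))) => π ug.1 * ug.2 = ug.2 * σ).card : ℕ) : ℝ)
      ≤ ((p ^ α : ℕ) : ℝ) + Cst * Real.sqrt ((p ^ α : ℕ) : ℝ) := by
  classical
  obtain ⟨dU, hdU⟩ := exists_deg U
  obtain ⟨dV, hdV⟩ := exists_deg V
  obtain ⟨Cst, hC0, hC⟩ := stepanov (Fintype.card (∀ i, Equiv.Perm (Fin (N i)))) (dU * Eb)
    (dV * Eb + (dU * Eb) * V.natDegree) Fintype.card_pos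
  refine ⟨Cst, hC0, ?_⟩
  intro k _ _ p _ _ α hα c β hβ hirr G τ π hG σ
  set q := p ^ α with hq
  have hdm : (U.map (zev (Sum.elim (fun x => C (c x)) β))).natDegree = Fintype.card (∀ i, Equiv.Perm (Fin (N i))) := by
    rw [hU1.natDegree_map, hU2]
  let c' : JJ N → k := fun x => (c ⟨x.1, (σ x.1)⁻¹ x.2⟩) ^ q
  let f : k × (∀ i, Equiv.Perm (Fin (N i))) → k × k := fun ug => (ug.1, lf c (τ ug.1) ug.2)
  set A := (G ×ˢ Finset.univ).filter fun ug : k × (∀ i, Equiv.Perm (Fin (N i))) => π ug.1 * ug.2 = ug.2 * σ with hA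
  have hfi : Set.InjOn f A := by
    rintro ⟨u, g⟩ h1 ⟨u', g'⟩ h2 he
    simp only [f, Prod.mk.injEq] at he
    obtain ⟨rfl, he⟩ := he
    have hu : u ∈ G := by
      have := (Finset.mem_filter.1 (Finset.mem_coe.1 h1)).1
      exact (Finset.mem_product.1 this).1
    rw [(hG u hu).2.2.1 he]
  rw [← Finset.card_image_of_injOn hfi]
  refine hC k p α hα _ (V.map (zev (Sum.elim (fun x => C (c x)) (Sum.elim (fun x => C (c' x)) β)))) (hU1.map _) hdm ?_ ?_ hirr _ ?_
  · rw [mem_Wt]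
    intro s i hsi
    by_cases hs : s = Fintype.card (∀ i, Equiv.Perm (Fin (N i)))
    · subst hs
      rw [← hdm, (hU1.map _).coeff_natDegree, coeff_one] at hsi
      split_ifs at hsi with h
      · omega
      · exact absurd rfl hsi
    · have hs2 : s ≤ Fintype.card (∀ i, Equiv.Perm (Fin (N i))) := by
        rw [← hdm]
        apply le_natDegree_of_ne_zero
        intro h
        rw [h] at hsi
        simp at hsi
      have hi : i ≤ dU * Eb := by
        refine (le_natDegree_of_ne_zero hsi).trans ?_
        rw [coeff_map]
        refine natDegree_zev (fun x => ?_) _ (hdU s)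
        rcases x with x | x
        · simp
        · simpa using hβ x
      have hs3 : s + 1 ≤ Fintype.card (∀ i, Equiv.Perm (Fin (N i))) := by omega
      calc i + dU * Eb * s ≤ dU * Eb + dU * Eb * s := by omega
        _ = dU * Eb * (s + 1) := by ring
        _ ≤ _ := Nat.mul_le_mul_left _ hs3
  · rw [mem_Wt]
    intro s i hsi
    have hs2 : s ≤ V.natDegree := by
      refine le_trans ?_ (natDegree_map_le (f := (zev (Sum.elim (fun x => C (c x)) (Sum.elim (fun x => C (c' x)) β)))) (p := V))
      apply le_natDegree_of_ne_zero
      intro h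
      rw [h] at hsi
      simp at hsi
    have hi : i ≤ dV * Eb := by
      refine (le_natDegree_of_ne_zero hsi).trans ?_
      rw [coeff_map]
      refine natDegree_zev (fun x => ?_) _ (hdV s)
      rcases x with x | x | x
      · simp
      · simp
      · simpa using hβ x
    exact add_le_add hi (Nat.mul_le_mul_left _ hs2)
  · intro P hP
    obtain ⟨⟨u, g⟩, hug, rfl⟩ := Finset.mem_image.1 hP
    obtain ⟨h1, h2⟩ := Finset.mem_filter.1 hug
    have hu := (Finset.mem_product.1 h1).1
    simp only at hu h2
    obtain ⟨e1, e2, e3, e4⟩ := hG u hu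
    have hUs : (U.map (zev (Sum.elim (fun x => C (c x)) β))).map (evalRingHom u) = ∏ h, (X - C (lf c (τ u) h)) := by
      rw [← hU3, Polynomial.map_map]
      congr 1
      apply MvPolynomial.ringHom_ext
      · intro r; simp
      · intro x
        rw [RingHom.comp_apply, zev_X, zev_X]
        rcases x with x | x
        · simp
        · simp [e2]
    have hVs : (V.map (zev (Sum.elim (fun x => C (c x)) (Sum.elim (fun x => C (c' x)) β)))).map (evalRingHom u)
        = ∑ g : ∀ i, Equiv.Perm (Fin (N i)), C (lf c' (τ u) g) *
            ∏ h ∈ Finset.univ.erase g, (X - C (lf c (τ u) h)) := by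
      rw [← hV, Polynomial.map_map]
      congr 1
      apply MvPolynomial.ringHom_ext
      · intro r; simp
      · intro x
        rw [RingHom.comp_apply, zev_X, zev_X]
        rcases x with x | x | x
        · simp
        · simp
        · simp [e2]
    have hee : ∀ P : k[X][X], ∀ y, P.evalEval u y = (P.map (evalRingHom u)).eval y := by
      intro P y
      rw [← Polynomial.map_evalRingHom_eval]
    simp only [f]
    rw [hee, hee, hee, ← derivative_map, hUs, hVs]
    have hder : (derivative (∏ h, (X - C (lf c (τ u) h)))).eval (lf c (τ u) g)
        = ∏ h ∈ Finset.univ.erase g, (lf c (τ u) g - lf c (τ u) h) := by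
      rw [derivative_prod_finset, eval_finsetSum, Finset.sum_eq_single g]
      · simp [eval_prod]
      · intro b _ hb
        rw [eval_mul, eval_prod, Finset.prod_eq_zero (i := g)]
        · simp
        · simp [hb.symm]
        · simp
      · simp
    refine ⟨e1, ?_, ?_, ?_⟩
    · rw [eval_prod]
      exact Finset.prod_eq_zero (Finset.mem_univ g) (by simp)
    · rw [hder, Finset.prod_ne_zero_iff]
      intro h hh
      rw [sub_ne_zero]
      intro he
      exact (Finset.mem_erase.1 hh).1 (e3 he).symm
    · rw [hder, eval_finsetSum, Finset.sum_eq_single g]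
      · rw [eval_mul, eval_C, eval_prod, mul_comm]
        simp only [eval_sub, eval_X, eval_C]
        congr 1
        have hfrob : (lf c (τ u) g) ^ q = ∑ x : JJ N, c x ^ q * τ u x.1 (π u x.1 (g x.1 x.2)) := by
          unfold lf
          rw [hq, sum_pow_char_pow]
          refine Finset.sum_congr rfl fun x _ => ?_
          rw [mul_pow, e4]
        rw [hfrob]
        unfold lf
        let eσ : JJ N ≃ JJ N := Equiv.sigmaCongrRight σ
        rw [← Equiv.sum_comp eσ (fun x => c' x * τ u x.1 (g x.1 x.2))]
        refine Finset.sum_congr rfl fun x _ => ?_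
        obtain ⟨i, j⟩ := x
        have h3 : π u i (g i j) = g i (σ i j) := by
          have := congrFun h2 i
          exact congrArg (fun e => e j) this
        have h4 : c' (eσ ⟨i, j⟩) = c ⟨i, j⟩ ^ q := by
          change (c ⟨i, (σ i)⁻¹ (σ i j)⟩) ^ q = _
          have h5 : (σ i)⁻¹ (σ i j) = j := by simp
          rw [h5]
        change c ⟨i, j⟩ ^ q * τ u i (π u i (g i j)) = c' (eσ ⟨i, j⟩) * τ u i (g i (σ i j))
        rw [h4, h3]
      · intro b _ hb
        rw [eval_mul, eval_prod, Finset.prod_eq_zero (i := g)]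
        · simp
        · simp [hb.symm]
        · simp
      · simp

theorem conj_count {k S : Type} [Group S] [Fintype S] [DecidableEq k] [DecidableEq S] (G : Finset k) (π : k → S) (K : ℝ)
    (hK : ∀ σ : S, ((((G ×ˢ Finset.univ).filter fun ug : k × S => π ug.1 * ug.2 = ug.2 * σ).card : ℕ) : ℝ) ≤ K)
    (T : Finset S) (hT : ∀ g σ, σ ∈ T → g⁻¹ * σ * g ∈ T) :
    ((G.filter fun u => π u ∈ T).card : ℝ) * Fintype.card S ≤ T.card * K := by
  have hsub : (G.filter fun u => π u ∈ T) ×ˢ (Finset.univ : Finset S) ⊆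
      T.biUnion fun σ => (G ×ˢ Finset.univ).filter fun ug : k × S => π ug.1 * ug.2 = ug.2 * σ := by
    rintro ⟨u, g⟩ h
    simp only [Finset.mem_product, Finset.mem_filter, Finset.mem_univ, and_true] at h
    simp only [Finset.mem_biUnion, Finset.mem_product, Finset.mem_filter, Finset.mem_univ, and_true]
    exact ⟨g⁻¹ * π u * g, hT g _ h.2, h.1, by group⟩
  have h1 := (Finset.card_le_card hsub).trans Finset.card_biUnion_le
  rw [Finset.card_product, Finset.card_univ] at h1
  calc ((G.filter fun u => π u ∈ T).card : ℝ) * Fintype.card S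
      ≤ ∑ σ ∈ T, ((((G ×ˢ Finset.univ).filter fun ug : k × S => π ug.1 * ug.2 = ug.2 * σ).card : ℕ) : ℝ) := by
        exact_mod_cast h1
    _ ≤ ∑ σ ∈ T, K := Finset.sum_le_sum fun σ _ => hK σ
    _ = T.card * K := by simp

theorem two_sided {k S : Type} [Group S] [Fintype S] [DecidableEq k] [DecidableEq S] (G : Finset k) (π : k → S)
    (q e Cst : ℝ) (hC : 0 ≤ Cst) (hG : q - e ≤ G.card) (he : 0 ≤ e)
    (hK : ∀ σ : S, ((((G ×ˢ Finset.univ).filter fun ug : k × S => π ug.1 * ug.2 = ug.2 * σ).card : ℕ) : ℝ) ≤ q + Cst)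
    (T : Finset S) (hT : ∀ g σ, σ ∈ T ↔ g⁻¹ * σ * g ∈ T) :
    |((G.filter fun u => π u ∈ T).card : ℝ) - T.card / Fintype.card S * q| ≤ e + Cst := by
  have hS : (0 : ℝ) < Fintype.card S := by exact_mod_cast Fintype.card_pos
  have h1 := conj_count G π _ hK T fun g σ h => (hT g σ).1 h
  have h2 := conj_count G π _ hK Tᶜ fun g σ h => by
    rw [Finset.mem_compl] at h ⊢
    exact fun h' => h ((hT g σ).2 h')
  have h3 : ((G.filter fun u => π u ∈ T).card : ℝ) + (G.filter fun u => π u ∈ Tᶜ).card = G.card := by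
    have := Finset.card_filter_add_card_filter_not (s := G) (fun u => π u ∈ T)
    simp only [Finset.mem_compl]
    exact_mod_cast this
  have h4 : (Tᶜ.card : ℝ) = Fintype.card S - T.card := by
    rw [Finset.card_compl, Nat.cast_sub (Finset.card_le_univ T)]
  have h5 : (T.card : ℝ) ≤ Fintype.card S := by exact_mod_cast Finset.card_le_univ T
  rw [h4] at h2
  set s : ℝ := (Fintype.card S : ℝ)
  set x : ℝ := ((G.filter fun u => π u ∈ T).card : ℝ)
  set y : ℝ := ((G.filter fun u => π u ∈ Tᶜ).card : ℝ)
  set t : ℝ := (T.card : ℝ) with ht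
  have ht0 : 0 ≤ t := by positivity
  clear_value s x y t
  have h6 : x ≤ t / s * (q + Cst) := by
    rw [div_mul_eq_mul_div, le_div_iff₀ hS]; linarith
  have h7 : y ≤ (1 - t / s) * (q + Cst) := by
    have : (1 - t / s) * (q + Cst) = (s - t) * (q + Cst) / s := by field_simp
    rw [this, le_div_iff₀ hS]; linarith
  have h8 : t / s ≤ 1 := by rw [div_le_one hS]; exact h5
  have h9 : 0 ≤ t / s := by positivity
  have h10 : t / s * Cst ≤ Cst := by
    have := mul_le_mul_of_nonneg_right h8 hC
    linarith
  have h11 : 0 ≤ t / s * Cst := by positivity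
  rw [abs_le]
  constructor <;> linarith

end BH

namespace BH

variable {Fq k : Type} [Field Fq] [Fintype Fq] [Field k] [Algebra Fq k]

theorem fixed_field {x : k} (hx : x ^ Fintype.card Fq = x) : ∃ y : Fq, algebraMap Fq k y = x := by
  have h : (∏ a : Fq, (X - C a)) = X ^ Fintype.card Fq - X := by
    have h1 : 1 < Fintype.card Fq := Fintype.one_lt_card
    have hd := FiniteField.X_pow_card_sub_X_natDegree_eq Fq h1
    have hmon : (X ^ Fintype.card Fq - X : Fq[X]).Monic := monic_X_pow_sub (by simpa using h1)
    have := prod_multiset_X_sub_C_of_monic_of_roots_card_eq hmon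
      (by rw [hd, FiniteField.roots_X_pow_card_sub_X]; simp)
    rw [FiniteField.roots_X_pow_card_sub_X] at this
    exact this
  have h1 := congrArg (fun p : Fq[X] => aeval x p) h
  simp only [map_prod, map_sub, aeval_X, aeval_C, map_pow, hx, sub_self] at h1
  obtain ⟨a, _, ha⟩ := Finset.prod_eq_zero_iff.1 h1
  exact ⟨a, (sub_eq_zero.1 ha).symm⟩

theorem pow_iter {ι : Type} {t : ι → k} {π : Equiv.Perm ι} (hπ : ∀ j, t j ^ Fintype.card Fq = t (π j)) (i : ℕ) (j : ι) :
    t ((π ^ i) j) = t j ^ (Fintype.card Fq) ^ i := by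
  induction i with
  | zero => simp
  | succ i ih => rw [pow_succ', Equiv.Perm.mul_apply, ← hπ, ih, ← pow_mul, pow_succ]

theorem orbit_poly {ι : Type} {t : ι → k} (ht : Function.Injective t) {π : Equiv.Perm ι}
    (hπ : ∀ j, t j ^ Fintype.card Fq = t (π j)) (O : Finset ι) (hne : O.Nonempty)
    (hst : ∀ j ∈ O, π j ∈ O) (htr : ∀ a ∈ O, ∀ b ∈ O, ∃ i : ℕ, (π ^ i) a = b) :
    ∃ P : Fq[X], P.Monic ∧ Irreducible P ∧ P.natDegree = O.card ∧
      P.map (algebraMap Fq k) = ∏ j ∈ O, (X - C (t j)) := by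
  classical
  set φ : k →+* k := (FiniteField.frobeniusAlgHom Fq k : k →ₐ[Fq] k).toRingHom with hφ
  have hφa : ∀ x, φ x = x ^ Fintype.card Fq := fun x => rfl
  set R : k[X] := ∏ j ∈ O, (X - C (t j)) with hR
  have hRm : R.Monic := monic_prod_of_monic _ _ fun j _ => monic_X_sub_C _
  have hRd : R.natDegree = O.card := by
    rw [hR, natDegree_prod_of_monic _ _ fun j _ => monic_X_sub_C _]; simp
  have hOm : O.map π.toEmbedding = O := by
    apply Finset.eq_of_subset_of_card_le
    · intro x hx
      obtain ⟨j, hj, rfl⟩ := Finset.mem_map.1 hx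
      exact hst j hj
    · simp
  have hRφ : R.map φ = R := by
    have h1 : R.map φ = ∏ j ∈ O, (X - C (t (π j))) := by
      simp only [hR, Polynomial.map_prod, Polynomial.map_sub, map_X, map_C, hφa, hπ]
    rw [h1, hR]
    conv_rhs => rw [← hOm, Finset.prod_map]
    rfl
  have hlift : R ∈ lifts (algebraMap Fq k) := by
    rw [lifts_iff_coeff_lifts]
    intro i
    have : (R.coeff i) ^ Fintype.card Fq = R.coeff i := by
      rw [← hφa, ← coeff_map, hRφ]
    obtain ⟨y, hy⟩ := fixed_field (Fq := Fq) this
    exact ⟨y, hy⟩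
  obtain ⟨P, hP, hPd, hPm⟩ := lifts_and_natDegree_eq_and_monic hlift hRm
  refine ⟨P, hPm, ?_, by rw [hPd, hRd], hP⟩
  obtain ⟨j0, hj0⟩ := hne
  have hroot : aeval (t j0) P = 0 := by
    rw [aeval_def, ← eval_map, hP, hR, eval_prod]
    exact Finset.prod_eq_zero hj0 (by simp)
  have hintg : IsIntegral Fq (t j0) := ⟨P, hPm, hroot⟩
  set μ := minpoly Fq (t j0) with hμ
  have hdvd : μ ∣ P := minpoly.dvd _ _ hroot
  have hμr : ∀ j ∈ O, (μ.map (algebraMap Fq k)).eval (t j) = 0 := by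
    intro j hj
    obtain ⟨i, hi⟩ := htr j0 hj0 j hj
    rw [eval_map, ← aeval_def, ← hi, pow_iter hπ]
    have : ∀ i : ℕ, aeval (t j0 ^ (Fintype.card Fq) ^ i) μ = 0 := by
      intro i
      induction i with
      | zero => simp [hμ]
      | succ i ih =>
        have h2 := Polynomial.aeval_algHom_apply (FiniteField.frobeniusAlgHom Fq k) (t j0 ^ (Fintype.card Fq) ^ i) μ
        rw [ih, map_zero] at h2
        rw [pow_succ, pow_mul]
        exact h2
    exact this i
  have hμm : μ.Monic := minpoly.monic hintg
  have hRμ : R ∣ μ.map (algebraMap Fq k) := by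
    apply Finset.prod_dvd_of_coprime
    · intro a _ b _ hab
      exact isCoprime_X_sub_C_of_isUnit_sub (sub_ne_zero.2 fun h => hab (ht h)).isUnit
    · intro j hj
      exact dvd_iff_isRoot.2 (hμr j hj)
  have hle : P.natDegree ≤ μ.natDegree := by
    rw [hPd, ← hμm.natDegree_map (algebraMap Fq k)]
    exact natDegree_le_of_dvd hRμ (hμm.map _).ne_zero
  have : P = μ := by
    symm
    exact (Polynomial.eq_of_monic_of_dvd_of_natDegree_le hμm hPm hdvd hle).symm
  rw [this]
  exact minpoly.irreducible hintg

theorem factors_cycle {N : ℕ} {t : Fin N → k} (ht : Function.Injective t) {π : Equiv.Perm (Fin N)}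
    (hπ : ∀ j, t j ^ Fintype.card Fq = t (π j)) {w : Fq[X]} {l : k} (hl : l ≠ 0)
    (hw : w.map (algebraMap Fq k) = C l * ∏ j, (X - C (t j))) :
    (UniqueFactorizationMonoid.factors w).map natDegree =
      π.cycleType + Multiset.replicate (N - π.support.card) 1 := by
  classical
  have hPex : ∀ O : Finset (Fin N), ∃ P : Fq[X], O.Nonempty → (∀ j ∈ O, π j ∈ O) →
      (∀ a ∈ O, ∀ b ∈ O, ∃ i : ℕ, (π ^ i) a = b) → Irreducible P ∧ P.natDegree = O.card ∧
      P.map (algebraMap Fq k) = ∏ j ∈ O, (X - C (t j)) := by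
    intro O
    by_cases h : O.Nonempty ∧ (∀ j ∈ O, π j ∈ O) ∧ (∀ a ∈ O, ∀ b ∈ O, ∃ i : ℕ, (π ^ i) a = b)
    · obtain ⟨P, _, h2, h3, h4⟩ := orbit_poly ht hπ O h.1 h.2.1 h.2.2
      exact ⟨P, fun _ _ _ => ⟨h2, h3, h4⟩⟩
    · exact ⟨0, fun h1 h2 h3 => absurd ⟨h1, h2, h3⟩ h⟩
  choose P hP using hPex
  have hc : ∀ c ∈ π.cycleFactorsFinset, Irreducible (P c.support) ∧ (P c.support).natDegree = c.support.card ∧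
      (P c.support).map (algebraMap Fq k) = ∏ j ∈ c.support, (X - C (t j)) := by
    intro c hcm
    have hc' := Equiv.Perm.mem_cycleFactorsFinset_iff.1 hcm
    have hon := Equiv.Perm.isCycleOn_support_of_mem_cycleFactorsFinset hcm
    apply hP
    · exact hc'.1.nonempty_support
    · intro j hj
      rw [← hc'.2 j hj]
      exact Equiv.Perm.apply_mem_support.2 hj
    · intro a ha b hb
      obtain ⟨i, _, hi⟩ := (hon.2 ha hb).exists_pow_eq'
      exact ⟨i, hi⟩
  have hf : ∀ j ∈ π.supportᶜ, Irreducible (P {j}) ∧ (P {j}).natDegree = 1 ∧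
      (P {j}).map (algebraMap Fq k) = X - C (t j) := by
    intro j hj
    have hj' : π j = j := by simpa using hj
    have := hP {j} (by simp) (by simp [hj']) (by
      intro a ha b hb
      rw [Finset.mem_singleton] at ha hb
      exact ⟨0, by simp [ha, hb]⟩)
    simpa using this
  have hsupp : π.support = π.cycleFactorsFinset.biUnion fun c => c.support := by
    ext x
    simp only [Finset.mem_biUnion]
    rw [Equiv.Perm.mem_support_iff_mem_support_of_mem_cycleFactorsFinset]
  set fs : Multiset Fq[X] := π.cycleFactorsFinset.val.map (fun c => P c.support) +
    π.supportᶜ.val.map (fun j => P {j}) with hfs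
  have hfsirr : ∀ x ∈ fs, Irreducible x := by
    intro x hx
    rw [hfs, Multiset.mem_add, Multiset.mem_map, Multiset.mem_map] at hx
    rcases hx with ⟨c, hc1, rfl⟩ | ⟨j, hj, rfl⟩
    · exact (hc c hc1).1
    · exact (hf j hj).1
  have hprod : fs.prod.map (algebraMap Fq k) = ∏ j, (X - C (t j)) := by
    have h1 : fs.prod = (∏ c ∈ π.cycleFactorsFinset, P c.support) * ∏ j ∈ π.supportᶜ, P {j} := by
      rw [hfs, Multiset.prod_add]; rfl
    rw [h1, Polynomial.map_mul, Polynomial.map_prod, Polynomial.map_prod,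
      Finset.prod_congr rfl fun c h => (hc c h).2.2, Finset.prod_congr rfl fun j h => (hf j h).2.2,
      ← Finset.prod_biUnion, ← hsupp, Finset.prod_mul_prod_compl]
    intro c hc1 c' hc2 hne
    exact Equiv.Perm.disjoint_iff_disjoint_support.1
      (Equiv.Perm.cycleFactorsFinset_pairwise_disjoint π hc1 hc2 hne)
  have hinj : Function.Injective (Polynomial.map (algebraMap Fq k)) :=
    Polynomial.map_injective _ (algebraMap Fq k).injective
  have hw0 : w ≠ 0 := by
    rintro rfl
    rw [Polynomial.map_zero] at hw
    have := hw.symm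
    rw [mul_eq_zero, C_eq_zero] at this
    rcases this with h | h
    · exact hl h
    · exact (monic_prod_of_monic _ _ fun j _ => monic_X_sub_C _).ne_zero h
  have hwl : w = C w.leadingCoeff * fs.prod := by
    apply hinj
    rw [Polynomial.map_mul, map_C, hprod, hw]
    have h1 : algebraMap Fq k w.leadingCoeff = l := by
      rw [← leadingCoeff_map, hw, leadingCoeff_mul, leadingCoeff_C,
        (monic_prod_of_monic _ _ fun j _ => monic_X_sub_C _).leadingCoeff, mul_one]
    rw [h1]
  have hass : Associated (UniqueFactorizationMonoid.factors w).prod fs.prod := by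
    refine (UniqueFactorizationMonoid.factors_prod hw0).trans ?_
    conv_lhs => rw [hwl]
    have : IsUnit (C w.leadingCoeff) := isUnit_C.2 (leadingCoeff_ne_zero.2 hw0).isUnit
    exact (associated_unit_mul_left _ _ this)
  have hrel := UniqueFactorizationMonoid.factors_unique
    (fun x hx => UniqueFactorizationMonoid.irreducible_of_factor x hx) hfsirr hass
  have hmap : (UniqueFactorizationMonoid.factors w).map natDegree = fs.map natDegree := by
    rw [← Multiset.rel_eq, Multiset.rel_map]
    refine hrel.mono fun a _ b _ hab => ?_
    exact natDegree_eq_of_degree_eq (degree_eq_degree_of_associated hab)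
  rw [hmap, hfs, Multiset.map_add, Multiset.map_map, Multiset.map_map]
  congr 1
  · rw [Equiv.Perm.cycleType_def]
    apply Multiset.map_congr rfl
    intro c h
    exact (hc c h).2.1
  · have h1 : π.supportᶜ.val.map (natDegree ∘ fun j => P {j}) = π.supportᶜ.val.map (fun _ => 1) := by
      apply Multiset.map_congr rfl
      intro j h
      exact (hf j h).2.1
    rw [h1, Multiset.map_const', Finset.card_val, Finset.card_compl, Fintype.card_fin]

theorem factors_iff {N : ℕ} {t : Fin N → k} (ht : Function.Injective t) {π : Equiv.Perm (Fin N)}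
    (hπ : ∀ j, t j ^ Fintype.card Fq = t (π j)) {w : Fq[X]} {l : k} (hl : l ≠ 0)
    (hw : w.map (algebraMap Fq k) = C l * ∏ j, (X - C (t j))) {M : Multiset ℕ} (hM : ∀ a ∈ M, 1 ≤ a)
    (hMs : M.sum = N) :
    (UniqueFactorizationMonoid.factors w).map natDegree = M ↔
      π.cycleType = M.filter (fun a => 2 ≤ a) := by
  rw [factors_cycle ht hπ hl hw]
  have hct : π.cycleType.filter (fun a => 2 ≤ a) = π.cycleType :=
    Multiset.filter_eq_self.2 fun a ha => Equiv.Perm.two_le_of_mem_cycleType ha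
  constructor
  · rintro rfl
    rw [Multiset.filter_add, hct]
    have : (Multiset.replicate (N - π.support.card) 1).filter (fun a => 2 ≤ a) = 0 := by
      rw [Multiset.filter_eq_nil]
      intro a ha
      rw [Multiset.eq_of_mem_replicate ha]; norm_num
    rw [this, add_zero]
  · intro h
    have h1 := Multiset.filter_add_not (fun a => 2 ≤ a) M
    have h2 : M.filter (fun a => ¬ 2 ≤ a) = Multiset.replicate (M.filter (fun a => ¬ 2 ≤ a)).card 1 := by
      rw [Multiset.eq_replicate_card]
      intro b hb
      have h3 := (Multiset.mem_filter.1 hb)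
      have := hM b h3.1
      omega
    have h4 := congrArg Multiset.sum h1
    rw [Multiset.sum_add, h2, hMs, Multiset.sum_replicate, ← h, Equiv.Perm.sum_cycleType] at h4
    rw [smul_eq_mul, mul_one] at h4
    rw [← h1, h2, ← h]
    congr 2
    omega

theorem frob_perm {N : ℕ} {t : Fin N → k} (ht : Function.Injective t) {w : Fq[X]} {l : k} (hl : l ≠ 0)
    (hw : w.map (algebraMap Fq k) = C l * ∏ j, (X - C (t j))) :
    ∃ π : Equiv.Perm (Fin N), ∀ j, t j ^ Fintype.card Fq = t (π j) := by
  have h1 : ∀ j, ∃ j', t j ^ Fintype.card Fq = t j' := by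
    intro j
    have h2 := Polynomial.aeval_algHom_apply (FiniteField.frobeniusAlgHom Fq k) (t j) w
    have h3 : aeval (t j) w = 0 := by
      rw [aeval_def, ← eval_map, hw, eval_mul, eval_prod, Finset.prod_eq_zero (Finset.mem_univ j) (by simp), mul_zero]
    rw [h3, map_zero] at h2
    change aeval (t j ^ Fintype.card Fq) w = 0 at h2
    rw [aeval_def, ← eval_map, hw, eval_mul, eval_prod, eval_C, mul_eq_zero, Finset.prod_eq_zero_iff] at h2
    obtain ⟨j', _, h4⟩ := h2.resolve_left hl
    exact ⟨j', by simpa [sub_eq_zero] using h4⟩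
  choose f hf using h1
  have hfi : Function.Injective f := by
    intro a b hab
    apply ht
    apply (FiniteField.frobeniusAlgHom Fq k).toRingHom.injective
    change t a ^ Fintype.card Fq = t b ^ Fintype.card Fq
    rw [hf, hf, hab]
  exact ⟨Equiv.ofBijective f (Finite.injective_iff_bijective.1 hfi), hf⟩

end BH

namespace BH

/-- coefficients of the polynomial attached to `u` and `a` -/
def ac {A : Type} [Zero A] {n : ℕ} (u : A) (a : Fin n → A) (l : ℕ) : A :=
  if l = 0 then u else if h : l - 1 < n then a ⟨l - 1, h⟩ else 0

theorem point_data {m n : ℕ} (hn : 3 ≤ n) {N : Fin m → ℕ}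
    (U : (MvPolynomial (JJ N ⊕ JJ N) ℤ)[X])
    (hU3 : ∀ (B : Type) [CommRing B] (c : JJ N → B) (τ : ∀ i, Fin (N i) → B),
        U.map (zev (Sum.elim c (cf τ)))
          = ∏ g : ∀ i, Equiv.Perm (Fin (N i)), (X - C (lf c τ g)))
    {Fq k : Type} [Field Fq] [Fintype Fq] [Field k] [IsAlgClosed k] [Algebra Fq k]
    (F : Fin m → Fq[X][X]) (F' : Fin m → k[X][X]) (hF' : ∀ i, F' i = (F i).map (mapRingHom (algebraMap Fq k)))
    (hN : ∀ i, (F' i).natDegree * n = N i)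
    (hs : ∀ i, ∀ j ≤ (F' i).natDegree, ((F' i).coeff j).natDegree ≤ ((F' i).natDegree - j) * n)
    (c : JJ N → k) (a : Fin n → Fq) (a0 : Fin n → k) (ha0 : ∀ l, a0 l = algebraMap Fq k (a l))
    (hLam : ∀ i, (Lam n (F' i)).eval (a0 ⟨n - 1, by omega⟩) ≠ 0) (u : Fq)
    (hinj : ∀ y : (∀ i, Equiv.Perm (Fin (N i))) → k,
          (U.map (zev (Sum.elim (fun x => C (c x)) (fun x => (bgen n N F' x).map (MvPolynomial.eval a0))))).map
            (evalRingHom (algebraMap Fq k u)) = ∏ g, (X - C (y g)) → Function.Injective y) :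
    ∃ (τ : ∀ i, Fin (N i) → k) (π : ∀ i, Equiv.Perm (Fin (N i))),
      (∀ x, cf τ x = ((bgen n N F' x).map (MvPolynomial.eval a0)).eval (algebraMap Fq k u)) ∧
      Function.Injective (fun g => lf c τ g) ∧
      (∀ i j, τ i j ^ Fintype.card Fq = τ i (π i j)) ∧
      ∀ i (M : Multiset ℕ), (∀ b ∈ M, 1 ≤ b) → M.sum = N i →
        ((UniqueFactorizationMonoid.factors (eval (fp n (ac u a)) (F i))).map natDegree = M ↔
          (π i).cycleType = M.filter (fun b => 2 ≤ b)) := by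
  classical
  set h : (RR k n)[X] →+* k := (evalRingHom (algebraMap Fq k u)).comp (mapRingHom (MvPolynomial.eval a0)) with hh
  have hψ : h.comp (kR k n) = RingHom.id k := by
    ext x
    simp [hh, kR]
  have hA : ∀ l ≤ n, h (Agen k n l) = algebraMap Fq k (ac u a l) := by
    intro l hl
    unfold Agen ac
    split_ifs with h1 h2
    · simp [hh]
    · simp [hh, ha0]
    · simp
  have hW := fun i => wgen_map h hψ hA (F' i)
  set f : Fq[X] := fp n (ac u a) with hf
  have hfm : fp n (fun l => algebraMap Fq k (ac u a l)) = f.map (algebraMap Fq k) := by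
    rw [hf, fp_map]
  have hacn : algebraMap Fq k (ac u a n) = a0 ⟨n - 1, by omega⟩ := by
    rw [ha0]
    congr 1
    unfold ac
    rw [if_neg (by omega), dif_pos (by omega)]
  have hfn : (f.map (algebraMap Fq k)).coeff n = algebraMap Fq k (ac u a n) := by
    rw [coeff_map, hf, fp_coeff, if_pos le_rfl]
  have hfd : (f.map (algebraMap Fq k)).natDegree ≤ n := natDegree_map_le.trans (fp_natDegree_le _)
  have hΛ : ∀ i, h (lgen n (F' i)) ≠ 0 := by
    intro i
    rw [(hW i).2, hacn]
    exact hLam i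
  have hwW : ∀ i, (eval f (F i)).map (algebraMap Fq k) = Wp (RingHom.id k) (F' i) (f.map (algebraMap Fq k)) := by
    intro i
    unfold Wp
    rw [hF', eval₂_map, eval, ← coe_mapRingHom, hom_eval₂]
    congr 1
    ext x <;> simp
  have hex : ∀ i, ∃ t : Fin (N i) → k, (wgen n (F' i)).map h = C (h (lgen n (F' i))) * ∏ j, (X - C (t j)) := by
    intro i
    have h1 : eval₂ (RingHom.id k) ((f.map (algebraMap Fq k)).coeff n) (Lam n (F' i)) = h (lgen n (F' i)) := by
      rw [(hW i).2, hfn]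
    obtain ⟨t, ht⟩ := roots_exist (ψ := RingHom.id k) (hs i) (hN i) hfd (by rw [h1]; exact hΛ i)
    refine ⟨t, ?_⟩
    rw [(hW i).1, hfm, ht, h1]
  choose t ht using hex
  have hw : ∀ i, (eval f (F i)).map (algebraMap Fq k) = C (h (lgen n (F' i))) * ∏ j, (X - C (t i j)) := by
    intro i
    rw [hwW, ← hfm, ← (hW i).1, ht]
  have hΛq : ∀ i, h (lgen n (F' i)) ^ Fintype.card Fq = h (lgen n (F' i)) := by
    intro i
    have h1 : algebraMap Fq k (eval f (F i)).leadingCoeff = h (lgen n (F' i)) := by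
      rw [← leadingCoeff_map, hw, leadingCoeff_mul, leadingCoeff_C,
        (monic_prod_of_monic _ _ fun j _ => monic_X_sub_C _).leadingCoeff, mul_one]
    rw [← h1, ← map_pow, FiniteField.pow_card]
  have hcf := cf_scale h t ht
  set τ : ∀ i, Fin (N i) → k := fun i j => h (lgen n (F' i)) * t i j with hτ
  have hcf' : ∀ x, cf τ x = ((bgen n N F' x).map (MvPolynomial.eval a0)).eval (algebraMap Fq k u) := by
    intro x
    rw [hcf]; rfl
  have hlf : Function.Injective (fun g => lf c τ g) := by
    apply hinj
    rw [← hU3 k c τ, Polynomial.map_map]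
    congr 1
    apply MvPolynomial.ringHom_ext
    · intro z; simp
    · rintro (x | x)
      · simp
      · simp only [RingHom.comp_apply, zev_X, Sum.elim_inr, coe_evalRingHom]
        rw [hcf' x]
  have htinj : ∀ i, Function.Injective (t i) := by
    intro i j1 j2 hj
    by_contra hne
    have h1 : lf c τ (Function.update 1 i (Equiv.swap j1 j2)) = lf c τ 1 := by
      unfold lf
      refine Finset.sum_congr rfl fun x _ => ?_
      obtain ⟨i', j'⟩ := x
      by_cases hi : i' = i
      · subst hi
        simp only [Function.update_self, Pi.one_apply, Equiv.Perm.one_apply, hτ]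
        rcases eq_or_ne j' j1 with rfl | hj1
        · rw [Equiv.swap_apply_left, hj]
        · rcases eq_or_ne j' j2 with rfl | hj2
          · rw [Equiv.swap_apply_right, hj]
          · rw [Equiv.swap_apply_of_ne_of_ne hj1 hj2]
      · simp only [Function.update_of_ne hi]
    have h2 := congrFun (hlf h1) i
    rw [Function.update_self] at h2
    have h3 := congrArg (fun e : Equiv.Perm _ => e j1) h2
    simp at h3
    exact hne h3.symm
  have hπ := fun i => frob_perm (htinj i) (hΛ i) (hw i)
  choose π hπ using hπ
  refine ⟨τ, π, hcf', hlf, ?_, ?_⟩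
  · intro i j
    simp only [hτ]
    rw [mul_pow, hΛq, hπ]
  · intro i M hM hMs
    exact factors_iff (htinj i) (hπ i) (hΛ i) (hw i) hM hMs

end BH

namespace BH

theorem card_T {m : ℕ} (N : Fin m → ℕ) (M : Fin m → Multiset ℕ) [DecidableEq (∀ i, Equiv.Perm (Fin (N i)))]
    (T : Finset (∀ i, Equiv.Perm (Fin (N i)))) (hT : ∀ σ, σ ∈ T ↔ ∀ i, (σ i).cycleType = M i) :
    (T.card : ℝ) / Fintype.card (∀ i, Equiv.Perm (Fin (N i))) =
      ∏ i, ((Nat.card {σ : Equiv.Perm (Fin (N i)) // σ.cycleType = M i} : ℝ) / (Nat.factorial (N i) : ℝ)) := by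
  classical
  have h1 : T = Fintype.piFinset (fun i => (Finset.univ : Finset (Equiv.Perm (Fin (N i)))).filter
      fun σ => σ.cycleType = M i) := by
    ext σ
    simp [hT]
  rw [Finset.prod_div_distrib, h1, Fintype.card_piFinset, Fintype.card_pi, Nat.cast_prod, Nat.cast_prod]
  congr 1
  · refine Finset.prod_congr rfl fun i _ => ?_
    rw [Nat.card_eq_fintype_card, Fintype.card_subtype]
  · refine Finset.prod_congr rfl fun i _ => ?_
    rw [Fintype.card_perm, Fintype.card_fin]

theorem line_count {m n : ℕ} (hn : 3 ≤ n) (r : Fin m → ℕ) (hr0 : ∀ i, 0 < r i) :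
    ∃ (E : ℕ) (K : ℝ), 0 ≤ K ∧ ∀ (Fq : Type) [Field Fq] [Fintype Fq] (F : Fin m → Fq[X][X]),
      (∀ i, (F i).Monic) → (∀ i, (F i).natDegree = r i) →
      (∀ i, Irreducible ((F i).map (mapRingHom (algebraMap Fq (AlgebraicClosure Fq))))) →
      (∀ i, derivative (F i) ≠ 0) → Function.Injective F →
      (∀ i, ∀ j ≤ (F i).natDegree, ((F i).coeff j).natDegree ≤ ((F i).natDegree - j) * n) →
      ∃ Q : RR (AlgebraicClosure Fq) n, Q ≠ 0 ∧ Q.totalDegree ≤ E ∧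
        ∀ a : Fin n → Fq, MvPolynomial.eval (fun l => algebraMap Fq (AlgebraicClosure Fq) (a l)) Q ≠ 0 →
          a ⟨n - 1, by omega⟩ ≠ 0 ∧ ∀ M : Fin m → Multiset ℕ, (∀ i, ∀ b ∈ M i, 1 ≤ b) → (∀ i, (M i).sum = r i * n) →
          |(Nat.card {u : Fq // ∀ i, (UniqueFactorizationMonoid.factors (eval (fp n (ac u a)) (F i))).map natDegree = M i} : ℝ)
            - (∏ i, ((Nat.card {σ : Equiv.Perm (Fin (r i * n)) // σ.cycleType = (M i).filter (fun b => 2 ≤ b)} : ℝ)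
              / (Nat.factorial (r i * n) : ℝ))) * Fintype.card Fq| ≤ K * Real.sqrt (Fintype.card Fq) := by
  classical
  set N : Fin m → ℕ := fun i => r i * n with hN
  obtain ⟨U, V, hU1, hU2, hU3, hV⟩ := resolvent' m N
  obtain ⟨E, e, Eb, hgood⟩ := good_Q hn r hr0 (N := N) (fun i => rfl) U hU1 hU2 hU3
  obtain ⟨Cst, hC0, hline⟩ := line_sigma U V hU1 hU2 hU3 hV Eb
  refine ⟨E, 2 * e + Cst, by positivity, ?_⟩
  intro Fq _ _ F hmon hr hirr hsep hinj hs
  set k := AlgebraicClosure Fq with hk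
  set ι : Fq →+* k := algebraMap Fq k with hι
  have hιi : Function.Injective ι := ι.injective
  have hmi : Function.Injective (mapRingHom ι) := Polynomial.map_injective _ hιi
  set F' : Fin m → k[X][X] := fun i => (F i).map (mapRingHom ι) with hF'
  have hd' : ∀ i, (F' i).natDegree = r i := fun i => by
    rw [hF', ← hr i]; exact (hmon i).natDegree_map _
  have hs' : ∀ i, ∀ j ≤ (F' i).natDegree, ((F' i).coeff j).natDegree ≤ ((F' i).natDegree - j) * n := by
    intro i j hj
    rw [hd', ← hr] at hj ⊢
    refine le_trans ?_ (hs i j hj)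
    simp only [hF', coeff_map, coe_mapRingHom]
    exact natDegree_map_le
  obtain ⟨hBd, c, Q, hQ0, hQd, hQ⟩ := hgood k F' (fun i => (hmon i).map _) hd' hirr
    (fun i h => by
      rw [hF', derivative_map] at h
      exact hsep i (Polynomial.map_injective _ hmi (by rw [h, Polynomial.map_zero])))
    (fun i j h => hinj (Polynomial.map_injective _ hmi h)) hs'
  refine ⟨Q, hQ0, hQd, ?_⟩
  intro a haQ
  set a0 : Fin n → k := fun l => ι (a l) with ha0
  obtain ⟨h1, h2, h3, bad, hbad, h4⟩ := hQ a0 haQ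
  refine ⟨fun h => h1 (by rw [ha0]; simp only; rw [h, map_zero]), ?_⟩
  intro M hM hMs
  obtain ⟨α, hp, hcard⟩ := FiniteField.card Fq (ringChar Fq)
  have : Fact (ringChar Fq).Prime := ⟨hp⟩
  have : CharP k (ringChar Fq) := charP_of_injective_algebraMap hιi _
  set p := ringChar Fq with hpdef
  set q := Fintype.card Fq with hq
  set G0 : Finset Fq := Finset.univ.filter fun u => ι u ∉ bad with hG0
  set G : Finset k := G0.map ⟨ι, hιi⟩ with hG
  have hex : ∀ x : k, ∃ (τ : ∀ i, Fin (N i) → k) (π : ∀ i, Equiv.Perm (Fin (N i))), x ∈ G → ∀ u, ι u = x →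
      (∀ y, cf τ y = ((bgen n N F' y).map (MvPolynomial.eval a0)).eval x) ∧
      Function.Injective (fun g => lf c τ g) ∧
      (∀ i j, τ i j ^ q = τ i (π i j)) ∧
      ∀ i (M : Multiset ℕ), (∀ b ∈ M, 1 ≤ b) → M.sum = N i →
        ((UniqueFactorizationMonoid.factors (eval (fp n (ac u a)) (F i))).map natDegree = M ↔
          (π i).cycleType = M.filter (fun b => 2 ≤ b)) := by
    intro x
    by_cases hx : x ∈ G
    · obtain ⟨u, hu, hux⟩ := Finset.mem_map.1 hx
      have hux' : ι u = x := hux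
      have hub : ι u ∉ bad := (Finset.mem_filter.1 hu).2
      obtain ⟨τ, π, e1, e2, e3, e4⟩ := point_data hn U hU3 F F' (fun i => rfl) (fun i => by rw [hd' i]) hs' c a a0
        (fun l => rfl) h2 u (h4 _ hub)
      refine ⟨τ, π, fun _ u' hu' => ?_⟩
      have : u' = u := hιi (hu'.trans hux'.symm)
      subst this
      refine ⟨?_, e2, e3, e4⟩
      intro y
      rw [← hux']
      exact e1 y
    · exact ⟨fun _ _ => 0, fun _ => 1, fun h => absurd h hx⟩
  choose τ π hτπ using hex
  have hGu : ∀ x ∈ G, ∃ u, ι u = x := by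
    intro x hx
    obtain ⟨u, _, hux⟩ := Finset.mem_map.1 hx
    exact ⟨u, hux⟩
  have hK := hline k p α α.ne_zero c (fun x => (bgen n N F' x).map (MvPolynomial.eval a0))
    (fun x => natDegree_map_le.trans (hBd x).1) h3 G τ π (by
      intro x hx
      obtain ⟨u, rfl⟩ := hGu x hx
      obtain ⟨e1, e2, e3, _⟩ := hτπ _ hx u rfl
      rw [← hcard]
      exact ⟨by rw [← map_pow, FiniteField.pow_card], e1, e2, e3⟩)
  rw [← hcard] at hK
  set T : Finset (∀ i, Equiv.Perm (Fin (N i))) := Finset.univ.filter fun σ =>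
    ∀ i, (σ i).cycleType = (M i).filter (fun b => 2 ≤ b) with hT
  have hTm : ∀ σ, σ ∈ T ↔ ∀ i, (σ i).cycleType = (M i).filter (fun b => 2 ≤ b) := by
    intro σ; simp [hT]
  have hsq : (1 : ℝ) ≤ Real.sqrt q := by
    rw [Real.one_le_sqrt]
    exact_mod_cast Fintype.card_pos
  have hcount : q ≤ G0.card + e := by
    have h5 := Finset.card_add_card_compl G0
    have h6 : G0ᶜ.card ≤ bad.card := by
      apply Finset.card_le_card_of_injOn ι
      · intro u hu
        simpa [hG0] using hu
      · exact hιi.injOn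
    omega
  have hGc : G.card = G0.card := by rw [hG, Finset.card_map]
  have hts := two_sided G π (q : ℝ) e (Cst * Real.sqrt q) (by positivity) (by
      rw [hGc]
      have : (q : ℝ) ≤ G0.card + e := by exact_mod_cast hcount
      linarith) (by positivity) (fun σ => by convert hK σ) T (by
      intro g σ
      rw [hTm, hTm]
      refine forall_congr' fun i => ?_
      have : (g⁻¹ * σ * g) i = (g i)⁻¹ * σ i * ((g i)⁻¹)⁻¹ := by simp
      rw [this, Equiv.Perm.cycleType_conj])
  rw [card_T N _ T hTm] at hts
  set P : Fq → Prop := fun u => ∀ i, (UniqueFactorizationMonoid.factors (eval (fp n (ac u a)) (F i))).map natDegree = M i with hP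
  have hGP : (G.filter fun x => π x ∈ T).card = (G0.filter P).card := by
    have : (G.filter fun x => π x ∈ T) = (G0.filter P).map ⟨ι, hιi⟩ := by
      rw [hG, Finset.filter_map]
      congr 1
      refine Finset.filter_congr fun u hu => ?_
      have hx : ι u ∈ G := Finset.mem_map.2 ⟨u, hu, rfl⟩
      obtain ⟨_, _, _, e4⟩ := hτπ _ hx u rfl
      change π (ι u) ∈ T ↔ P u
      rw [hTm]
      refine forall_congr' fun i => ?_
      exact (e4 i (M i) (hM i) (hMs i)).symm
    rw [this, Finset.card_map]
  have hPc : Nat.card {u : Fq // P u} = (Finset.univ.filter P).card := by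
    rw [Nat.card_eq_fintype_card, Fintype.card_subtype]
  have hPle : (G0.filter P).card ≤ (Finset.univ.filter P).card :=
    Finset.card_le_card (Finset.filter_subset_filter _ (Finset.subset_univ _))
  have hPge : (Finset.univ.filter P).card ≤ (G0.filter P).card + e := by
    have h7 : Finset.univ.filter P ⊆ (G0.filter P) ∪ G0ᶜ := by
      intro u hu
      by_cases h : u ∈ G0
      · exact Finset.mem_union_left _ (Finset.mem_filter.2 ⟨h, (Finset.mem_filter.1 hu).2⟩)
      · exact Finset.mem_union_right _ (Finset.mem_compl.2 h)
    have h8 := (Finset.card_le_card h7).trans (Finset.card_union_le _ _)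
    rw [Finset.card_compl] at h8
    omega
  rw [hGP] at hts
  change |(Nat.card {u : Fq // P u} : ℝ) - _| ≤ _
  rw [hPc]
  have h9 : ((G0.filter P).card : ℝ) ≤ (Finset.univ.filter P).card := by exact_mod_cast hPle
  have h10 : ((Finset.univ.filter P).card : ℝ) ≤ (G0.filter P).card + e := by exact_mod_cast hPge
  have he0 : (0 : ℝ) ≤ e := by positivity
  have h11 : (2 * e : ℝ) ≤ 2 * e * Real.sqrt q := le_mul_of_one_le_right (by positivity) hsq
  rw [abs_le] at hts ⊢
  rw [add_mul]
  obtain ⟨b1, b2⟩ := hts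
  constructor
  · linarith
  · linarith

end BH

namespace BH

theorem sz_count {Fq k : Type} [Field Fq] [Fintype Fq] [Field k] (ι : Fq →+* k) {n : ℕ} (hn : 1 ≤ n)
    {Q : RR k n} (hQ : Q ≠ 0) {E : ℕ} (hE : Q.totalDegree ≤ E) (B : Finset (Fin n → Fq))
    (hB : ∀ a ∈ B, MvPolynomial.eval (fun l => ι (a l)) Q = 0) :
    (B.card : ℝ) ≤ E * (Fintype.card Fq : ℝ) ^ (n - 1) := by
  classical
  set S : Finset k := Finset.univ.map ⟨ι, ι.injective⟩ with hS
  have hSc : S.card = Fintype.card Fq := by simp [hS]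
  have h := MvPolynomial.schwartz_zippel_totalDegree hQ S
  rw [hSc] at h
  have hq : 0 < Fintype.card Fq := Fintype.card_pos
  set Z := (Fintype.piFinset fun _ : Fin n => S).filter fun f => MvPolynomial.eval f Q = 0 with hZ
  have hBZ : B.card ≤ Z.card := by
    apply Finset.card_le_card_of_injOn (fun a l => ι (a l))
    · intro a ha
      simp only [hZ, Finset.coe_filter, Set.mem_ofPred_eq, Fintype.mem_piFinset]
      exact ⟨fun l => by simp [hS], hB a ha⟩
    · intro a _ b _ hab
      funext l
      exact ι.injective (congrFun hab l)
  have h1 : (Z.card : ℝ) / (Fintype.card Fq : ℝ) ^ n ≤ (Q.totalDegree : ℝ) / (Fintype.card Fq : ℝ) := by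
    have := (NNRat.cast_le (K := ℝ)).2 h
    push_cast at this
    exact this
  have hq' : (0 : ℝ) < Fintype.card Fq := by exact_mod_cast hq
  obtain ⟨n', rfl⟩ : ∃ n', n = n' + 1 := ⟨n - 1, by omega⟩
  rw [div_le_div_iff₀ (by positivity) hq', pow_succ, ← mul_assoc] at h1
  have h2 := le_of_mul_le_mul_right h1 hq'
  calc (B.card : ℝ) ≤ Z.card := by exact_mod_cast hBZ
    _ ≤ Q.totalDegree * (Fintype.card Fq : ℝ) ^ n' := h2
    _ ≤ E * (Fintype.card Fq : ℝ) ^ n' := by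
      gcongr

theorem sum_count {Fq : Type} [Fintype Fq] [Nonempty Fq] {n : ℕ} (hn : 1 ≤ n) (P : (Fin n → Fq) → Fq → Prop)
    (B : Finset (Fin n → Fq)) (E K ρ : ℝ) (hK : 0 ≤ K) (h0 : 0 ≤ ρ) (h1 : ρ ≤ 1)
    (hB : (B.card : ℝ) ≤ E * (Fintype.card Fq : ℝ) ^ (n - 1))
    (hP : ∀ a ∉ B, |(Nat.card {u : Fq // P a u} : ℝ) - ρ * Fintype.card Fq| ≤ K * Real.sqrt (Fintype.card Fq)) :
    |(Nat.card {au : (Fin n → Fq) × Fq // P au.1 au.2} : ℝ) - ρ * (Fintype.card Fq : ℝ) ^ (n + 1)| ≤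
      (E + K) * (Fintype.card Fq : ℝ) ^ n * Real.sqrt (Fintype.card Fq) := by
  classical
  set q : ℝ := (Fintype.card Fq : ℝ) with hq
  have hq1 : 1 ≤ q := by rw [hq]; exact_mod_cast Fintype.card_pos
  have hsq : 1 ≤ Real.sqrt q := by rwa [Real.one_le_sqrt]
  have hcard : Nat.card {au : (Fin n → Fq) × Fq // P au.1 au.2} = ∑ a : Fin n → Fq, Nat.card {u : Fq // P a u} := by
    rw [Nat.card_congr (Equiv.subtypeProdEquivSigmaSubtype P), Nat.card_sigma]
  have hsum : (Nat.card {au : (Fin n → Fq) × Fq // P au.1 au.2} : ℝ) - ρ * q ^ (n + 1)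
      = ∑ a : Fin n → Fq, ((Nat.card {u : Fq // P a u} : ℝ) - ρ * q) := by
    rw [hcard, Finset.sum_sub_distrib, Nat.cast_sum, Finset.sum_const, Finset.card_univ, Fintype.card_fun, Fintype.card_fin,
      nsmul_eq_mul, Nat.cast_pow, ← hq]
    ring
  have hbd : ∀ a, |(Nat.card {u : Fq // P a u} : ℝ) - ρ * q| ≤ (if a ∈ B then q else 0) + K * Real.sqrt q := by
    intro a
    split_ifs with h
    · have h2 : (Nat.card {u : Fq // P a u} : ℝ) ≤ q := by
        rw [hq]
        have := Nat.card_le_card_of_injective (Subtype.val : {u : Fq // P a u} → Fq) Subtype.val_injective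
        rw [Nat.card_eq_fintype_card (α := Fq)] at this
        exact_mod_cast this
      have h3 : (0 : ℝ) ≤ Nat.card {u : Fq // P a u} := by positivity
      have h4 : 0 ≤ ρ * q := by positivity
      have h5 : ρ * q ≤ q := mul_le_of_le_one_left (by linarith) h1
      have h6 : 0 ≤ K * Real.sqrt q := by positivity
      rw [abs_le]
      constructor <;> linarith
    · rw [zero_add]; exact hP a h
  rw [hsum]
  refine (Finset.abs_sum_le_sum_abs _ _).trans ((Finset.sum_le_sum fun a _ => hbd a).trans ?_)
  rw [Finset.sum_add_distrib, Finset.sum_const, Finset.card_univ, Fintype.card_fun, Fintype.card_fin,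
      nsmul_eq_mul, Nat.cast_pow, ← hq, ← Finset.sum_filter, Finset.sum_const, nsmul_eq_mul]
  have h7 : (Finset.univ.filter fun a => a ∈ B) = B := by simp
  rw [h7]
  have h8 : (B.card : ℝ) * q ≤ E * q ^ n := by
    obtain ⟨n', rfl⟩ : ∃ n', n = n' + 1 := ⟨n - 1, by omega⟩
    rw [pow_succ, ← mul_assoc]
    exact mul_le_mul_of_nonneg_right hB (by linarith)
  have h9 : E * q ^ n ≤ E * q ^ n * Real.sqrt q := by
    refine le_mul_of_one_le_right (le_trans ?_ h8) hsq
    positivity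
  calc (B.card : ℝ) * q + q ^ n * (K * Real.sqrt q) ≤ E * q ^ n * Real.sqrt q + q ^ n * (K * Real.sqrt q) := by linarith
    _ = _ := by ring

theorem card_poly {Fq : Type} [Field Fq] {n : ℕ} (hn : 1 ≤ n) (R : Fq[X] → Prop) :
    Nat.card {f : Fq[X] // f.degree = (n : ℕ) ∧ R f} =
      Nat.card {au : (Fin n → Fq) × Fq // au.1 ⟨n - 1, by omega⟩ ≠ 0 ∧ R (fp n (ac au.2 au.1))} := by
  have hco : ∀ (u : Fq) (a : Fin n → Fq) (l : Fin n), (fp n (ac u a)).coeff (l + 1) = a l := by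
    intro u a l
    have := l.2
    rw [fp_coeff, if_pos (by omega)]
    simp [ac]
  have hco0 : ∀ (u : Fq) (a : Fin n → Fq), (fp n (ac u a)).coeff 0 = u := by
    intro u a
    rw [fp_coeff, if_pos (by omega)]
    simp [ac]
  have hn' : n - 1 + 1 = n := by omega
  symm
  refine Nat.card_congr (Equiv.ofBijective
    (fun au => ⟨fp n (ac au.1.2 au.1.1), ?_, au.2.2⟩) ⟨?_, ?_⟩)
  · apply le_antisymm
    · exact degree_le_of_natDegree_le (fp_natDegree_le _)
    · apply le_degree_of_ne_zero
      have := hco au.1.2 au.1.1 ⟨n - 1, by omega⟩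
      simp only [hn'] at this
      rw [this]
      exact au.2.1
  · rintro ⟨⟨a, u⟩, h⟩ ⟨⟨a', u'⟩, h'⟩ he
    have he' : fp n (ac u a) = fp n (ac u' a') := congrArg Subtype.val he
    have e1 : a = a' := by
      funext l
      rw [← hco u a l, he', hco]
    have e2 : u = u' := by rw [← hco0 u a, he', hco0]
    subst e1 e2
    rfl
  · rintro ⟨f, hf, hR⟩
    have hfe : fp n (ac (f.coeff 0) (fun l : Fin n => f.coeff (l + 1))) = f := by
      ext l
      rw [fp_coeff]
      split_ifs with hl
      · unfold ac
        split_ifs with h1 h2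
        · rw [h1]
        · simp only [Nat.sub_one_add_one h1]
        · omega
      · rw [coeff_eq_zero_of_degree_lt]
        rw [hf]
        exact_mod_cast (not_le.1 hl)
    refine ⟨⟨(fun l : Fin n => f.coeff (l + 1), f.coeff 0), ?_, ?_⟩, ?_⟩
    · simp only [hn']
      exact coeff_ne_zero_of_eq_degree hf
    · simp only
      rw [hfe]; exact hR
    · exact Subtype.ext hfe

end BH

namespace BH

theorem slope_bound {K : Type} [Field K] {P : Polynomial (Polynomial K)} (hP : P.Monic) {n : ℕ}
    (h : slopeX P ≤ ((n : ℚ) : WithBot ℚ)) :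
    ∀ j ≤ P.natDegree, (P.coeff j).natDegree ≤ (P.natDegree - j) * n := by
  intro j hj
  rcases hj.eq_or_lt with rfl | hlt
  · rw [coeff_natDegree, hP.leadingCoeff]; simp
  · rcases eq_or_ne (P.coeff j) 0 with h0 | h0
    · rw [h0]; simp
    · have h1 : P.natDegree - j ∈ Finset.Icc 1 P.natDegree := by
        rw [Finset.mem_Icc]; omega
      have h2 := (Finset.le_sup (f := fun j : ℕ =>
        ((P.coeff (P.natDegree - j)).degree).map fun d : ℕ => (d : ℚ) / (j : ℚ)) h1).trans h
      rw [Nat.sub_sub_self hj, degree_eq_natDegree h0] at h2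
      have h3 : (((P.coeff j).natDegree : ℚ) / ((P.natDegree - j : ℕ) : ℚ)) ≤ (n : ℚ) := WithBot.coe_le_coe.1 h2
      have h4 : (0 : ℚ) < ((P.natDegree - j : ℕ) : ℚ) := by
        exact_mod_cast (by omega : 0 < P.natDegree - j)
      rw [div_le_iff₀ h4] at h3
      have h5 : (P.coeff j).natDegree ≤ n * (P.natDegree - j) := by exact_mod_cast h3
      rw [mul_comm]; exact h5

theorem natDegree_le_totalDeg {K : Type} [Field K] (P : Polynomial (Polynomial K)) : P.natDegree ≤ totalDeg P := by
  have := Finset.le_sup (f := fun j => j + (P.coeff j).natDegree) (Finset.self_mem_range_succ P.natDegree)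
  exact le_trans (Nat.le_add_right _ _) this

theorem deriv_ne_zero {K : Type} [Field K] {p : ℕ} [Fact p.Prime] [CharP K p] {P : Polynomial (Polynomial K)}
    (h : ∀ G : Polynomial (Polynomial K), P ≠ G.comp (X ^ p)) : derivative P ≠ 0 := by
  intro h0
  have h1 := expand_contract p h0 (Fact.out : p.Prime).ne_zero
  rw [expand_eq_comp_X_pow] at h1
  exact h _ h1.symm

theorem csp_nonneg (N : ℕ) {M : ℕ} (s : Fin M → ℕ) : 0 ≤ cycleStructureProb N s := by
  unfold cycleStructureProb; positivity

theorem csp_le_one (N : ℕ) {M : ℕ} (s : Fin M → ℕ) : cycleStructureProb N s ≤ 1 := by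
  unfold cycleStructureProb
  apply div_le_one_of_le₀ _ (by positivity)
  have h1 := Nat.card_le_card_of_injective (Subtype.val : {σ : Equiv.Perm (Fin N) //
      σ.cycleType = Multiset.filter (fun a => 2 ≤ a) (List.ofFn s : Multiset ℕ)} → _) Subtype.val_injective
  rw [Nat.card_eq_fintype_card (α := Equiv.Perm (Fin N)), Fintype.card_perm, Fintype.card_fin] at h1
  exact_mod_cast h1

theorem main_r {m n : ℕ} (hn : 3 ≤ n) (r : Fin m → ℕ) : ∃ K : ℝ, 0 ≤ K ∧
    ∀ (Fq : Type) [Field Fq] [Fintype Fq], ∀ F : Fin m → Polynomial (Polynomial Fq),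
        (∀ i, (F i).natDegree = r i) →
        (∀ i, 0 < (F i).natDegree) →
        (∀ i j, i ≠ j → ¬ Associated (F i) (F j)) →
        (∀ i, Irreducible ((F i).map (Polynomial.mapRingHom
          (algebraMap Fq (AlgebraicClosure Fq))))) →
        (∀ i, (F i).Monic) →
        (∀ i, ∀ G : Polynomial (Polynomial Fq),
          F i ≠ G.comp (Polynomial.X ^ ringChar Fq)) →
        (∀ i, slopeX (F i) ≤ ((n : ℚ) : WithBot ℚ)) →
        ∀ (M : Fin m → ℕ) (s : ∀ i, Fin (M i) → ℕ),
          (∀ i k, 1 ≤ s i k) →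
          (∀ i, ∑ k, s i k = (F i).natDegree * n) →
          |(Nat.card {f : Polynomial Fq //
                f.degree = (n : ℕ) ∧ ∀ i,
                  (UniqueFactorizationMonoid.factors
                      (Polynomial.eval f (F i))).map Polynomial.natDegree
                    = (List.ofFn (s i) : Multiset ℕ)} : ℝ)
              - (∏ i, cycleStructureProb ((F i).natDegree * n) (s i)) *
                (Fintype.card Fq : ℝ) ^ (n + 1)|
            ≤ K * (Fintype.card Fq : ℝ) ^ n * Real.sqrt (Fintype.card Fq) := by
  classical
  by_cases hr0 : ∀ i, 0 < r i
  swap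
  · refine ⟨0, le_rfl, ?_⟩
    intro Fq _ _ F hr hpos
    exact absurd (fun i => hr i ▸ hpos i) hr0
  obtain ⟨E, K, hK0, hlc⟩ := line_count hn r hr0
  refine ⟨E + K, by positivity, ?_⟩
  intro Fq _ _ F hr hpos hass hirr hmon hsep hsl M s hs1 hsum
  have hp : Fact (ringChar Fq).Prime := by
    obtain ⟨α, hp, _⟩ := FiniteField.card Fq (ringChar Fq)
    exact ⟨hp⟩
  obtain ⟨Q, hQ0, hQd, hQ⟩ := hlc Fq F hmon hr hirr (fun i => deriv_ne_zero (p := ringChar Fq) (hsep i))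
    (fun i j hij => by
      by_contra hne
      exact hass i j hne (by rw [hij]))
    (fun i => slope_bound (hmon i) (hsl i))
  obtain rfl : r = fun i => (F i).natDegree := funext fun i => (hr i).symm
  rw [card_poly (by omega) (fun f => ∀ i, (UniqueFactorizationMonoid.factors
                      (Polynomial.eval f (F i))).map Polynomial.natDegree
                    = (List.ofFn (s i) : Multiset ℕ))]
  set B : Finset (Fin n → Fq) := Finset.univ.filter fun a =>
    MvPolynomial.eval (fun l => algebraMap Fq (AlgebraicClosure Fq) (a l)) Q = 0 with hB
  have hBc := sz_count (algebraMap Fq (AlgebraicClosure Fq)) (by omega : 1 ≤ n) hQ0 hQd B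
    (fun a ha => (Finset.mem_filter.1 ha).2)
  refine sum_count (by omega : 1 ≤ n) (fun a u => a ⟨n - 1, by omega⟩ ≠ 0 ∧
    ∀ i, (UniqueFactorizationMonoid.factors (Polynomial.eval (fp n (ac u a)) (F i))).map Polynomial.natDegree
                    = (List.ofFn (s i) : Multiset ℕ)) B E K _ hK0
    (Finset.prod_nonneg fun i _ => csp_nonneg _ _)
    (Finset.prod_le_one (fun i _ => csp_nonneg _ _) (fun i _ => csp_le_one _ _)) hBc ?_
  intro a ha
  have hne : MvPolynomial.eval (fun l => algebraMap Fq (AlgebraicClosure Fq) (a l)) Q ≠ 0 := by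
    intro h0
    exact ha (Finset.mem_filter.2 ⟨Finset.mem_univ _, h0⟩)
  obtain ⟨h1, h2⟩ := hQ a hne
  have h3 := h2 (fun i => (List.ofFn (s i) : Multiset ℕ)) (by
    intro i b hb
    rw [Multiset.mem_coe, List.mem_ofFn] at hb
    obtain ⟨k, rfl⟩ := hb
    exact hs1 i k) (by
    intro i
    rw [Multiset.sum_coe, List.sum_ofFn]
    exact hsum i)
  simp only [h1, ne_eq, not_false_eq_true, true_and]
  exact h3

end BH

/-- decomposition statistics.  For every `m ≥ 1`, degrees `d_i`, and
`n ≥ 3` there is `C` such that for every finite field `F_q`, all pairwise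
non-associate absolutely irreducible `F_i ∈ F_q[t][x]` monic in `x`, separable over
`F_q(t)`, with `deg F_i = d_i`, `deg_x F_i = r_i > 0` and `n ≥ sl F_i`, and every
choice of partitions `N_i = r_i n = Σ_k s_{ik}` (`s_{ik} ≥ 1`), the number of `f` with
`deg f = n` such that each `F_i(t,f)` factors into irreducibles of degrees
`s_{i1},…,s_{iM_i}` differs from `(∏_i P(s_{i1},…,s_{iM_i})) q^{n+1}` by at most
`C q^{n+1/2}`. -/
theorem bateman_horn_decomposition_statistics
    (m : ℕ) (hm : 1 ≤ m) (d : Fin m → ℕ) (n : ℕ) (hn : 3 ≤ n) :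
    ∃ C : ℝ, ∀ (Fq : Type) [Field Fq] [Fintype Fq],
      ∀ F : Fin m → Polynomial (Polynomial Fq),
        (∀ i, totalDeg (F i) = d i) →
        (∀ i, 0 < (F i).natDegree) →
        (∀ i j, i ≠ j → ¬ Associated (F i) (F j)) →
        (∀ i, Irreducible ((F i).map (Polynomial.mapRingHom
          (algebraMap Fq (AlgebraicClosure Fq))))) →
        (∀ i, (F i).Monic) →
        (∀ i, ∀ G : Polynomial (Polynomial Fq),
          F i ≠ G.comp (Polynomial.X ^ ringChar Fq)) →
        (∀ i, slopeX (F i) ≤ ((n : ℚ) : WithBot ℚ)) →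
        ∀ (M : Fin m → ℕ) (s : ∀ i, Fin (M i) → ℕ),
          (∀ i k, 1 ≤ s i k) →
          (∀ i, ∑ k, s i k = (F i).natDegree * n) →
          |(Nat.card {f : Polynomial Fq //
                f.degree = (n : ℕ) ∧ ∀ i,
                  (UniqueFactorizationMonoid.factors
                      (Polynomial.eval f (F i))).map Polynomial.natDegree
                    = (List.ofFn (s i) : Multiset ℕ)} : ℝ)
              - (∏ i, cycleStructureProb ((F i).natDegree * n) (s i)) *
                (Fintype.card Fq : ℝ) ^ (n + 1)|
            ≤ C * (Fintype.card Fq : ℝ) ^ n * Real.sqrt (Fintype.card Fq) := by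
  classical
  choose K hK0 hK using fun r : Fin m → ℕ => BH.main_r (m := m) hn r
  refine ⟨∑ r ∈ Fintype.piFinset (fun i => Finset.range (d i + 1)), K r, ?_⟩
  intro Fq _ _ F hd hpos hass hirr hmon hsep hsl M s hs1 hsum
  refine (hK (fun i => (F i).natDegree) Fq F (fun i => rfl) hpos hass hirr hmon hsep hsl M s hs1 hsum).trans ?_
  have hle : K (fun i => (F i).natDegree) ≤ ∑ r ∈ Fintype.piFinset (fun i => Finset.range (d i + 1)), K r := by
    apply Finset.single_le_sum (f := K) (fun r _ => hK0 r)
    rw [Fintype.mem_piFinset]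
    intro i
    rw [Finset.mem_range, ← hd i]
    have := BH.natDegree_le_totalDeg (F i)
    omega
  gcongr
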